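/- Let q₁ < q₂ < ⋯ < q_{n−1} be real numbers and let v ∈ C²(closure(ℝ²₊) \ {q₁,…,q_{n−1}}) be a solution of problem (+s) with K = 1 satisfying ∫_{ℝ²₊} e^v < ∞. Then the Schwarzian map Q = v_zz − (1/2)v_z² of v is given by Q(z) = Σ_{i=1}^{n−1} ( α_i/(z − q_i)² + β_i/(z − q_i) ), where the real numbers α_i, β_i satisfy α_i ≤ 1/2 for all i, Σ_{i=1}^{n−1} β_i = 0, and Σ_{i=1}^{n−1} (α_i + q_i β_i) ≤ 1/2. -/

import Mathlib

open Complex Set Filter MeasureTheory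

/-- The Laplacian Δv = v_ss + v_tt of a function v : ℂ → ℝ, identifying ℂ ≅ ℝ². -/
noncomputable def lap (v : ℂ → ℝ) (z : ℂ) : ℝ :=
  fderiv ℝ (fun w => fderiv ℝ v w 1) z 1 +
  fderiv ℝ (fun w => fderiv ℝ v w Complex.I) z Complex.I

/-- The boundary derivative ∂v/∂t at a real point s, taken within the closed upper
half-plane. -/
noncomputable def dnu (v : ℂ → ℝ) (s : ℝ) : ℝ :=
  fderivWithin ℝ v {w : ℂ | 0 ≤ w.im} (s : ℂ) Complex.I

/-- v_z = (v_s − i v_t)/2, with derivatives taken within the closed upper half-plane. -/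
noncomputable def vzc (v : ℂ → ℝ) (z : ℂ) : ℂ :=
  (((fderivWithin ℝ v {w : ℂ | 0 ≤ w.im} z 1 : ℝ) : ℂ)
    - Complex.I * ((fderivWithin ℝ v {w : ℂ | 0 ≤ w.im} z Complex.I : ℝ) : ℂ)) / 2

/-- The Schwarzian map Q = v_zz − (1/2) v_z² of a solution v of the Liouville equation. -/
noncomputable def schwarzianMap (v : ℂ → ℝ) (z : ℂ) : ℂ :=
  (fderivWithin ℝ (vzc v) {w : ℂ | 0 ≤ w.im} z 1
    - Complex.I * fderivWithin ℝ (vzc v) {w : ℂ | 0 ≤ w.im} z Complex.I) / 2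
  - (vzc v z) ^ 2 / 2

/-- Problem (+s): v ∈ C²(closure(ℝ²₊) \ {q₁,…,q_m}) with Δv + 2K e^v = 0 in ℝ²₊ and
∂v/∂t = c_j e^{v/2} on each boundary interval I_j = (q_j, q_{j+1}) (where
q₀ = −∞, q_{m+1} = +∞); the interval membership is encoded via the order relations
with the boundary singularities. -/
def IsSolutionPS (K : ℝ) (m : ℕ) (q : Fin m → ℝ) (c : Fin (m + 1) → ℝ)
    (v : ℂ → ℝ) : Prop :=
  ContDiffOn ℝ 2 v ({z : ℂ | 0 ≤ z.im} \ (Set.range fun i => (q i : ℂ))) ∧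
  (∀ z : ℂ, 0 < z.im → lap v z + 2 * K * Real.exp (v z) = 0) ∧
  (∀ j : Fin (m + 1), ∀ s : ℝ,
    (∀ i : Fin m, ((i : ℕ) < (j : ℕ) → q i < s) ∧ ((j : ℕ) ≤ (i : ℕ) → s < q i)) →
    dnu v s = c j * Real.exp (v (s : ℂ) / 2))

section Part1
open scoped Topology

/-- `LapAt f z L`: `f` is twice differentiable along coordinate lines at `z`, with Laplacian `L`. -/
def LapAt (f : ℂ → ℝ) (z : ℂ) (L : ℝ) : Prop :=
  ∃ fs ft : ℂ → ℝ, ∃ a b : ℝ,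
    (∀ᶠ w in 𝓝 z, HasDerivAt (fun τ : ℝ => f (w + τ)) (fs w) 0) ∧
    (∀ᶠ w in 𝓝 z, HasDerivAt (fun τ : ℝ => f (w + τ * I)) (ft w) 0) ∧
    HasDerivAt (fun τ : ℝ => fs (z + τ)) a 0 ∧
    HasDerivAt (fun τ : ℝ => ft (z + τ * I)) b 0 ∧ a + b = L

theorem LapAt.add {f g : ℂ → ℝ} {z : ℂ} {L M : ℝ} (hf : LapAt f z L) (hg : LapAt g z M) :
    LapAt (fun w => f w + g w) z (L + M) := by
  obtain ⟨fs, ft, a, b, h1, h2, h3, h4, h5⟩ := hf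
  obtain ⟨gs, gt, a', b', k1, k2, k3, k4, k5⟩ := hg
  refine ⟨fun w => fs w + gs w, fun w => ft w + gt w, a + a', b + b', ?_, ?_, h3.add k3,
    h4.add k4, by rw [← h5, ← k5]; ring⟩
  · filter_upwards [h1, k1] with w h k using h.add k
  · filter_upwards [h2, k2] with w h k using h.add k

theorem LapAt.const_mul {f : ℂ → ℝ} {z : ℂ} {L : ℝ} (c : ℝ) (hf : LapAt f z L) :
    LapAt (fun w => c * f w) z (c * L) := by
  obtain ⟨fs, ft, a, b, h1, h2, h3, h4, h5⟩ := hf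
  refine ⟨fun w => c * fs w, fun w => c * ft w, c * a, c * b, ?_, ?_, h3.const_mul c,
    h4.const_mul c, by rw [← h5]; ring⟩
  · filter_upwards [h1] with w h using h.const_mul c
  · filter_upwards [h2] with w h using h.const_mul c

theorem LapAt.neg {f : ℂ → ℝ} {z : ℂ} {L : ℝ} (hf : LapAt f z L) :
    LapAt (fun w => - f w) z (-L) := by
  have := hf.const_mul (-1)
  simpa using this

theorem LapAt.congr {f g : ℂ → ℝ} {z : ℂ} {L : ℝ} (hf : LapAt f z L) (h : f =ᶠ[𝓝 z] g) :
    LapAt g z L := by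
  obtain ⟨fs, ft, a, b, h1, h2, h3, h4, h5⟩ := hf
  refine ⟨fs, ft, a, b, ?_, ?_, h3, h4, h5⟩
  · filter_upwards [h1, h.eventually_nhds] with w hw hh
    refine hw.congr_of_eventuallyEq ?_
    have ht : Tendsto (fun τ : ℝ => w + (τ : ℂ)) (𝓝 0) (𝓝 w) := by
      have : Continuous (fun τ : ℝ => w + (τ : ℂ)) := by fun_prop
      simpa using this.tendsto 0
    filter_upwards [ht.eventually hh] with τ hτ using hτ.symm
  · filter_upwards [h2, h.eventually_nhds] with w hw hh
    refine hw.congr_of_eventuallyEq ?_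
    have ht : Tendsto (fun τ : ℝ => w + (τ : ℂ) * I) (𝓝 0) (𝓝 w) := by
      have : Continuous (fun τ : ℝ => w + (τ : ℂ) * I) := by fun_prop
      simpa using this.tendsto 0
    filter_upwards [ht.eventually hh] with τ hτ using hτ.symm

theorem LapAt.const (c : ℝ) (z : ℂ) : LapAt (fun _ => c) z 0 :=
  ⟨fun _ => 0, fun _ => 0, 0, 0, Eventually.of_forall fun _ => hasDerivAt_const _ _,
    Eventually.of_forall fun _ => hasDerivAt_const _ _, hasDerivAt_const _ _,
    hasDerivAt_const _ _, by simp⟩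

theorem LapAt.im (z : ℂ) : LapAt (fun w => w.im) z 0 := by
  refine ⟨fun _ => 0, fun _ => 1, 0, 0, Eventually.of_forall fun w => ?_,
    Eventually.of_forall fun w => ?_, hasDerivAt_const _ _, hasDerivAt_const _ _, by simp⟩
  · simpa using hasDerivAt_const (0:ℝ) w.im
  · simpa using (hasDerivAt_id (0:ℝ)).const_add w.im

theorem LapAt.sq_re (s : ℝ) (z : ℂ) : LapAt (fun w => (w.re - s) ^ 2) z 2 := by
  refine ⟨fun w => 2 * (w.re - s), fun _ => 0, 2, 0, Eventually.of_forall fun w => ?_,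
    Eventually.of_forall fun w => ?_, ?_, hasDerivAt_const _ _, by simp⟩
  · have := (((hasDerivAt_id (0:ℝ)).const_add w.re).sub_const s).fun_pow 2
    simpa using this
  · simpa using hasDerivAt_const (0:ℝ) ((w.re - s) ^ 2)
  · have := (((hasDerivAt_id (0:ℝ)).const_add z.re).sub_const s).const_mul 2
    simpa using this

theorem hasDerivAt_line {g : ℂ → ℂ} {g' : ℂ} {w : ℂ} (h : HasDerivAt g g' w) (d : ℂ) :
    HasDerivAt (fun τ : ℝ => g (w + τ * d)) (g' * d) 0 := by
  have h1 : HasDerivAt (fun τ : ℝ => w + (τ : ℂ) * d) d 0 := by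
    have := ((hasDerivAt_id (0:ℝ)).ofReal_comp.mul_const d).const_add w
    simpa using this
  have h2 : HasDerivAt g g' (w + ((0:ℝ) : ℂ) * d) := by simpa using h
  exact h2.comp (0:ℝ) h1

theorem hasDerivAt_re' {f : ℝ → ℂ} {f' : ℂ} {x : ℝ} (h : HasDerivAt f f' x) :
    HasDerivAt (fun τ => (f τ).re) f'.re x := reCLM.hasFDerivAt.comp_hasDerivAt x h

theorem LapAt.re_holo {g : ℂ → ℂ} {U : Set ℂ} (hU : IsOpen U) (hg : DifferentiableOn ℂ g U)
    {z : ℂ} (hz : z ∈ U) : LapAt (fun w => (g w).re) z 0 := by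
  have key : ∀ w ∈ U, HasDerivAt g (deriv g w) w := fun w hw =>
    (hg.differentiableAt (hU.mem_nhds hw)).hasDerivAt
  have key2 : HasDerivAt (deriv g) (deriv (deriv g) z) z :=
    ((hg.deriv hU).differentiableAt (hU.mem_nhds hz)).hasDerivAt
  refine ⟨fun w => (deriv g w).re, fun w => (deriv g w * I).re, (deriv (deriv g) z).re,
    (deriv (deriv g) z * I * I).re, ?_, ?_, ?_, ?_, ?_⟩
  · filter_upwards [hU.mem_nhds hz] with w hw
    have := hasDerivAt_line (key w hw) 1
    simpa using hasDerivAt_re' this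
  · filter_upwards [hU.mem_nhds hz] with w hw
    have := hasDerivAt_line (key w hw) I
    simpa using hasDerivAt_re' this
  · have := hasDerivAt_line key2 1
    simpa using hasDerivAt_re' this
  · have := (hasDerivAt_line key2 I).mul_const I
    exact hasDerivAt_re' this
  · rw [mul_assoc, I_mul_I]; simp

theorem snd_deriv_nonpos {g g' : ℝ → ℝ} {a : ℝ} (hm : IsLocalMax g 0)
    (h1 : ∀ᶠ τ in 𝓝 (0:ℝ), HasDerivAt g (g' τ) τ) (h2 : HasDerivAt g' a 0) : a ≤ 0 := by
  by_contra ha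
  push Not at ha
  have e : deriv g =ᶠ[𝓝 0] g' := h1.mono fun τ h => h.deriv
  have h2' : HasDerivAt (deriv g) a 0 := h2.congr_of_eventuallyEq e
  have hd0 : deriv g 0 = 0 := hm.deriv_eq_zero
  have hmin : IsLocalMin g 0 := isLocalMin_of_deriv_deriv_pos (by rw [h2'.deriv]; exact ha) hd0
    h1.self_of_nhds.continuousAt
  have hc : g =ᶠ[𝓝 0] fun _ => g 0 := by
    filter_upwards [hm, hmin] with x hx hx' using le_antisymm hx hx'
  have : deriv g =ᶠ[𝓝 0] fun _ => 0 := by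
    filter_upwards [hc.eventually_nhds] with x hx
    rw [Filter.EventuallyEq.deriv_eq hx]; simp
  have h3 := h2'.congr_of_eventuallyEq this.symm
  have := h3.unique (hasDerivAt_const (0:ℝ) (0:ℝ))
  linarith

theorem LapAt.nonpos_of_isLocalMax {f : ℂ → ℝ} {z : ℂ} {L : ℝ} (hf : LapAt f z L)
    (hm : IsLocalMax f z) : L ≤ 0 := by
  obtain ⟨fs, ft, a, b, h1, h2, h3, h4, h5⟩ := hf
  have aux : ∀ (d : ℂ) (fd : ℂ → ℝ) (a : ℝ),
      (∀ᶠ w in 𝓝 z, HasDerivAt (fun τ : ℝ => f (w + τ * d)) (fd w) 0) →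
      HasDerivAt (fun τ : ℝ => fd (z + τ * d)) a 0 → a ≤ 0 := by
    intro d fd a h1 h2
    have ht : Tendsto (fun τ : ℝ => z + (τ : ℂ) * d) (𝓝 0) (𝓝 z) := by
      have : Continuous (fun τ : ℝ => z + (τ : ℂ) * d) := by fun_prop
      simpa using this.tendsto 0
    refine snd_deriv_nonpos (g := fun τ : ℝ => f (z + τ * d)) ?_ ?_ h2
    · have := ht.eventually hm
      simpa [IsLocalMax, IsMaxFilter] using this
    · filter_upwards [ht.eventually h1] with τ hτ
      have h0 : HasDerivAt (fun σ : ℝ => f (z + τ * d + σ * d)) (fd (z + τ * d)) (τ - τ) := by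
        simpa using hτ
      have := h0.comp_sub_const τ τ
      refine this.congr_of_eventuallyEq (Eventually.of_forall fun x => ?_)
      simp only [ofReal_sub]; congr 1; ring
  have ha := aux 1 fs a (by simpa using h1) (by simpa using h3)
  have hb := aux I ft b h2 h4
  linarith

theorem deriv_nonpos_of_right_max {g : ℝ → ℝ} {d : ℝ}
    (hd : HasDerivWithinAt g d (Ici 0) 0) (hm : ∀ᶠ τ in 𝓝[>] (0:ℝ), g τ ≤ g 0) : d ≤ 0 := by
  have h := hasDerivWithinAt_iff_tendsto_slope.1 hd.Ioi_of_Ici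
  have hs : Ioi (0:ℝ) \ {0} = Ioi 0 := by simp
  rw [hs] at h
  refine le_of_tendsto h ?_
  filter_upwards [hm, self_mem_nhdsWithin] with τ h1 h2
  rw [slope_def_field]
  apply div_nonpos_of_nonpos_of_nonneg
  · linarith
  · simpa using (le_of_lt h2)

/-- folding the plane onto the closed upper half plane -/
noncomputable def foldH (z : ℂ) : ℂ := ⟨z.re, |z.im|⟩

theorem continuous_foldH : Continuous foldH := by
  have : foldH = fun z : ℂ => ((z.re : ℝ) : ℂ) + ((|z.im| : ℝ) : ℂ) * I := by
    ext z; apply Complex.ext <;> simp [foldH]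
  rw [this]
  have h : Continuous fun z : ℂ => |z.im| := continuous_abs.comp continuous_im
  fun_prop

theorem foldH_of_nonneg {z : ℂ} (h : 0 ≤ z.im) : foldH z = z := by
  apply Complex.ext <;> simp [foldH, abs_of_nonneg h]

theorem foldH_of_nonpos {z : ℂ} (h : z.im ≤ 0) : foldH z = (starRingEnd ℂ) z := by
  apply Complex.ext <;> simp [foldH, abs_of_nonpos h]

theorem foldH_im_nonneg (z : ℂ) : 0 ≤ (foldH z).im := abs_nonneg _

theorem foldH_dist_le {z z0 : ℂ} (h0 : 0 ≤ z0.im) : dist (foldH z) z0 ≤ dist z z0 := by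
  rw [Complex.dist_eq_re_im, Complex.dist_eq_re_im]
  apply Real.sqrt_le_sqrt
  have : (|z.im| - z0.im) ^ 2 ≤ (z.im - z0.im) ^ 2 := by
    nlinarith [le_abs_self z.im, sq_abs z.im]
  simpa [foldH] using this

theorem LapAt.conj {f : ℂ → ℝ} {z : ℂ} {L : ℝ} (hf : LapAt f ((starRingEnd ℂ) z) L) :
    LapAt (fun w => f ((starRingEnd ℂ) w)) z L := by
  obtain ⟨fs, ft, a, b, h1, h2, h3, h4, h5⟩ := hf
  have ht : Tendsto (starRingEnd ℂ) (𝓝 z) (𝓝 ((starRingEnd ℂ) z)) :=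
    Complex.continuous_conj.tendsto z
  refine ⟨fun w => fs ((starRingEnd ℂ) w), fun w => - ft ((starRingEnd ℂ) w), a, b, ?_, ?_, ?_, ?_, h5⟩
  · filter_upwards [ht.eventually h1] with w hw
    simpa using hw
  · filter_upwards [ht.eventually h2] with w hw
    have h0 : HasDerivAt (fun τ : ℝ => f ((starRingEnd ℂ) w + τ * I)) (ft ((starRingEnd ℂ) w)) (-0) := by
      simpa using hw
    have := h0.scomp (0:ℝ) (hasDerivAt_neg (0:ℝ))
    simpa [Function.comp_def] using this
  · simpa using h3
  · have h0 : HasDerivAt (fun τ : ℝ => ft ((starRingEnd ℂ) z + τ * I)) b (-0) := by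
      simpa using h4
    have := (h0.scomp (0:ℝ) (hasDerivAt_neg (0:ℝ))).neg
    refine HasDerivAt.congr_deriv (f' := -(-1 * b)) ?_ (by ring)
    refine (HasDerivAt.congr_of_eventuallyEq (by simpa using this) (Eventually.of_forall fun x => ?_))
    simp [Function.comp_def]

end Part1

section Part2
open scoped Topology

theorem trig_re_poly (h : C(AddCircle (2 * Real.pi), ℂ))
    (hh : h ∈ Submodule.span ℂ (range (@fourier (2 * Real.pi)))) :
    ∀ a : ℂ, ∃ p : Polynomial ℂ, ∀ θ : ℝ,
      (a * h (θ : AddCircle (2 * Real.pi))).re = (p.eval (Complex.exp (θ * I))).re := by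
  induction hh using Submodule.span_induction with
  | mem x hx =>
    obtain ⟨n, rfl⟩ := hx
    intro a
    have hf : ∀ θ : ℝ, (fourier n (θ : AddCircle (2 * Real.pi)) : ℂ)
        = Complex.exp (n * (θ * I)) := by
      intro θ
      rw [fourier_coe_apply]
      congr 1
      have : (Real.pi : ℂ) ≠ 0 := by exact_mod_cast Real.pi_ne_zero
      push_cast
      field_simp
    rcases le_total 0 n with hn | hn
    · lift n to ℕ using hn
      refine ⟨Polynomial.C a * Polynomial.X ^ n, fun θ => ?_⟩
      rw [hf]
      simp [← Complex.exp_nat_mul]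
    · obtain ⟨k, rfl⟩ : ∃ k : ℕ, n = -(k:ℤ) := ⟨n.natAbs, by omega⟩
      refine ⟨Polynomial.C ((starRingEnd ℂ) a) * Polynomial.X ^ k, fun θ => ?_⟩
      rw [hf]
      simp only [Polynomial.eval_mul, Polynomial.eval_C, Polynomial.eval_pow, Polynomial.eval_X,
        ← Complex.exp_nat_mul]
      have : (starRingEnd ℂ) a * Complex.exp (k * (θ * I))
          = (starRingEnd ℂ) (a * Complex.exp (((-(k:ℤ) : ℤ) : ℂ) * (θ * I))) := by
        rw [map_mul, ← Complex.exp_conj]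
        congr 2
        simp
      rw [this, Complex.conj_re]
  | zero => intro a; exact ⟨0, by simp⟩
  | add x y _ _ hx hy =>
    intro a
    obtain ⟨p, hp⟩ := hx a
    obtain ⟨q, hq⟩ := hy a
    refine ⟨p + q, fun θ => ?_⟩
    simp only [Polynomial.eval_add, Complex.add_re, ← hp, ← hq, ContinuousMap.add_apply, mul_add]
  | smul b x _ hx =>
    intro a
    obtain ⟨p, hp⟩ := hx (a * b)
    refine ⟨p, fun θ => ?_⟩
    rw [← hp]; simp [mul_assoc]

theorem approx_re_poly (g : ℝ → ℝ) (hc : Continuous g) (hp : Function.Periodic g (2 * Real.pi))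
    {ε : ℝ} (hε : 0 < ε) :
    ∃ p : Polynomial ℂ, ∀ θ : ℝ, |g θ - (p.eval (Complex.exp (θ * I))).re| ≤ ε := by
  have : Fact (0 < 2 * Real.pi) := ⟨Real.two_pi_pos⟩
  have hlift : Continuous (hp.lift : AddCircle (2 * Real.pi) → ℝ) :=
    continuous_coinduced_dom.2 hc
  let G : C(AddCircle (2 * Real.pi), ℂ) :=
    ⟨fun x => ((hp.lift x : ℝ) : ℂ), continuous_ofReal.comp hlift⟩
  have hG : G ∈ (Submodule.span ℂ (range (@fourier (2 * Real.pi)))).topologicalClosure := by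
    rw [span_fourier_closure_eq_top]; trivial
  rw [← SetLike.mem_coe, Submodule.topologicalClosure_coe, Metric.mem_closure_iff] at hG
  obtain ⟨h, hh, hd⟩ := hG ε hε
  obtain ⟨p, hp'⟩ := trig_re_poly h hh 1
  refine ⟨p, fun θ => ?_⟩
  rw [← hp' θ, one_mul]
  have h1 : dist (G (θ : AddCircle (2 * Real.pi))) (h θ) ≤ ε :=
    (ContinuousMap.dist_apply_le_dist _).trans hd.le
  have h2 : G (θ : AddCircle (2 * Real.pi)) = (g θ : ℂ) := by
    simp [G]
  rw [h2, Complex.dist_eq] at h1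
  calc |g θ - (h (θ : AddCircle (2 * Real.pi))).re| = |((g θ : ℂ) - h θ).re| := by simp
    _ ≤ _ := (Complex.abs_re_le_norm _).trans h1

/-- Sub-mean value property on circles, for the even reflection of a strictly subharmonic
function on the upper half plane with strictly positive normal derivative. -/
theorem subMean_circle (f : ℂ → ℝ) (z0 : ℂ) (hz0 : 0 ≤ z0.im) {ρ : ℝ} (hρ : 0 < ρ)
    (hc : ContinuousOn f (Metric.closedBall z0 ρ ∩ {z : ℂ | 0 ≤ z.im}))
    (hL : ∀ z ∈ Metric.ball z0 ρ, 0 < z.im → ∃ L > 0, LapAt f z L)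
    (hN : ∀ z ∈ Metric.ball z0 ρ, z.im = 0 →
      ∃ d > 0, HasDerivWithinAt (fun τ : ℝ => f (z + τ * I)) d (Ici 0) 0) :
    f z0 ≤ Real.circleAverage (fun z => f (foldH z)) z0 ρ := by
  have hfold : ∀ z ∈ Metric.closedBall z0 ρ,
      foldH z ∈ Metric.closedBall z0 ρ ∩ {z : ℂ | 0 ≤ z.im} := fun z hz =>
    ⟨(foldH_dist_le hz0).trans hz, foldH_im_nonneg z⟩
  have hcf : ContinuousOn (fun z => f (foldH z)) (Metric.closedBall z0 ρ) :=
    hc.comp continuous_foldH.continuousOn hfold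
  have hcm : ∀ θ, circleMap z0 ρ θ ∈ Metric.closedBall z0 ρ := fun θ =>
    circleMap_mem_closedBall _ hρ.le _
  set g : ℝ → ℝ := fun θ => f (foldH (circleMap z0 ρ θ)) with hg
  have hgc : Continuous g := by
    have := hcf.comp_continuous (continuous_circleMap z0 ρ) hcm
    exact this
  have hgp : Function.Periodic g (2 * Real.pi) := fun θ => by
    simp only [hg]; rw [periodic_circleMap]
  refine le_of_forall_pos_le_add fun ε hε => ?_
  obtain ⟨p, hp⟩ := approx_re_poly g hgc hgp (half_pos hε)
  set P : ℂ → ℂ := fun z => p.eval ((z - z0) / ρ) with hP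
  have hPd : Differentiable ℂ P := by
    intro z
    exact (p.differentiable _).comp z (by fun_prop)
  have hPc : ∀ θ, P (circleMap z0 ρ θ) = p.eval (Complex.exp (θ * I)) := by
    intro θ
    have : (ρ : ℂ) ≠ 0 := by exact_mod_cast hρ.ne'
    simp [hP, circleMap, this]
  -- maximum principle
  have hmax : ∀ z ∈ Metric.closedBall z0 ρ, f (foldH z) - (P z).re ≤ ε / 2 := by
    have hcont : ContinuousOn (fun z => f (foldH z) - (P z).re) (Metric.closedBall z0 ρ) :=
      hcf.sub (continuous_re.comp hPd.continuous).continuousOn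
    obtain ⟨zm, hzm, hmx⟩ := (isCompact_closedBall z0 ρ).exists_isMaxOn
      (Metric.nonempty_closedBall.2 hρ.le) hcont
    suffices hs : f (foldH zm) - (P zm).re ≤ ε / 2 from fun z hz => (hmx hz).trans hs
    by_cases hsph : zm ∈ Metric.sphere z0 ρ
    · have : zm ∈ range (circleMap z0 ρ) := by
        rw [range_circleMap, abs_of_pos hρ]; exact hsph
      obtain ⟨θ, rfl⟩ := this
      have := hp θ
      rw [← hPc] at this
      exact (le_abs_self _).trans this
    exfalso
    have hball : zm ∈ Metric.ball z0 ρ := by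
      rw [Metric.mem_ball]
      exact lt_of_le_of_ne hzm (fun h => hsph h)
    have hlm : IsLocalMax (fun z => f (foldH z) - (P z).re) zm := by
      filter_upwards [Metric.isOpen_ball.mem_nhds hball] with z hz
      exact hmx (Metric.ball_subset_closedBall hz)
    have hLP : LapAt (fun z => - (P z).re) zm 0 := by
      have := (LapAt.re_holo isOpen_univ hPd.differentiableOn (mem_univ zm)).neg
      simpa using this
    rcases lt_trichotomy zm.im 0 with him | him | him
    · have hconj : (starRingEnd ℂ) zm = foldH zm := (foldH_of_nonpos him.le).symm
      obtain ⟨L, hLpos, hLa⟩ := hL ((starRingEnd ℂ) zm) (by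
        rw [hconj]; exact (foldH_dist_le hz0).trans_lt hball) (by simpa using him)
      have h1 : LapAt (fun z => f (foldH z)) zm L := by
        refine hLa.conj.congr ?_
        filter_upwards [(continuous_im.isOpen_preimage _ isOpen_Iio).mem_nhds him] with w hw
        rw [foldH_of_nonpos (le_of_lt hw)]
      have := (h1.add hLP).nonpos_of_isLocalMax (by simpa [sub_eq_add_neg] using hlm)
      linarith
    · obtain ⟨d, hd, hder⟩ := hN zm hball him
      have hup : HasDerivWithinAt (fun τ : ℝ => f (foldH (zm + τ * I)) - (P (zm + τ * I)).re)
          (d - (deriv P zm * I).re) (Ici 0) 0 := by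
        refine HasDerivWithinAt.sub ?_ (hasDerivAt_re'
          (hasDerivAt_line (hPd zm).hasDerivAt I)).hasDerivWithinAt
        refine hder.congr (fun τ hτ => ?_) ?_
        · rw [foldH_of_nonneg]; simp [him]; exact hτ
        · rw [foldH_of_nonneg]; simp [him]
      have hdn : HasDerivWithinAt (fun τ : ℝ => f (foldH (zm + τ * (-I))) - (P (zm + τ * (-I))).re)
          (d - (deriv P zm * (-I)).re) (Ici 0) 0 := by
        refine HasDerivWithinAt.sub ?_ (hasDerivAt_re'
          (hasDerivAt_line (hPd zm).hasDerivAt (-I))).hasDerivWithinAt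
        have hee : ∀ τ : ℝ, 0 ≤ τ → foldH (zm + τ * (-I)) = zm + τ * I := by
          intro τ hτ
          rw [foldH_of_nonpos (by simp [him, hτ])]
          apply Complex.ext <;> simp [him]
        refine hder.congr (fun τ hτ => ?_) ?_
        · rw [hee τ hτ]
        · rw [hee 0 le_rfl]
      have hmm : ∀ e : ℂ, ∀ᶠ τ : ℝ in 𝓝[>] 0,
          f (foldH (zm + τ * e)) - (P (zm + τ * e)).re
            ≤ f (foldH (zm + (0:ℝ) * e)) - (P (zm + (0:ℝ) * e)).re := by
        intro e
        have ht : Tendsto (fun τ : ℝ => zm + (τ : ℂ) * e) (𝓝 0) (𝓝 zm) := by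
          have : Continuous (fun τ : ℝ => zm + (τ : ℂ) * e) := by fun_prop
          simpa using this.tendsto 0
        refine nhdsWithin_le_nhds ?_
        filter_upwards [ht.eventually hlm] with τ hτ
        simpa using hτ
      have h1 := deriv_nonpos_of_right_max hup (hmm I)
      have h2 := deriv_nonpos_of_right_max hdn (hmm (-I))
      simp at h1 h2
      linarith
    · obtain ⟨L, hLpos, hLa⟩ := hL zm hball him
      have h1 : LapAt (fun z => f (foldH z)) zm L := by
        refine hLa.congr ?_
        filter_upwards [(continuous_im.isOpen_preimage _ isOpen_Ioi).mem_nhds him] with w hw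
        rw [foldH_of_nonneg (le_of_lt hw)]
      have := (h1.add hLP).nonpos_of_isLocalMax (by simpa [sub_eq_add_neg] using hlm)
      linarith
  have hcen := hmax z0 (Metric.mem_closedBall_self hρ.le)
  rw [foldH_of_nonneg hz0] at hcen
  have hav : Real.circleAverage (fun z => (P z).re) z0 ρ = (P z0).re := by
    have h1 : Real.circleAverage P z0 ρ = P z0 :=
      DiffContOnCl.circleAverage (hPd.diffContOnCl)
    have h2 := reCLM.circleAverage_comp_comm (f := P) (c := z0) (R := ρ)
      (hPd.continuous.continuousOn.circleIntegrable')
    rw [h1] at h2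
    simpa [Function.comp_def] using h2
  have hle : (P z0).re - ε / 2 ≤ Real.circleAverage (fun z => f (foldH z)) z0 ρ := by
    have : Real.circleAverage (fun z => (P z).re - ε / 2) z0 ρ = (P z0).re - ε / 2 := by
      have := Real.circleAverage_fun_sub (f₁ := fun z => (P z).re) (f₂ := fun _ => ε / 2)
        (c := z0) (R := ρ)
        ((continuous_re.comp hPd.continuous).continuousOn.circleIntegrable')
        (continuousOn_const.circleIntegrable')
      rw [this, hav, Real.circleAverage_const]
    rw [← this]
    refine Real.circleAverage_mono ?_ ?_ ?_
    · exact ((continuous_re.comp hPd.continuous).sub continuous_const).continuousOn.circleIntegrable'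
    · exact (hcf.mono (by rw [abs_of_pos hρ]; exact Metric.sphere_subset_closedBall)).circleIntegrable'
    · intro z hz
      rw [abs_of_pos hρ] at hz
      have : z ∈ range (circleMap z0 ρ) := by
        rw [range_circleMap, abs_of_pos hρ]; exact hz
      obtain ⟨θ, rfl⟩ := this
      have := hp θ
      rw [← hPc, abs_le] at this
      simp only [hg] at this
      linarith [this.1]
  linarith

end Part2

section Part3
open scoped Topology

theorem radial_integral {E : Type*} [NormedAddCommGroup E] [NormedSpace ℝ E] [CompleteSpace E]
    (g : ℂ → E) (k : ℝ → ℝ) (z0 : ℂ) {ρ : ℝ} (hρ : 0 < ρ)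
    (hg : ContinuousOn g (Metric.closedBall z0 ρ)) (hk : Continuous k) :
    ∫ z in Metric.ball z0 ρ, k ‖z - z0‖ • g z
      = ∫ r in (0:ℝ)..ρ, (2 * Real.pi * r * k r) • Real.circleAverage g z0 r := by
  have h1 : ∫ z in Metric.ball z0 ρ, k ‖z - z0‖ • g z
      = ∫ z, (Metric.ball (0:ℂ) ρ).indicator (fun z => k ‖z‖ • g (z0 + z)) z := by
    rw [← integral_indicator Metric.isOpen_ball.measurableSet, ← integral_add_left_eq_self _ z0]
    congr 1
    ext z
    by_cases hz : z ∈ Metric.ball (0:ℂ) ρ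
    · rw [indicator_of_mem, indicator_of_mem hz]
      · simp
      · simpa using hz
    · rw [indicator_of_notMem, indicator_of_notMem hz]
      simpa using hz
  rw [h1, ← Complex.integral_comp_polarCoord_symm]
  set G : ℝ × ℝ → E := fun p => (p.1 * k p.1) • g (circleMap z0 p.1 p.2) with hG
  have hset : MeasurableSet (Ioo (0:ℝ) ρ ×ˢ Ioo (-Real.pi) Real.pi) :=
    (measurableSet_Ioo.prod measurableSet_Ioo)
  have h2 : ∫ p in polarCoord.target,
      p.1 • (Metric.ball (0:ℂ) ρ).indicator (fun z => k ‖z‖ • g (z0 + z)) (Complex.polarCoord.symm p)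
      = ∫ p in Ioo (0:ℝ) ρ ×ˢ Ioo (-Real.pi) Real.pi, G p := by
    rw [← integral_indicator hset, polarCoord_target,
      ← integral_indicator (measurableSet_Ioi.prod measurableSet_Ioo)]
    congr 1
    ext p
    by_cases hp : p ∈ Ioi (0:ℝ) ×ˢ Ioo (-Real.pi) Real.pi
    · rw [indicator_of_mem hp]
      have hp0 : 0 < p.1 := hp.1
      have hn : ‖Complex.polarCoord.symm p‖ = p.1 := by
        rw [Complex.norm_polarCoord_symm, abs_of_pos hp0]
      by_cases hr : p.1 < ρ
      · rw [indicator_of_mem (by rw [Metric.mem_ball, dist_zero_right, hn]; exact hr),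
          indicator_of_mem (show p ∈ Ioo (0:ℝ) ρ ×ˢ Ioo (-Real.pi) Real.pi from ⟨⟨hp0, hr⟩, hp.2⟩), hn]
        simp only [hG, smul_smul]
        congr 2
        rw [Complex.polarCoord_symm_apply, circleMap, Complex.exp_mul_I]
        simp
      · rw [indicator_of_notMem (by rw [Metric.mem_ball, dist_zero_right, hn]; exact hr), smul_zero, indicator_of_notMem]
        intro h; exact hr h.1.2
    · rw [indicator_of_notMem hp, indicator_of_notMem]
      intro h; exact hp ⟨h.1.1, h.2⟩
  have hGc : ContinuousOn G (Icc (0:ℝ) ρ ×ˢ Icc (-Real.pi) Real.pi) := by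
    refine ContinuousOn.smul ?_ (hg.comp ?_ ?_)
    · exact (continuous_fst.mul (hk.comp continuous_fst)).continuousOn
    · have : Continuous (fun p : ℝ × ℝ => circleMap z0 p.1 p.2) := by
        unfold circleMap; fun_prop
      exact this.continuousOn
    · intro p hp
      exact Metric.closedBall_subset_closedBall hp.1.2 (circleMap_mem_closedBall _ hp.1.1 _)
  have hGi : IntegrableOn G (Ioo (0:ℝ) ρ ×ˢ Ioo (-Real.pi) Real.pi) :=
    (hGc.integrableOn_compact (isCompact_Icc.prod isCompact_Icc)).mono_set
      (prod_mono Ioo_subset_Icc_self Ioo_subset_Icc_self)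
  rw [h2, Measure.volume_eq_prod, setIntegral_prod _ (by rwa [Measure.volume_eq_prod] at hGi),
    intervalIntegral.integral_of_le hρ.le, integral_Ioc_eq_integral_Ioo]
  refine setIntegral_congr_fun measurableSet_Ioo fun r hr => ?_
  simp only [hG]
  rw [integral_smul, ← integral_Ioc_eq_integral_Ioo,
    ← intervalIntegral.integral_of_le (by linarith [Real.pi_pos]),
    Real.circleAverage_eq_integral_add (-Real.pi), smul_smul,
    intervalIntegral.integral_comp_add_right (fun θ => g (circleMap z0 r θ))]
  have : (2 * Real.pi * r * k r) * (2 * Real.pi)⁻¹ = r * k r := by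
    field_simp
  rw [this]
  congr 2 <;> ring

theorem subMean_ball (f : ℂ → ℝ) (z0 : ℂ) (hz0 : 0 ≤ z0.im) {ρ : ℝ} (hρ : 0 < ρ)
    (hc : ContinuousOn f (Metric.closedBall z0 ρ ∩ {z : ℂ | 0 ≤ z.im}))
    (hL : ∀ z ∈ Metric.ball z0 ρ, 0 < z.im → ∃ L > 0, LapAt f z L)
    (hN : ∀ z ∈ Metric.ball z0 ρ, z.im = 0 →
      ∃ d > 0, HasDerivWithinAt (fun τ : ℝ => f (z + τ * I)) d (Ici 0) 0) :
    f z0 * (Real.pi * ρ ^ 2) ≤ ∫ z in Metric.ball z0 ρ, f (foldH z) := by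
  have hfold : ∀ z ∈ Metric.closedBall z0 ρ,
      foldH z ∈ Metric.closedBall z0 ρ ∩ {z : ℂ | 0 ≤ z.im} := fun z hz =>
    ⟨(foldH_dist_le hz0).trans hz, foldH_im_nonneg z⟩
  have hcf : ContinuousOn (fun z => f (foldH z)) (Metric.closedBall z0 ρ) :=
    hc.comp continuous_foldH.continuousOn hfold
  have h := radial_integral (fun z => f (foldH z)) (fun _ => 1) z0 hρ hcf continuous_const
  simp only [one_smul, mul_one] at h
  rw [h]
  have hci : ContinuousOn (fun r => Real.circleAverage (fun z => f (foldH z)) z0 r) (Icc 0 ρ) := by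
    refine Real.ContinuousOn.circleAverage ?_ (fun r hr => hr.1)
    · refine hcf.mono ?_
      rintro z ⟨hz1, hz2⟩
      simpa [dist_eq_norm] using hz2
  have h2 : f z0 * (Real.pi * ρ ^ 2) = ∫ r in (0:ℝ)..ρ, (2 * Real.pi * r) * f z0 := by
    rw [intervalIntegral.integral_mul_const, intervalIntegral.integral_const_mul, integral_id]
    ring
  rw [h2]
  refine intervalIntegral.integral_mono_on hρ.le ?_ ?_ ?_
  · apply Continuous.intervalIntegrable; fun_prop
  · apply ContinuousOn.intervalIntegrable
    rw [uIcc_of_le hρ.le]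
    exact ContinuousOn.smul (f := fun r : ℝ => 2 * Real.pi * r) (by fun_prop) hci
  · intro r hr
    rcases hr.1.eq_or_lt with h0 | h0
    · simp [← h0]
    refine mul_le_mul_of_nonneg_left ?_ (by positivity)
    refine subMean_circle f z0 hz0 h0 (hc.mono ?_) ?_ ?_
    · exact inter_subset_inter_left _ (Metric.closedBall_subset_closedBall hr.2)
    · exact fun z hz => hL z (Metric.ball_subset_ball hr.2 hz)
    · exact fun z hz => hN z (Metric.ball_subset_ball hr.2 hz)

end Part3

section Part4
open scoped Topology

/-- The closed upper half plane. -/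
def Hb : Set ℂ := {w : ℂ | 0 ≤ w.im}

/-- The real differential `h ↦ 2 Re (D h)`. -/
noncomputable def reF (D : ℂ) : ℂ →L[ℝ] ℝ := (2 * D.re) • reCLM - (2 * D.im) • imCLM

theorem reF_apply (D h : ℂ) : reF D h = 2 * (D * h).re := by
  simp [reF]; ring

/-- The real linear map `h ↦ a h + b conj h`. -/
noncomputable def cF (a b : ℂ) : ℂ →L[ℝ] ℂ :=
  a • (ContinuousLinearMap.id ℝ ℂ) + b • (conjCLE : ℂ →L[ℝ] ℂ)

theorem cF_apply (a b h : ℂ) : cF a b h = a * h + b * (starRingEnd ℂ) h := by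
  simp [cF]

/-- `v` solves the Liouville equation near `z`, with `V = v_z` and `Q` its Schwarzian. -/
structure LTrip (v : ℂ → ℝ) (V Q : ℂ → ℂ) (z : ℂ) : Prop where
  dv : HasFDerivAt v (reF (V z)) z
  dV : HasFDerivAt V (cF (Q z + V z ^ 2 / 2) (-(Real.exp (v z) / 2 : ℝ))) z

theorem uniqueDiffOn_Hb : UniqueDiffOn ℝ Hb := by
  apply uniqueDiffOn_convex
  · exact convex_halfSpace_im_ge 0
  · refine ⟨I, ?_⟩
    rw [mem_interior]
    exact ⟨{w | 0 < w.im}, fun w (hw : 0 < w.im) => hw.le, isOpen_lt continuous_const continuous_im, by simp⟩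

theorem Hb_mem_nhds {z : ℂ} (hz : 0 < z.im) : Hb ∈ 𝓝 z :=
  mem_of_superset ((isOpen_lt continuous_const continuous_im).mem_nhds hz) fun w (hw : 0 < w.im) => hw.le

section basic
variable {v : ℂ → ℝ} {S : Set ℂ}

theorem cd_within (hS : IsClosed S) (hv : ContDiffOn ℝ 2 v (Hb \ S)) {z : ℂ} (hz : z ∈ Hb \ S) :
    ContDiffWithinAt ℝ 2 v Hb z := by
  refine (hv z hz).mono_of_mem_nhdsWithin ?_
  rw [sdiff_eq]
  exact inter_mem self_mem_nhdsWithin (mem_nhdsWithin_of_mem_nhds (hS.isOpen_compl.mem_nhds hz.2))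

theorem cd_fderiv (hS : IsClosed S) (hv : ContDiffOn ℝ 2 v (Hb \ S)) {z : ℂ} (hz : z ∈ Hb \ S) :
    ContDiffWithinAt ℝ 1 (fderivWithin ℝ v Hb) Hb z :=
  (cd_within hS hv hz).fderivWithin_right uniqueDiffOn_Hb (by norm_num) hz.1

theorem cd_vzc (hS : IsClosed S) (hv : ContDiffOn ℝ 2 v (Hb \ S)) {z : ℂ} (hz : z ∈ Hb \ S) :
    ContDiffWithinAt ℝ 1 (vzc v) Hb z := by
  have h1 : ContDiffWithinAt ℝ 1 (fun w => fderivWithin ℝ v Hb w 1) Hb z :=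
    (cd_fderiv hS hv hz).clm_apply contDiffWithinAt_const
  have h2 : ContDiffWithinAt ℝ 1 (fun w => fderivWithin ℝ v Hb w I) Hb z :=
    (cd_fderiv hS hv hz).clm_apply contDiffWithinAt_const
  have h3 := Complex.ofRealCLM.contDiff.contDiffAt.comp_contDiffWithinAt z h1
  have h4 := Complex.ofRealCLM.contDiff.contDiffAt.comp_contDiffWithinAt z h2
  exact ((h3.sub (contDiffWithinAt_const.mul h4)).div_const 2)

theorem cont_fderiv_vzc (hS : IsClosed S) (hv : ContDiffOn ℝ 2 v (Hb \ S)) {z : ℂ}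
    (hz : z ∈ Hb \ S) : ContinuousWithinAt (fderivWithin ℝ (vzc v) Hb) Hb z :=
  ((cd_vzc hS hv hz).fderivWithin_right (m := 0) uniqueDiffOn_Hb (by norm_num) hz.1).continuousWithinAt

theorem cont_schw (hS : IsClosed S) (hv : ContDiffOn ℝ 2 v (Hb \ S)) :
    ContinuousOn (schwarzianMap v) (Hb \ S) := by
  intro z hz
  have h := cont_fderiv_vzc hS hv hz
  have h1 : ContinuousWithinAt (fun w => fderivWithin ℝ (vzc v) Hb w 1) Hb z :=
    h.clm_apply continuousWithinAt_const
  have h2 : ContinuousWithinAt (fun w => fderivWithin ℝ (vzc v) Hb w I) Hb z :=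
    h.clm_apply continuousWithinAt_const
  have h3 := (cd_vzc hS hv hz).continuousWithinAt
  have : ContinuousWithinAt (schwarzianMap v) Hb z :=
    ((h1.sub (continuousWithinAt_const.mul h2)).div_const 2).sub ((h3.pow 2).div_const 2)
  exact this.mono sdiff_subset

theorem cont_vzc (hS : IsClosed S) (hv : ContDiffOn ℝ 2 v (Hb \ S)) :
    ContinuousOn (vzc v) (Hb \ S) := fun _ hz =>
  ((cd_vzc hS hv hz).continuousWithinAt).mono sdiff_subset

theorem fderivWithin_apply_eq (z h : ℂ) :
    fderivWithin ℝ v Hb z h = 2 * (vzc v z * h).re := by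
  obtain ⟨x, y, rfl⟩ : ∃ x y : ℝ, h = x • (1:ℂ) + y • I := ⟨h.re, h.im, by
    simp⟩
  rw [map_add, map_smul, map_smul]
  change _ = 2 * ((((fderivWithin ℝ v Hb z 1 : ℝ) : ℂ)
    - I * ((fderivWithin ℝ v Hb z I : ℝ) : ℂ)) / 2 * _).re
  generalize fderivWithin ℝ v Hb z 1 = a
  generalize fderivWithin ℝ v Hb z I = b
  have : ((((a : ℝ) : ℂ) - I * ((b : ℝ) : ℂ)) / 2) = ⟨a / 2, - b / 2⟩ := by
    apply Complex.ext <;> simp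
  rw [this]
  simp
  ring

theorem fderivWithin_vzc_eq (z h : ℂ) :
    fderivWithin ℝ (vzc v) Hb z h = (schwarzianMap v z + vzc v z ^ 2 / 2) * h +
      (fderivWithin ℝ (vzc v) Hb z 1 + I * fderivWithin ℝ (vzc v) Hb z I) / 2 * (starRingEnd ℂ) h := by
  obtain ⟨x, y, rfl⟩ : ∃ x y : ℝ, h = x • (1:ℂ) + y • I := ⟨h.re, h.im, by
    simp⟩
  rw [map_add, map_smul, map_smul]
  have hs : schwarzianMap v z + vzc v z ^ 2 / 2 = (fderivWithin ℝ (vzc v) Hb z 1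
    - Complex.I * fderivWithin ℝ (vzc v) Hb z Complex.I) / 2 := by
    unfold schwarzianMap Hb; ring
  rw [hs]
  generalize fderivWithin ℝ (vzc v) Hb z 1 = a
  generalize fderivWithin ℝ (vzc v) Hb z I = b
  simp
  linear_combination (b * y) * I_sq

theorem hasF_v (hS : IsClosed S) (hv : ContDiffOn ℝ 2 v (Hb \ S)) {z : ℂ} (hz : z ∈ Hb \ S) :
    HasFDerivWithinAt v (reF (vzc v z)) Hb z := by
  have h := ((cd_within hS hv hz).differentiableWithinAt (by norm_num)).hasFDerivWithinAt
  have e : fderivWithin ℝ v Hb z = reF (vzc v z) := by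
    ext h
    rw [fderivWithin_apply_eq, reF_apply]
  rwa [e] at h

theorem dbar_int (hS : IsClosed S) (hv : ContDiffOn ℝ 2 v (Hb \ S)) {z : ℂ} (hz : z ∈ Hb \ S)
    (hp : 0 < z.im) :
    (fderivWithin ℝ (vzc v) Hb z 1 + I * fderivWithin ℝ (vzc v) Hb z I) / 2 = ((lap v z / 4 : ℝ) : ℂ) := by
  have hU : IsOpen {w : ℂ | 0 < w.im} := isOpen_lt continuous_const continuous_im
  have cd : ContDiffAt ℝ 2 v z := (cd_within hS hv hz).contDiffAt (Hb_mem_nhds hp)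
  have hsym : IsSymmSndFDerivAt ℝ v z := cd.isSymmSndFDerivAt (by simp)
  have hd : DifferentiableAt ℝ (fderiv ℝ v) z :=
    (cd.fderiv_right (m := 1) (by norm_num)).differentiableAt (by norm_num)
  set B := fderiv ℝ (fderiv ℝ v) z with hB
  have hB' : HasFDerivAt (fderiv ℝ v) B z := hd.hasFDerivAt
  have hdir : ∀ k : ℂ, HasFDerivAt (fun w => fderiv ℝ v w k) (B.flip k) z := by
    intro k
    have := hB'.clm_apply (hasFDerivAt_const k z)
    simpa using this
  have hl : lap v z = B 1 1 + B I I := by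
    unfold lap
    rw [(hdir 1).fderiv, (hdir I).fderiv]; simp
  have heq : vzc v =ᶠ[𝓝 z] fun w => (((fderiv ℝ v w 1 : ℝ) : ℂ) - I * ((fderiv ℝ v w I : ℝ) : ℂ)) / 2 := by
    filter_upwards [hU.mem_nhds hp] with w hw
    have : fderivWithin ℝ v Hb w = fderiv ℝ v w := fderivWithin_of_mem_nhds (Hb_mem_nhds hw)
    unfold vzc
    rw [show {w : ℂ | 0 ≤ w.im} = Hb from rfl, this]
  have hV : HasFDerivAt (vzc v)
      ((2:ℂ)⁻¹ • (ofRealCLM.comp (B.flip 1) - I • ofRealCLM.comp (B.flip I))) z := by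
    refine HasFDerivAt.congr_of_eventuallyEq ?_ heq
    have h1 := (ofRealCLM.hasFDerivAt.comp z (hdir 1))
    have h2 := (ofRealCLM.hasFDerivAt.comp z (hdir I)).const_mul I
    have := (h1.sub h2).const_mul (2:ℂ)⁻¹
    refine this.congr_of_eventuallyEq (Eventually.of_forall fun w => ?_)
    simp [div_eq_inv_mul]
  rw [fderivWithin_of_mem_nhds (Hb_mem_nhds hp), hV.fderiv, hl]
  have hs : B 1 I = B I 1 := hsym 1 I
  simp
  rw [hs]
  linear_combination (- (B I I : ℂ) / 4) * I_sq

theorem dbar_all (hS : IsClosed S) (hv : ContDiffOn ℝ 2 v (Hb \ S))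
    (hlap : ∀ z : ℂ, 0 < z.im → lap v z + 2 * 1 * Real.exp (v z) = 0) (hSU : ∀ z ∈ S, z.im = 0)
    {z : ℂ} (hz : z ∈ Hb \ S) :
    (fderivWithin ℝ (vzc v) Hb z 1 + I * fderivWithin ℝ (vzc v) Hb z I) / 2
      = -((Real.exp (v z) / 2 : ℝ) : ℂ) := by
  have hbound0 : ∀ w : ℂ, 0 < w.im →
    (fderivWithin ℝ (vzc v) Hb w 1 + I * fderivWithin ℝ (vzc v) Hb w I) / 2
      = -((Real.exp (v w) / 2 : ℝ) : ℂ) := by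
    intro w hw
    rw [dbar_int hS hv ⟨le_of_lt hw, fun h => hw.ne' (hSU w h)⟩ hw]
    have := hlap w hw
    have : lap v w = - 2 * Real.exp (v w) := by linarith
    rw [this]; push_cast; ring
  have h := cont_fderiv_vzc hS hv hz
  have h1 : ContinuousWithinAt (fun w => fderivWithin ℝ (vzc v) Hb w 1) Hb z :=
    h.clm_apply continuousWithinAt_const
  have h2 : ContinuousWithinAt (fun w => fderivWithin ℝ (vzc v) Hb w I) Hb z :=
    h.clm_apply continuousWithinAt_const
  have h3 : ContinuousWithinAt (fun w => (fderivWithin ℝ (vzc v) Hb w 1 +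
      I * fderivWithin ℝ (vzc v) Hb w I) / 2) Hb z :=
    (h1.add (continuousWithinAt_const.mul h2)).div_const 2
  have h4 : ContinuousWithinAt (fun w => -((Real.exp (v w) / 2 : ℝ) : ℂ)) Hb z := by
    have := (cd_within hS hv hz).continuousWithinAt
    have := (Real.continuous_exp.continuousAt.comp_continuousWithinAt this).div_const 2
    exact (Complex.continuous_ofReal.continuousAt.comp_continuousWithinAt this).neg
  have hsub : {w : ℂ | 0 < w.im} ⊆ Hb := fun w (hw : 0 < w.im) => hw.le
  have hcl : z ∈ closure {w : ℂ | 0 < w.im} := by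
    rw [Complex.closure_setOfPred_lt_im]; exact hz.1
  have : (𝓝[{w : ℂ | 0 < w.im}] z).NeBot := mem_closure_iff_nhdsWithin_neBot.1 hcl
  refine tendsto_nhds_unique (h3.mono hsub) ?_
  refine (h4.mono hsub).congr' ?_
  filter_upwards [self_mem_nhdsWithin] with w hw using (hbound0 w hw).symm

end basic

end Part4

section Part5
open scoped Topology

/-- The data of a solution in the half plane used throughout the proof. -/
structure Sol (v : ℂ → ℝ) (V Q : ℂ → ℂ) (S : Set ℂ) (c0 : ℝ) : Prop where
  Sfin : S.Finite
  Sre : ∀ z ∈ S, z.im = 0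
  cv : ContinuousOn v (Hb \ S)
  cV : ContinuousOn V (Hb \ S)
  cQ : ContinuousOn Q (Hb \ S)
  trip : ∀ z : ℂ, 0 < z.im → LTrip v V Q z
  c0n : 0 ≤ c0
  bd : ∀ s : ℝ, (s : ℂ) ∉ S → |(V s).im| ≤ c0 * Real.exp (v s / 2)
  realQ : ∀ s : ℝ, (s : ℂ) ∉ S → (Q s).im = 0
  lv : ∀ s : ℝ, (s : ℂ) ∉ S → HasDerivAt (fun x : ℝ => v x) (2 * (V s).re) s
  lV : ∀ s : ℝ, (s : ℂ) ∉ S →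
    HasDerivAt (fun x : ℝ => V x) (Q s + V s ^ 2 / 2 - (Real.exp (v s) / 2 : ℝ)) s
  fin : IntegrableOn (fun z => Real.exp (v z)) {z : ℂ | 0 < z.im}

theorem exists_interval {m : ℕ} (q : Fin m → ℝ) (hq : StrictMono q) (s : ℝ)
    (hs : ∀ i, q i ≠ s) : ∃ j : Fin (m + 1),
      ∀ i : Fin m, ((i : ℕ) < (j : ℕ) → q i < s) ∧ ((j : ℕ) ≤ (i : ℕ) → s < q i) := by
  by_cases h : ∃ i, s < q i
  · have hne : (Finset.univ.filter fun i => s < q i).Nonempty := by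
      obtain ⟨i, hi⟩ := h; exact ⟨i, by simpa using hi⟩
    set j := (Finset.univ.filter fun i => s < q i).min' hne with hj
    have hjm : s < q j := by
      have := Finset.min'_mem _ hne
      simpa using this
    refine ⟨j.castSucc, fun i => ⟨fun hi => ?_, fun hi => ?_⟩⟩
    · refine lt_of_le_of_ne ?_ (hs i)
      by_contra hc
      push Not at hc
      have := Finset.min'_le (Finset.univ.filter fun i => s < q i) i (by simpa using hc)
      rw [← hj, Fin.le_def] at this
      simp at hi
      omega
    · refine lt_of_lt_of_le hjm (hq.monotone ?_)
      exact Fin.le_def.2 (by simpa using hi)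
  · push Not at h
    refine ⟨Fin.last m, fun i => ⟨fun _ => lt_of_le_of_ne (h i) (hs i), fun hi => ?_⟩⟩
    have := i.2
    simp at hi
    omega

theorem sol_of {m : ℕ} {q : Fin m → ℝ} (hq : StrictMono q) {c : Fin (m + 1) → ℝ} {v : ℂ → ℝ}
    (hv : IsSolutionPS 1 m q c v)
    (hfin : IntegrableOn (fun z => Real.exp (v z)) {z : ℂ | 0 < z.im}) :
    Sol v (vzc v) (schwarzianMap v) (range fun i => (q i : ℂ)) (∑ j, |c j|) := by
  obtain ⟨hcd, hlap, hbd⟩ := hv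
  set S : Set ℂ := range fun i => (q i : ℂ) with hSdef
  have hcd' : ContDiffOn ℝ 2 v (Hb \ S) := hcd
  have hSf : S.Finite := finite_range _
  have hS : IsClosed S := hSf.isClosed
  have hSre : ∀ z ∈ S, z.im = 0 := by rintro _ ⟨i, rfl⟩; simp
  have hreal : ∀ s : ℝ, (s : ℂ) ∉ S → (s : ℂ) ∈ Hb \ S := fun s hs => ⟨by simp [Hb], hs⟩
  have hV : ∀ z ∈ Hb \ S, HasFDerivWithinAt (vzc v)
      (cF (schwarzianMap v z + vzc v z ^ 2 / 2) (-(Real.exp (v z) / 2 : ℝ))) Hb z := by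
    intro z hz
    have h := ((cd_vzc hS hcd' hz).differentiableWithinAt (by norm_num)).hasFDerivWithinAt
    have e : fderivWithin ℝ (vzc v) Hb z =
      cF (schwarzianMap v z + vzc v z ^ 2 / 2) (-(Real.exp (v z) / 2 : ℝ)) := by
      ext h
      rw [fderivWithin_vzc_eq, dbar_all hS hcd' hlap hSre hz, cF_apply]
    rwa [e] at h
  have hmaps : ∀ s : ℝ, HasDerivAt (fun x : ℝ => (x : ℂ)) 1 s := fun s => (hasDerivAt_id s).ofReal_comp
  have hlv : ∀ s : ℝ, (s : ℂ) ∉ S → HasDerivAt (fun x : ℝ => v x) (2 * (vzc v s).re) s := by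
    intro s hs
    have := (hasF_v hS hcd' (hreal s hs)).comp_hasDerivWithinAt (s := univ) s
      ((hmaps s).hasDerivWithinAt) (fun x _ => by simp [Hb])
    rw [hasDerivWithinAt_univ, reF_apply, mul_one] at this
    exact this
  have hlV : ∀ s : ℝ, (s : ℂ) ∉ S → HasDerivAt (fun x : ℝ => vzc v x)
      (schwarzianMap v s + vzc v s ^ 2 / 2 - (Real.exp (v s) / 2 : ℝ)) s := by
    intro s hs
    have := (hV s (hreal s hs)).comp_hasDerivWithinAt (s := univ) s
      ((hmaps s).hasDerivWithinAt) (fun x _ => by simp [Hb])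
    rw [hasDerivWithinAt_univ, cF_apply, map_one, mul_one, mul_one, ← sub_eq_add_neg] at this
    exact this
  have hdnu : ∀ s : ℝ, dnu v s = - 2 * (vzc v s).im := by
    intro s
    have := fderivWithin_apply_eq (v := v) s I
    change fderivWithin ℝ v Hb (s : ℂ) I = _
    rw [this]; simp
  have hbd2 : ∀ s : ℝ, (s : ℂ) ∉ S → ∃ j, ∀ᶠ x : ℝ in 𝓝 s, (vzc v x).im = - c j / 2 * Real.exp (v (x : ℂ) / 2) := by
    intro s hs
    obtain ⟨j, hj⟩ := exists_interval q hq s (fun i hi => hs ⟨i, by simp [hi]⟩)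
    refine ⟨j, ?_⟩
    have : ∀ᶠ x in 𝓝 s, ∀ i : Fin m, ((i : ℕ) < (j : ℕ) → q i < x) ∧ ((j : ℕ) ≤ (i : ℕ) → x < q i) := by
      rw [eventually_all]
      intro i
      by_cases h : (i : ℕ) < (j : ℕ)
      · filter_upwards [lt_mem_nhds ((hj i).1 h)] with x hx
        exact ⟨fun _ => hx, fun h' => absurd h (not_lt.2 h')⟩
      · filter_upwards [gt_mem_nhds ((hj i).2 (not_lt.1 h))] with x hx
        exact ⟨fun h' => absurd h' h, fun _ => hx⟩
    filter_upwards [this] with x hx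
    have := hbd j x hx
    rw [hdnu] at this
    linarith
  refine ⟨hSf, hSre, hcd'.continuousOn, cont_vzc hS hcd', cont_schw hS hcd', ?_, ?_, ?_, ?_, hlv, hlV, hfin⟩
  · intro z hz
    have hzA : z ∈ Hb \ S := ⟨hz.le, fun h => hz.ne' (hSre z h)⟩
    exact ⟨(hasF_v hS hcd' hzA).hasFDerivAt (Hb_mem_nhds hz), (hV z hzA).hasFDerivAt (Hb_mem_nhds hz)⟩
  · exact Finset.sum_nonneg fun j _ => abs_nonneg _
  · intro s hs
    obtain ⟨j, hj⟩ := hbd2 s hs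
    rw [hj.self_of_nhds, abs_mul, abs_of_pos (Real.exp_pos _)]
    refine mul_le_mul_of_nonneg_right ?_ (Real.exp_pos _).le
    have := Finset.single_le_sum (f := fun j => |c j|) (fun j _ => abs_nonneg _) (Finset.mem_univ j)
    rw [abs_div, abs_neg]
    have h2 := abs_nonneg (c j)
    rw [abs_of_pos (by norm_num : (0:ℝ) < 2)]
    linarith
  · intro s hs
    obtain ⟨j, hj⟩ := hbd2 s hs
    have h1 : HasDerivAt (fun x : ℝ => (vzc v x).im)
      (schwarzianMap v s + vzc v s ^ 2 / 2 - (Real.exp (v s) / 2 : ℝ)).im s :=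
      imCLM.hasFDerivAt.comp_hasDerivAt s (hlV s hs)
    have h2 : HasDerivAt (fun x : ℝ => - c j / 2 * Real.exp (v (x : ℂ) / 2))
      (- c j / 2 * (Real.exp (v s / 2) * (2 * (vzc v s).re / 2))) s :=
      (((hlv s hs).div_const 2).exp).const_mul _
    have h3 := h1.unique (h2.congr_of_eventuallyEq hj)
    have h4 := hj.self_of_nhds
    have h5 : (vzc v s ^ 2 / 2).im = (vzc v s).re * (vzc v s).im := by
      rw [sq]; simp; ring
    rw [sub_im, add_im, ofReal_im, h5] at h3
    have : (schwarzianMap v s).im = - c j / 2 * Real.exp (v s / 2) * (vzc v s).re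
      - (vzc v s).re * (vzc v s).im := by linarith
    rw [this, ← h4]; ring

end Part5

section Part6
open scoped Topology

theorem line_fderiv {E : Type*} [NormedAddCommGroup E] [NormedSpace ℝ E] {g : ℂ → E}
    {g' : ℂ →L[ℝ] E} {w : ℂ} (h : HasFDerivAt g g' w) (d : ℂ) :
    HasDerivAt (fun τ : ℝ => g (w + τ * d)) (g' d) 0 := by
  have h1 : HasDerivAt (fun τ : ℝ => w + (τ : ℂ) * d) d 0 := by
    have := ((hasDerivAt_id (0:ℝ)).ofReal_comp.mul_const d).const_add w
    simpa using this
  have h2 : HasFDerivAt g g' (w + ((0:ℝ) : ℂ) * d) := by simpa using h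
  exact h2.comp_hasDerivAt (0:ℝ) h1

theorem LapAt.of_trip {v : ℂ → ℝ} {V Q : ℂ → ℂ} {U : Set ℂ} (hU : IsOpen U)
    (h : ∀ w ∈ U, LTrip v V Q w) {z : ℂ} (hz : z ∈ U) : LapAt v z (-2 * Real.exp (v z)) := by
  set p := Q z + V z ^ 2 / 2
  have hV := (h z hz).dV
  refine ⟨fun w => 2 * (V w).re, fun w => 2 * (V w * I).re, 2 * (p - (Real.exp (v z) / 2 : ℝ)).re,
    2 * (-p - (Real.exp (v z) / 2 : ℝ)).re, ?_, ?_, ?_, ?_, ?_⟩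
  · filter_upwards [hU.mem_nhds hz] with w hw
    have := line_fderiv (h w hw).dv 1
    rw [reF_apply] at this
    simpa using this
  · filter_upwards [hU.mem_nhds hz] with w hw
    have := line_fderiv (h w hw).dv I
    rw [reF_apply] at this
    exact this
  · have := (hasDerivAt_re' (line_fderiv hV 1)).const_mul 2
    rw [cF_apply] at this
    simp only [mul_one, map_one, ← sub_eq_add_neg] at this
    exact this
  · have := (hasDerivAt_re' ((line_fderiv hV I).mul_const I)).const_mul 2
    rw [cF_apply, conj_I] at this
    have e : ((Q z + V z ^ 2 / 2) * I + -((Real.exp (v z) / 2 : ℝ) : ℂ) * -I) * I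
      = -p - (Real.exp (v z) / 2 : ℝ) := by
      linear_combination ((Q z + V z ^ 2 / 2) + ((Real.exp (v z) / 2 : ℝ) : ℂ)) * I_sq
    rw [e] at this
    exact this
  · simp only [sub_re, neg_re, ofReal_re]; ring

theorem normal_deriv {v : ℂ → ℝ} {V : ℂ → ℂ} {z : ℂ} {δ : ℝ} (hδ : 0 < δ) (d : ℂ)
    (h : ∀ τ ∈ Ioo 0 δ, HasFDerivAt v (reF (V (z + τ * d))) (z + τ * d))
    (hv : ContinuousWithinAt (fun τ : ℝ => v (z + τ * d)) (Ioo 0 δ) 0)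
    (hV : ContinuousWithinAt (fun τ : ℝ => V (z + τ * d)) (Ioo 0 δ) 0) :
    HasDerivWithinAt (fun τ : ℝ => v (z + τ * d)) (2 * (V z * d).re) (Ici 0) 0 := by
  have hd : ∀ τ ∈ Ioo 0 δ, HasDerivAt (fun τ : ℝ => v (z + τ * d)) (2 * (V (z + τ * d) * d).re) τ := by
    intro τ hτ
    have h1 : HasDerivAt (fun τ : ℝ => z + (τ : ℂ) * d) d τ := by
      have := ((hasDerivAt_id τ).ofReal_comp.mul_const d).const_add z
      simpa using this
    have := (h τ hτ).comp_hasDerivAt τ h1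
    rwa [reF_apply] at this
  have hIoo : Ioo 0 δ ∈ 𝓝[>] (0:ℝ) := Ioo_mem_nhdsGT hδ
  refine hasDerivWithinAt_Ici_of_tendsto_deriv (s := Ioo 0 δ) ?_ hv hIoo ?_
  · exact fun τ hτ => (hd τ hτ).differentiableAt.differentiableWithinAt
  · have h2 : Tendsto (fun τ : ℝ => 2 * (V (z + τ * d) * d).re) (𝓝[Ioo 0 δ] 0) (𝓝 (2 * (V z * d).re)) := by
      have : ContinuousWithinAt (fun τ : ℝ => 2 * (V (z + τ * d) * d).re) (Ioo 0 δ) 0 :=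
        (continuous_re.continuousAt.comp_continuousWithinAt (hV.mul continuousWithinAt_const)).const_mul 2
      simpa [ContinuousWithinAt] using this
    rw [nhdsWithin_Ioo_eq_nhdsGT hδ] at h2
    refine h2.congr' ?_
    filter_upwards [hIoo] with τ hτ using (hd τ hτ).deriv.symm

theorem volume_im_eq_zero : volume {z : ℂ | z.im = 0} = 0 := by
  have h : (LinearMap.ker (imLm : ℂ →ₗ[ℝ] ℝ)) ≠ ⊤ := by
    intro h
    have : I ∈ LinearMap.ker (imLm : ℂ →ₗ[ℝ] ℝ) := by rw [h]; trivial
    simp at this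
  have := Measure.addHaar_submodule (volume : Measure ℂ) _ h
  convert this using 2
  ext z; simp

theorem fold_integral_le {g : ℂ → ℝ} {z1 : ℂ} (hz1 : 0 ≤ z1.im) {ρ : ℝ}
    (hg : ContinuousOn g (Metric.closedBall z1 ρ ∩ Hb))
    (hpos : ∀ z ∈ Metric.closedBall z1 ρ ∩ Hb, 0 ≤ g z) :
    ∫ z in Metric.ball z1 ρ, g (foldH z) ≤ 2 * ∫ z in Metric.ball z1 ρ ∩ {z : ℂ | 0 < z.im}, g z := by
  have hfold : ∀ z ∈ Metric.closedBall z1 ρ, foldH z ∈ Metric.closedBall z1 ρ ∩ Hb := fun z hz =>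
    ⟨(foldH_dist_le hz1).trans hz, foldH_im_nonneg z⟩
  have hcf : ContinuousOn (fun z => g (foldH z)) (Metric.closedBall z1 ρ) :=
    hg.comp continuous_foldH.continuousOn hfold
  have hi : IntegrableOn (fun z => g (foldH z)) (Metric.ball z1 ρ) :=
    (hcf.integrableOn_compact (isCompact_closedBall _ _)).mono_set Metric.ball_subset_closedBall
  have hmU : MeasurableSet {z : ℂ | 0 < z.im} := (isOpen_lt continuous_const continuous_im).measurableSet
  have hmL : MeasurableSet {z : ℂ | z.im < 0} := (isOpen_lt continuous_im continuous_const).measurableSet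
  have hmB : MeasurableSet (Metric.ball z1 ρ) := Metric.isOpen_ball.measurableSet
  have hU : ∫ z in Metric.ball z1 ρ ∩ {z : ℂ | 0 < z.im}, g (foldH z)
      = ∫ z in Metric.ball z1 ρ ∩ {z : ℂ | 0 < z.im}, g z := by
    refine setIntegral_congr_fun (hmB.inter hmU) fun z hz => ?_
    rw [foldH_of_nonneg (hz.2 : 0 < z.im).le]
  have hL : ∫ z in Metric.ball z1 ρ ∩ {z : ℂ | z.im < 0}, g (foldH z)
      ≤ ∫ z in Metric.ball z1 ρ ∩ {z : ℂ | 0 < z.im}, g z := by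
    have e1 : ∫ z in Metric.ball z1 ρ ∩ {z : ℂ | z.im < 0}, g (foldH z)
      = ∫ z in conjCLE ⁻¹' (conjCLE ⁻¹' (Metric.ball z1 ρ ∩ {z : ℂ | z.im < 0})), g (conjCLE z) := by
      have : conjCLE ⁻¹' (conjCLE ⁻¹' (Metric.ball z1 ρ ∩ {z : ℂ | z.im < 0})) =
        Metric.ball z1 ρ ∩ {z : ℂ | z.im < 0} := by
        ext z; simp
      rw [this]
      refine setIntegral_congr_fun (hmB.inter hmL) fun z hz => ?_
      rw [foldH_of_nonpos (hz.2 : z.im < 0).le]; rfl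
    have mp : MeasurePreserving (conjCLE : ℂ → ℂ) volume volume :=
      conjLIE.measurePreserving
    have me : MeasurableEmbedding (conjCLE : ℂ → ℂ) := conjCLE.toHomeomorph.measurableEmbedding
    rw [e1, mp.setIntegral_preimage_emb me]
    have hsub : (conjCLE : ℂ → ℂ) ⁻¹' (Metric.ball z1 ρ ∩ {z : ℂ | z.im < 0}) ⊆
        Metric.ball z1 ρ ∩ {z : ℂ | 0 < z.im} := by
      rintro z ⟨h1, h2⟩
      have h2' : 0 < z.im := by simpa using h2
      refine ⟨?_, h2'⟩
      have := foldH_dist_le (z := conjCLE z) hz1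
      rw [foldH_of_nonpos (le_of_lt h2)] at this
      simp only [conjCLE_apply, conj_conj] at this
      exact lt_of_le_of_lt this h1
    refine setIntegral_mono_set ?_ ?_ (Eventually.of_forall hsub)
    · refine (hg.integrableOn_compact ((isCompact_closedBall _ _).inter_right
        (isClosed_le continuous_const continuous_im))).mono_set ?_
      exact inter_subset_inter Metric.ball_subset_closedBall fun z (hz : 0 < z.im) => hz.le
    · refine (ae_restrict_iff' (hmB.inter hmU)).2 (Eventually.of_forall fun z hz => ?_)
      exact hpos z ⟨Metric.ball_subset_closedBall hz.1, show 0 ≤ z.im from le_of_lt hz.2⟩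
  have hsplit : ∫ z in Metric.ball z1 ρ, g (foldH z) =
      (∫ z in Metric.ball z1 ρ ∩ {z : ℂ | 0 < z.im}, g (foldH z)) +
      ∫ z in Metric.ball z1 ρ ∩ {z : ℂ | z.im < 0}, g (foldH z) := by
    rw [← setIntegral_union ?_ (hmB.inter hmL) (hi.mono_set inter_subset_left)
      (hi.mono_set inter_subset_left)]
    · refine setIntegral_congr_set ?_
      rw [← inter_union_distrib_left]
      have : ∀ᵐ z : ℂ, z.im ≠ 0 := by
        rw [ae_iff]; simpa using volume_im_eq_zero
      filter_upwards [this] with z hz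
      apply propext
      constructor
      · intro h; exact ⟨h, (lt_or_gt_of_ne hz).symm⟩
      · intro h; exact h.1
    · rw [Set.disjoint_left]
      rintro z ⟨_, h1⟩ ⟨_, h2⟩
      have h1' : 0 < z.im := h1
      have h2' : z.im < 0 := h2
      linarith
  rw [hsplit, hU]
  linarith

end Part6

section Part7
open scoped Topology

theorem Sol.normal {v : ℂ → ℝ} {V Q : ℂ → ℂ} {S : Set ℂ} {c0 : ℝ} (hs : Sol v V Q S c0)
    {z : ℂ} (hz : z.im = 0) (hzS : z ∉ S) :
    HasDerivWithinAt (fun τ : ℝ => v (z + τ * I)) (2 * (V z * I).re) (Ici 0) 0 := by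
  have hzA : z ∈ Hb \ S := ⟨by simp [Hb, hz], hzS⟩
  have hm : ∀ τ ∈ Ioo (0:ℝ) 1, 0 < (z + τ * I).im := fun τ hτ => by simpa [hz] using hτ.1
  have hmaps : MapsTo (fun τ : ℝ => z + τ * I) (Ioo 0 1) (Hb \ S) := fun τ hτ =>
    ⟨(hm τ hτ).le, fun h => (hm τ hτ).ne' (hs.Sre _ h)⟩
  have hc : ContinuousWithinAt (fun τ : ℝ => z + τ * I) (Ioo 0 1) 0 := by fun_prop
  have h0 : z + ((0:ℝ):ℂ) * I = z := by simp
  refine normal_deriv one_pos I (fun τ hτ => (hs.trip _ (hm τ hτ)).dv) ?_ ?_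
  · exact ContinuousWithinAt.comp (by simpa [h0] using hs.cv z hzA) hc hmaps
  · exact ContinuousWithinAt.comp (by simpa [h0] using hs.cV z hzA) hc hmaps

set_option maxHeartbeats 2000000 in
theorem Sol.eps_reg {v : ℂ → ℝ} {V Q : ℂ → ℂ} {S : Set ℂ} {c0 : ℝ} (hs : Sol v V Q S c0)
    {z0 : ℂ} (hz0 : 0 ≤ z0.im) {R : ℝ} (hR : 0 < R) (hRS : ∀ z ∈ S, z ∉ Metric.closedBall z0 R)
    (hA : ∫ z in Metric.ball z0 R ∩ {z : ℂ | 0 < z.im}, Real.exp (v z) ≤ Real.exp (-(4 * c0 + 6))) :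
    R ^ 2 * Real.exp (v z0) ≤ 8 * Real.exp (4 * c0 + 6) *
      ∫ z in Metric.ball z0 R ∩ {z : ℂ | 0 < z.im}, Real.exp (v z) := by
  set A := ∫ z in Metric.ball z0 R ∩ {z : ℂ | 0 < z.im}, Real.exp (v z) with hAdef
  set M := 4 * c0 + 6 with hM
  have hKsub : Metric.closedBall z0 R ∩ Hb ⊆ Hb \ S := fun z hz => ⟨hz.2, fun h => hRS z h hz.1⟩
  have hK : IsCompact (Metric.closedBall z0 R ∩ Hb) :=
    (isCompact_closedBall _ _).inter_right (isClosed_le continuous_const continuous_im)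
  have hGc : ContinuousOn (fun z => (R - dist z z0) ^ 2 * Real.exp (v z)) (Metric.closedBall z0 R ∩ Hb) := by
    refine ContinuousOn.mul (by fun_prop) (Real.continuous_exp.comp_continuousOn (hs.cv.mono hKsub))
  have hz0K : z0 ∈ Metric.closedBall z0 R ∩ Hb := ⟨Metric.mem_closedBall_self hR.le, hz0⟩
  obtain ⟨z1, hz1, hmax⟩ := hK.exists_isMaxOn ⟨z0, hz0K⟩ hGc
  have hz1im : 0 ≤ z1.im := hz1.2
  set d := R - dist z1 z0 with hd
  set E := Real.exp (v z1) with hE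
  have hEpos : 0 < E := Real.exp_pos _
  have hG0 : R ^ 2 * Real.exp (v z0) ≤ d ^ 2 * E := by
    have := hmax hz0K
    simpa using this
  have hd0 : 0 ≤ d := by have := hz1.1; rw [Metric.mem_closedBall] at this; linarith
  have hdpos : 0 < d := by
    rcases hd0.eq_or_lt with h | h
    · exfalso
      rw [← h] at hG0
      have : 0 < R ^ 2 * Real.exp (v z0) := by positivity
      simp at hG0
      linarith
    · exact h
  set ρ := min (d / 2) (Real.sqrt E)⁻¹ with hρ
  have hsE : 0 < Real.sqrt E := Real.sqrt_pos.2 hEpos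
  have hρpos : 0 < ρ := lt_min (by linarith) (by positivity)
  have hρE : ρ * Real.sqrt E ≤ 1 := by
    calc ρ * Real.sqrt E ≤ (Real.sqrt E)⁻¹ * Real.sqrt E := by
          gcongr; exact min_le_right _ _
      _ = 1 := inv_mul_cancel₀ hsE.ne'
  have hsq : Real.sqrt E ^ 2 = E := Real.sq_sqrt hEpos.le
  have hρE2 : E * ρ ^ 2 ≤ 1 := by
    have : E * ρ ^ 2 = (ρ * Real.sqrt E) ^ 2 := by rw [mul_pow, hsq]; ring
    rw [this]
    exact pow_le_one₀ (by positivity) hρE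
  have hballs : ∀ z ∈ Metric.closedBall z1 ρ ∩ Hb, z ∈ Metric.closedBall z0 R ∩ Hb ∧ Real.exp (v z) ≤ 4 * E := by
    rintro z ⟨h1, h2⟩
    rw [Metric.mem_closedBall] at h1
    have h3 : dist z z0 ≤ R - d / 2 := by
      have := dist_triangle z z1 z0
      have h4 : ρ ≤ d / 2 := min_le_left _ _
      linarith
    have h5 : z ∈ Metric.closedBall z0 R ∩ Hb := ⟨by rw [Metric.mem_closedBall]; linarith, h2⟩
    refine ⟨h5, ?_⟩
    have h6 : (R - dist z z0) ^ 2 * Real.exp (v z) ≤ d ^ 2 * E := hmax h5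
    have h7 : (d / 2) ^ 2 * Real.exp (v z) ≤ (R - dist z z0) ^ 2 * Real.exp (v z) := by
      gcongr
      linarith
    have h8 : (d / 2) ^ 2 * Real.exp (v z) ≤ (d / 2) ^ 2 * (4 * E) := by nlinarith
    exact le_of_mul_le_mul_left h8 (by positivity)
  have hsubS : Metric.closedBall z1 ρ ∩ Hb ⊆ Hb \ S := fun z hz => hKsub (hballs z hz).1
  set k := (4 * c0 + 1) * Real.sqrt E with hk
  set f : ℂ → ℝ := fun z => v z + (5 * E * (z.re - z1.re) ^ 2 + k * (z.im + -z1.im)) with hf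
  have hcv : ContinuousOn v (Metric.closedBall z1 ρ ∩ Hb) := hs.cv.mono hsubS
  have hmean := subMean_ball f z1 hz1im hρpos ?_ ?_ ?_
  rotate_left
  · exact hcv.add (by fun_prop)
  · intro z hz hzp
    have hzb := hballs z ⟨Metric.ball_subset_closedBall hz, hzp.le⟩
    refine ⟨-2 * Real.exp (v z) + (5 * E * 2 + k * (0 + 0)), by nlinarith [hzb.2], ?_⟩
    refine LapAt.add (LapAt.of_trip (isOpen_lt continuous_const continuous_im)
      (fun w hw => hs.trip w hw) hzp) (LapAt.add ((LapAt.sq_re _ z).const_mul _)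
      (LapAt.const_mul k ((LapAt.im z).add (LapAt.const _ z))))
  · intro z hz hz0'
    have hzm : z ∈ Metric.closedBall z1 ρ ∩ Hb := ⟨Metric.ball_subset_closedBall hz, hz0'.ge⟩
    have hzb := (hballs z hzm).2
    have hzS := (hsubS hzm).2
    have h1 := hs.normal hz0' hzS
    have h2 : HasDerivWithinAt (fun τ : ℝ => 5 * E * ((z + τ * I).re - z1.re) ^ 2 + k * ((z + τ * I).im + -z1.im))
      k (Ici 0) 0 := by
      have := ((((hasDerivAt_id (0:ℝ)).const_add (z.im)).add_const (-z1.im)).const_mul k).const_add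
        (5 * E * (z.re - z1.re) ^ 2)
      simpa using this.hasDerivWithinAt
    refine ⟨_, ?_, h1.add h2⟩
    have h3 : |(V z).im| ≤ c0 * Real.exp (v z / 2) := by
      have e : z = ((z.re : ℝ) : ℂ) := by apply Complex.ext <;> simp [hz0']
      have := hs.bd z.re (by rwa [← e])
      rwa [← e] at this
    have h4 : Real.exp (v z / 2) ≤ 2 * Real.sqrt E := by
      have h5 : Real.exp (v z / 2) ^ 2 = Real.exp (v z) := by rw [← Real.exp_nat_mul]; congr 1; push_cast; ring
      nlinarith [Real.exp_pos (v z / 2)]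
    have h6 : (V z * I).re = - (V z).im := by simp
    have h7 : c0 * Real.exp (v z / 2) ≤ c0 * (2 * Real.sqrt E) := mul_le_mul_of_nonneg_left h4 hs.c0n
    have h8 := (abs_le.1 h3).2
    rw [h6, hk]
    nlinarith
  have hf1 : f z1 = v z1 := by simp [hf]
  rw [hf1] at hmean
  have hfold : ∀ z ∈ Metric.closedBall z1 ρ, foldH z ∈ Metric.closedBall z1 ρ ∩ Hb := fun z hz =>
    ⟨(foldH_dist_le hz1im).trans hz, foldH_im_nonneg z⟩
  have hvf : ContinuousOn (fun z => v (foldH z)) (Metric.closedBall z1 ρ) :=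
    hcv.comp continuous_foldH.continuousOn hfold
  have hi1 : IntegrableOn (fun z => v (foldH z)) (Metric.ball z1 ρ) :=
    (hvf.integrableOn_compact (isCompact_closedBall _ _)).mono_set Metric.ball_subset_closedBall
  have hi2 : IntegrableOn (fun z => Real.exp (v (foldH z))) (Metric.ball z1 ρ) :=
    ((Real.continuous_exp.comp_continuousOn hvf).integrableOn_compact
      (isCompact_closedBall _ _)).mono_set Metric.ball_subset_closedBall
  have hcf : ContinuousOn f (Metric.closedBall z1 ρ ∩ Hb) := hcv.add (by fun_prop)
  have hff : ContinuousOn (fun z => f (foldH z)) (Metric.closedBall z1 ρ) :=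
    hcf.comp continuous_foldH.continuousOn hfold
  have hi3 : IntegrableOn (fun z => f (foldH z)) (Metric.ball z1 ρ) :=
    (hff.integrableOn_compact (isCompact_closedBall _ _)).mono_set Metric.ball_subset_closedBall
  have hvol : (volume (Metric.ball z1 ρ)).toReal = Real.pi * ρ ^ 2 := by
    rw [Complex.volume_ball]; simp [hρpos.le]; ring
  have hvolf : volume (Metric.ball z1 ρ) ≠ ⊤ := measure_ball_lt_top.ne
  set a := v z1 - M with ha
  have hint1 : ∫ z in Metric.ball z1 ρ, f (foldH z) ≤ ∫ z in Metric.ball z1 ρ, (v (foldH z) + M) := by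
    refine setIntegral_mono_on hi3 (hi1.add (integrableOn_const hvolf)) Metric.isOpen_ball.measurableSet ?_
    intro z hz
    have hz' := (hfold z (Metric.ball_subset_closedBall hz)).1
    rw [Metric.mem_closedBall, dist_eq_norm] at hz'
    have r1 := (abs_re_le_norm (foldH z - z1)).trans hz'
    have r2 := (abs_im_le_norm (foldH z - z1)).trans hz'
    rw [sub_re] at r1
    rw [sub_im] at r2
    have r3 : ((foldH z).re - z1.re) ^ 2 ≤ ρ ^ 2 := by
      rw [← sq_abs]; gcongr
    have r4 := (abs_le.1 r2).2
    simp only [hf]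
    have r5 : k * ((foldH z).im + -z1.im) ≤ 4 * c0 + 1 := by
      have hc := hs.c0n
      calc k * ((foldH z).im + -z1.im) ≤ k * ρ := by
            apply mul_le_mul_of_nonneg_left (by linarith) (by positivity)
        _ = (4 * c0 + 1) * (ρ * Real.sqrt E) := by rw [hk]; ring
        _ ≤ (4 * c0 + 1) * 1 := mul_le_mul_of_nonneg_left hρE (by positivity)
        _ = _ := by ring
    have r6 : 5 * E * ((foldH z).re - z1.re) ^ 2 ≤ 5 := by nlinarith
    linarith
  have hconst : ∀ c : ℝ, ∫ _z in Metric.ball z1 ρ, c = Real.pi * ρ ^ 2 * c := by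
    intro c
    rw [setIntegral_const, smul_eq_mul, measureReal_def, hvol]
  rw [integral_add hi1 (integrableOn_const hvolf), hconst] at hint1
  have hic : IntegrableOn (fun _ : ℂ => Real.exp a * (1 - a)) (Metric.ball z1 ρ) := integrableOn_const hvolf
  have hJ : Real.exp a * (Real.pi * ρ ^ 2) ≤ ∫ z in Metric.ball z1 ρ, Real.exp (v (foldH z)) := by
    have h1 : ∫ z in Metric.ball z1 ρ, (Real.exp a * (1 - a) + Real.exp a * v (foldH z)) ≤
        ∫ z in Metric.ball z1 ρ, Real.exp (v (foldH z)) := by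
      refine setIntegral_mono_on (hic.add (hi1.const_mul _)) hi2
        Metric.isOpen_ball.measurableSet ?_
      intro z _
      have := Real.add_one_le_exp (v (foldH z) - a)
      have e : Real.exp (v (foldH z)) = Real.exp a * Real.exp (v (foldH z) - a) := by
        rw [← Real.exp_add]; congr 1; ring
      rw [e]
      nlinarith [Real.exp_pos a]
    rw [integral_add hic (hi1.const_mul _), hconst, integral_const_mul] at h1
    have h2 : a * (Real.pi * ρ ^ 2) ≤ ∫ z in Metric.ball z1 ρ, v (foldH z) := by
      rw [ha]; linarith
    have h3 := mul_le_mul_of_nonneg_left h2 (Real.exp_pos a).le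
    linarith
  have hfold2 := fold_integral_le (g := fun z => Real.exp (v z)) hz1im
    (Real.continuous_exp.comp_continuousOn hcv) (fun z _ => (Real.exp_pos _).le)
  have hAA : ∫ z in Metric.ball z1 ρ ∩ {z : ℂ | 0 < z.im}, Real.exp (v z) ≤ A := by
    refine setIntegral_mono_set (hs.fin.mono_set inter_subset_right)
      (Eventually.of_forall fun z => (Real.exp_pos _).le) (Eventually.of_forall ?_)
    intro z hz
    refine ⟨?_, hz.2⟩
    have h1 : dist z z1 < ρ := hz.1
    have h4 : ρ ≤ d / 2 := min_le_left _ _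
    have := dist_triangle z z1 z0
    rw [Metric.mem_ball]
    linarith
  have hfinal : E * Real.exp (-M) * (Real.pi * ρ ^ 2) ≤ 2 * A := by
    have : E * Real.exp (-M) = Real.exp a := by rw [hE, ← Real.exp_add]; congr 1
    rw [this]; linarith
  have hpi := Real.pi_gt_three
  have hex : Real.exp M * Real.exp (-M) = 1 := by rw [← Real.exp_add]; simp
  rcases min_choice (d / 2) (Real.sqrt E)⁻¹ with h | h
  · rw [← hρ] at h
    rw [h] at hfinal
    have h1 : d ^ 2 * E * Real.exp (-M) * 3 / 4 ≤ 2 * A := by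
      refine le_trans ?_ hfinal
      have : 0 < E * Real.exp (-M) * d ^ 2 := by positivity
      nlinarith
    have h2 := mul_le_mul_of_nonneg_left h1 (Real.exp_pos M).le
    have h3 : Real.exp M * (d ^ 2 * E * Real.exp (-M) * 3 / 4) = d ^ 2 * E * 3 / 4 := by
      linear_combination (d ^ 2 * E * 3 / 4) * hex
    have hA0 : 0 ≤ A := by
      have : 0 ≤ E * Real.exp (-M) * (Real.pi * (d/2) ^ 2) := by positivity
      linarith
    have : 0 ≤ Real.exp M * A := by positivity
    linarith
  · exfalso
    rw [← hρ] at h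
    have h1 : E * ρ ^ 2 = 1 := by
      rw [h, inv_pow, hsq]; exact mul_inv_cancel₀ hEpos.ne'
    have h2 : E * Real.exp (-M) * (Real.pi * ρ ^ 2) = Real.exp (-M) * Real.pi := by
      linear_combination (Real.exp (-M) * Real.pi) * h1
    rw [h2] at hfinal
    nlinarith [Real.exp_pos (-M)]

end Part7

section Part8
open scoped Topology Interval

/-- Divergence theorem on a rectangle in `ℂ`. -/
theorem rect_div {E : Type*} [NormedAddCommGroup E] [NormedSpace ℝ E] [CompleteSpace E]
    {A B G : ℂ → E} {x1 x2 y1 y2 : ℝ}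
    (hA : ContinuousOn A ([[x1, x2]] ×ℂ [[y1, y2]])) (hB : ContinuousOn B ([[x1, x2]] ×ℂ [[y1, y2]]))
    (hG : ContinuousOn G ([[x1, x2]] ×ℂ [[y1, y2]]))
    (hd : ∀ z ∈ Ioo (min x1 x2) (max x1 x2) ×ℂ Ioo (min y1 y2) (max y1 y2), ∃ A' B' : ℂ →L[ℝ] E,
      HasFDerivAt A A' z ∧ HasFDerivAt B B' z ∧ B' 1 + A' I = G z) :
    (∫ x in x1..x2, ∫ y in y1..y2, G (x + y * I)) =
      (((∫ x in x1..x2, A (x + y2 * I)) - ∫ x in x1..x2, A (x + y1 * I)) +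
        ∫ y in y1..y2, B (x2 + y * I)) - ∫ y in y1..y2, B (x1 + y * I) := by
  set e : (ℝ × ℝ) ≃L[ℝ] ℂ := equivRealProdCLM.symm with he
  have e1 : ∀ x y : ℝ, e (x, y) = x + y * I := fun x y => Complex.equivRealProd_symm_apply (x, y)
  have hmem : ∀ (p : ℝ × ℝ) (s t : Set ℝ), p ∈ s ×ˢ t → e p ∈ s ×ℂ t := by
    rintro ⟨x, y⟩ s t h
    rw [mem_prod] at h
    rw [e1, mem_reProdIm]
    simpa using h
  choose! A' B' h1 h2 h3 using hd
  have hder : ∀ p ∈ Ioo (min x1 x2) (max x1 x2) ×ˢ Ioo (min y1 y2) (max y1 y2),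
      ((B' (e p)).comp (e : ℝ × ℝ →L[ℝ] ℂ)) (1, 0) + ((A' (e p)).comp (e : ℝ × ℝ →L[ℝ] ℂ)) (0, 1) = G (e p) := by
    intro p hp
    have a1 : e (1, 0) = 1 := by rw [e1]; simp
    have a2 : e (0, 1) = I := by rw [e1]; simp
    rw [ContinuousLinearMap.comp_apply, ContinuousLinearMap.comp_apply]
    erw [a1, a2]
    exact h3 _ (hmem _ _ _ hp)
  have hcG : ContinuousOn (fun p => G (e p)) ([[x1, x2]] ×ˢ [[y1, y2]]) :=
    hG.comp e.continuous.continuousOn (fun p hp => hmem _ _ _ hp)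
  have hae : (Ioo (min x1 x2) (max x1 x2) ×ˢ Ioo (min y1 y2) (max y1 y2) : Set (ℝ × ℝ)) =ᵐ[volume]
      ([[x1, x2]] ×ˢ [[y1, y2]] : Set (ℝ × ℝ)) :=
    Measure.set_prod_ae_eq Ioo_ae_eq_Icc Ioo_ae_eq_Icc
  have hI : IntegrableOn (fun p => ((B' (e p)).comp (e : ℝ × ℝ →L[ℝ] ℂ)) (1, 0) +
      ((A' (e p)).comp (e : ℝ × ℝ →L[ℝ] ℂ)) (0, 1)) ([[x1, x2]] ×ˢ [[y1, y2]]) := by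
    have := (hcG.integrableOn_compact (isCompact_uIcc.prod isCompact_uIcc)).congr_set_ae hae
    refine IntegrableOn.congr_set_ae ?_ hae.symm
    exact this.congr_fun (fun p hp => (hder p hp).symm) (measurableSet_Ioo.prod measurableSet_Ioo)
  have key := integral2_divergence_prod_of_hasFDerivAt (fun p => B (e p)) (fun p => A (e p))
    (fun p => (B' (e p)).comp (e : ℝ × ℝ →L[ℝ] ℂ)) (fun p => (A' (e p)).comp (e : ℝ × ℝ →L[ℝ] ℂ)) x1 y1 x2 y2
    (hB.comp e.continuous.continuousOn (fun p hp => hmem _ _ _ hp))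
    (hA.comp e.continuous.continuousOn (fun p hp => hmem _ _ _ hp))
    (fun p hp => (h2 _ (hmem _ _ _ hp)).comp p e.hasFDerivAt)
    (fun p hp => (h1 _ (hmem _ _ _ hp)).comp p e.hasFDerivAt) hI
  simp only [e1] at key
  rw [← key]
  have io : ∀ a b : ℝ, ∀ᵐ x : ℝ, x ∈ Ι a b → x ∈ Ioo (min a b) (max a b) := by
    intro a b
    have : ∀ᵐ x : ℝ, x ≠ max a b := by simp [ae_iff]
    filter_upwards [this] with x hx h
    exact ⟨h.1, lt_of_le_of_ne h.2 hx⟩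
  refine intervalIntegral.integral_congr_ae ?_
  filter_upwards [io x1 x2] with x hx hx'
  refine intervalIntegral.integral_congr_ae ?_
  filter_upwards [io y1 y2] with y hy hy'
  have := hder (x, y) ⟨hx hx', hy hy'⟩
  simp only [e1] at this
  exact this.symm

theorem rect_fubini {G : ℂ → ℝ} {x1 x2 y1 y2 : ℝ} (hx : x1 ≤ x2) (hy : y1 ≤ y2)
    (hG : ContinuousOn G (Icc x1 x2 ×ℂ Icc y1 y2)) :
    ∫ z in Icc x1 x2 ×ℂ Icc y1 y2, G z = ∫ x in x1..x2, ∫ y in y1..y2, G (x + y * I) := by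
  have h1 := Complex.volume_preserving_equiv_real_prod.symm.setIntegral_preimage_emb
    Complex.measurableEquivRealProd.symm.measurableEmbedding G (Icc x1 x2 ×ℂ Icc y1 y2)
  have e1 : ∀ p : ℝ × ℝ, measurableEquivRealProd.symm p = p.1 + p.2 * I := fun p => by
    apply Complex.ext <;> simp [measurableEquivRealProd]
  have hpre : (measurableEquivRealProd.symm ⁻¹' (Icc x1 x2 ×ℂ Icc y1 y2)) = Icc x1 x2 ×ˢ Icc y1 y2 := by
    ext p
    rw [mem_preimage, e1, mem_reProdIm, mem_prod]
    simp
  rw [hpre] at h1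
  rw [← h1]
  simp only [e1]
  have hc : ContinuousOn (fun p : ℝ × ℝ => G (p.1 + p.2 * I)) (Icc x1 x2 ×ˢ Icc y1 y2) := by
    refine hG.comp (by fun_prop) (fun p hp => ?_)
    rw [mem_reProdIm]
    rw [mem_prod] at hp
    simpa using hp
  rw [Measure.volume_eq_prod, setIntegral_prod _ (hc.integrableOn_compact (isCompact_Icc.prod isCompact_Icc))]
  rw [intervalIntegral.integral_of_le hx, integral_Icc_eq_integral_Ioc]
  simp_rw [intervalIntegral.integral_of_le hy, integral_Icc_eq_integral_Ioc]

end Part8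

section Part9
open scoped Topology Interval

theorem LTrip.dexp {v : ℂ → ℝ} {V Q : ℂ → ℂ} {z : ℂ} (h : LTrip v V Q z) :
    HasFDerivAt (fun w => ((Real.exp (v w) : ℝ) : ℂ)) (ofRealCLM.comp (Real.exp (v z) • reF (V z))) z :=
  (ofRealCLM.hasFDerivAt (x := Real.exp (v z))).comp z h.dv.exp

theorem holo_of_trip {v : ℂ → ℝ} {V Q : ℂ → ℂ} {U : Set ℂ} (hU : IsOpen U)
    (h : ∀ z ∈ U, LTrip v V Q z) (hQ : ContinuousOn Q U) : DifferentiableOn ℂ Q U := by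
  have cv : ContinuousOn v U := fun z hz => (h z hz).dv.continuousAt.continuousWithinAt
  have cV : ContinuousOn V U := fun z hz => (h z hz).dV.continuousAt.continuousWithinAt
  have cE : ContinuousOn (fun z => ((Real.exp (v z) : ℝ) : ℂ)) U :=
    fun z hz => (h z hz).dexp.continuousAt.continuousWithinAt
  intro z0 hz0
  obtain ⟨r, hr, hball⟩ := Metric.isOpen_iff.1 hU z0 hz0
  have hcons : IsConservativeOn Q (Metric.ball z0 r) := by
    intro z w hzw
    have hR : [[z.re, w.re]] ×ℂ [[z.im, w.im]] ⊆ U := hzw.trans hball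
    rw [← add_eq_zero_iff_eq_neg, wedgeIntegral_add_wedgeIntegral_eq]
    set P : ℂ → ℂ := fun z => (1 / 2) * ((Real.exp (v z) : ℝ) : ℂ) - (1 / 2) * (V z * V z) with hP
    set T : ℂ → ℂ := fun z => -(I / 2) * (((Real.exp (v z) : ℝ) : ℂ) + V z * V z) with hT
    have cP : ContinuousOn P U := (continuousOn_const.mul cE).sub (continuousOn_const.mul (cV.mul cV))
    have cT : ContinuousOn T U := continuousOn_const.mul (cE.add (cV.mul cV))
    have lineH : ∀ y : ℝ, ∀ x ∈ [[z.re, w.re]], y ∈ [[z.im, w.im]] → ((x:ℂ) + y * I) ∈ U := by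
      intro y x hx hy
      apply hR
      rw [mem_reProdIm]; simpa using ⟨hx, hy⟩
    have hor : ∀ y ∈ [[z.im, w.im]], ∫ x in z.re..w.re, Q (x + y * I) =
        V (w.re + y * I) - V (z.re + y * I) + ∫ x in z.re..w.re, P (x + y * I) := by
      intro y hy
      have hm : MapsTo (fun x : ℝ => (x:ℂ) + y * I) [[z.re, w.re]] U := fun x hx => lineH y x hx hy
      have hc : ContinuousOn (fun x : ℝ => (x:ℂ) + y * I) [[z.re, w.re]] := by fun_prop
      have iQ := (hQ.comp hc hm).intervalIntegrable (μ := volume)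
      have iP := (cP.comp hc hm).intervalIntegrable (μ := volume)
      have hd : ∀ x ∈ [[z.re, w.re]], HasDerivAt (fun x : ℝ => V (x + y * I))
          (Q (x + y * I) - P (x + y * I)) x := by
        intro x hx
        have h1 := (h _ (hm hx)).dV.comp_hasDerivAt x
          (((hasDerivAt_id x).ofReal_comp).add_const ((y:ℂ) * I))
        refine HasDerivAt.congr_deriv h1 ?_
        rw [cF_apply]; simp [hP]; ring
      have := intervalIntegral.integral_eq_sub_of_hasDerivAt hd (iQ.sub iP)
      simp only [Function.comp_def] at iQ iP
      rw [← this, intervalIntegral.integral_sub iQ iP]; ring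
    have ver : ∀ x ∈ [[z.re, w.re]], I * ∫ y in z.im..w.im, Q (x + y * I) =
        V (x + w.im * I) - V (x + z.im * I) + ∫ y in z.im..w.im, T (x + y * I) := by
      intro x hx
      have hm : MapsTo (fun y : ℝ => (x:ℂ) + y * I) [[z.im, w.im]] U := fun y hy => lineH y x hx hy
      have hc : ContinuousOn (fun y : ℝ => (x:ℂ) + y * I) [[z.im, w.im]] := by fun_prop
      have iQ := ((hQ.comp hc hm).intervalIntegrable (μ := volume)).const_mul I
      have iT := (cT.comp hc hm).intervalIntegrable (μ := volume)
      have hd : ∀ y ∈ [[z.im, w.im]], HasDerivAt (fun y : ℝ => V (x + y * I))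
          (I * Q (x + y * I) - T (x + y * I)) y := by
        intro y hy
        have h1 := (h _ (hm hy)).dV.comp_hasDerivAt y
          ((((hasDerivAt_id y).ofReal_comp).mul_const I).const_add (x:ℂ))
        refine HasDerivAt.congr_deriv h1 ?_
        rw [cF_apply]; simp [hT]; ring
      have := intervalIntegral.integral_eq_sub_of_hasDerivAt hd (iQ.sub iT)
      simp only [Function.comp_def] at iQ iT
      rw [← this, intervalIntegral.integral_sub iQ iT, intervalIntegral.integral_const_mul]; ring
    have hdiv := rect_div (A := fun z => -P z) (B := T) (G := fun _ => (0:ℂ)) (x1 := z.re) (x2 := w.re)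
      (y1 := z.im) (y2 := w.im) (cP.neg.mono hR) (cT.mono hR) continuousOn_const ?_
    rotate_left
    · intro ζ hζ
      have hζU : ζ ∈ U := by
        apply hR
        rw [mem_reProdIm] at hζ ⊢
        exact ⟨Ioo_subset_Icc_self hζ.1, Ioo_subset_Icc_self hζ.2⟩
      have t := h ζ hζU
      refine ⟨_, _, ((t.dexp.const_mul _).sub ((t.dV.mul t.dV).const_mul _)).neg,
        (t.dexp.add (t.dV.mul t.dV)).const_mul _, ?_⟩
      simp [cF_apply, reF_apply]
      apply Complex.ext <;> simp <;> ring
    simp only [intervalIntegral.integral_zero, intervalIntegral.integral_neg] at hdiv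
    rw [hor _ left_mem_uIcc, hor _ right_mem_uIcc, smul_eq_mul, smul_eq_mul, ver _ right_mem_uIcc,
      ver _ left_mem_uIcc]
    linear_combination -hdiv
  have := (isConservativeOn_and_continuousOn_iff_isDifferentiableOn Metric.isOpen_ball).1
    ⟨hcons, hQ.mono hball⟩
  exact (this.differentiableAt (Metric.ball_mem_nhds _ hr)).differentiableWithinAt

/-- A continuous function which is holomorphic off the real axis is holomorphic. -/
theorem holo_of_off_real {F : ℂ → ℂ} {U : Set ℂ} (hU : IsOpen U) (hF : ContinuousOn F U)
    (hd : ∀ z ∈ U, z.im ≠ 0 → DifferentiableAt ℂ F z) : DifferentiableOn ℂ F U := by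
  intro z0 hz0
  obtain ⟨r, hr, hball⟩ := Metric.isOpen_iff.1 hU z0 hz0
  have hcons : IsConservativeOn F (Metric.ball z0 r) := by
    intro z w hzw
    have hR : [[z.re, w.re]] ×ℂ [[z.im, w.im]] ⊆ U := hzw.trans hball
    rw [← add_eq_zero_iff_eq_neg, wedgeIntegral_add_wedgeIntegral_eq]
    -- rectangles not crossing the axis
    have base : ∀ a b : ℝ, [[a, b]] ⊆ [[z.im, w.im]] → (0:ℝ) ∉ Ioo (min a b) (max a b) →
        (∫ x : ℝ in z.re..w.re, F (x + a * I)) - (∫ x : ℝ in z.re..w.re, F (x + b * I)) +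
        I • (∫ y : ℝ in a..b, F (w.re + y * I)) - I • (∫ y : ℝ in a..b, F (z.re + y * I)) = 0 := by
      intro a b hab h0
      have hsub : [[z.re, w.re]] ×ℂ [[a, b]] ⊆ U := fun ζ hζ => hR ⟨hζ.1, hab hζ.2⟩
      have := integral_boundary_rect_eq_zero_of_continuousOn_of_differentiableOn F
        (z.re + a * I) (w.re + b * I) ?_ ?_
      · simpa using this
      · simpa using hF.mono hsub
      · intro ζ hζ
        simp at hζ
        refine (hd ζ (hsub ?_) ?_).differentiableWithinAt
        · rw [mem_reProdIm] at hζ ⊢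
          exact ⟨Ioo_subset_Icc_self hζ.1, Ioo_subset_Icc_self hζ.2⟩
        · intro h
          rw [mem_reProdIm, h] at hζ
          exact h0 hζ.2
    by_cases h0 : (0:ℝ) ∈ [[z.im, w.im]]
    · have b1 := base z.im 0 (uIcc_subset_uIcc left_mem_uIcc h0) (by
        intro h
        rcases le_total z.im 0 with h' | h' <;> simp [h'] at h)
      have b2 := base 0 w.im (uIcc_subset_uIcc h0 right_mem_uIcc) (by
        intro h
        rcases le_total w.im 0 with h' | h' <;> simp [h'] at h)
      have ci : ∀ x ∈ [[z.re, w.re]], ContinuousOn (fun y : ℝ => F (x + y * I)) [[z.im, w.im]] := by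
        intro x hx
        refine hF.comp (by fun_prop) (fun y hy => hR ?_)
        rw [mem_reProdIm]; simpa using ⟨hx, hy⟩
      have split : ∀ x ∈ [[z.re, w.re]], (∫ y : ℝ in z.im..w.im, F (x + y * I)) =
          (∫ y : ℝ in z.im..0, F (x + y * I)) + ∫ y : ℝ in (0:ℝ)..w.im, F (x + y * I) := by
        intro x hx
        rw [intervalIntegral.integral_add_adjacent_intervals]
        · exact ((ci x hx).mono (uIcc_subset_uIcc left_mem_uIcc h0)).intervalIntegrable
        · exact ((ci x hx).mono (uIcc_subset_uIcc h0 right_mem_uIcc)).intervalIntegrable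
      rw [split _ left_mem_uIcc, split _ right_mem_uIcc]
      simp only [smul_eq_mul] at b1 b2 ⊢
      linear_combination b1 + b2
    · exact base _ _ le_rfl (fun h => h0 (Ioo_subset_Icc_self h))
  have := (isConservativeOn_and_continuousOn_iff_isDifferentiableOn Metric.isOpen_ball).1
    ⟨hcons, hF.mono hball⟩
  exact (this.differentiableAt (Metric.ball_mem_nhds _ hr)).differentiableWithinAt

end Part9

section Part10
open scoped Topology Interval

/-- Extension by reflection. -/
noncomputable def Qx (Q : ℂ → ℂ) (z : ℂ) : ℂ :=
  if 0 ≤ z.im then Q z else (starRingEnd ℂ) (Q ((starRingEnd ℂ) z))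

section
variable {v : ℂ → ℝ} {V Q : ℂ → ℂ} {S : Set ℂ} {c0 : ℝ}

theorem Sol.conj_mem (hs : Sol v V Q S c0) {z : ℂ} : (starRingEnd ℂ) z ∈ S ↔ z ∈ S := by
  constructor
  · intro h
    have h1 := hs.Sre _ h
    rw [conj_im, neg_eq_zero] at h1
    rwa [conj_eq_iff_im.2 h1] at h
  · intro h
    rwa [conj_eq_iff_im.2 (hs.Sre _ h)]

theorem Sol.real_conj (hs : Sol v V Q S c0) {z : ℂ} (hz : z.im = 0) (hzS : z ∉ S) :
    (starRingEnd ℂ) (Q z) = Q z := by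
  have e : z = ((z.re : ℝ) : ℂ) := by apply Complex.ext <;> simp [hz]
  apply conj_eq_iff_im.2
  have := hs.realQ z.re (by rwa [← e])
  rwa [← e] at this

theorem Sol.Qx_low (hs : Sol v V Q S c0) {z : ℂ} (hz : z.im ≤ 0) (hzS : z ∉ S) :
    Qx Q z = (starRingEnd ℂ) (Q ((starRingEnd ℂ) z)) := by
  unfold Qx
  split_ifs with h
  · have h0 : z.im = 0 := le_antisymm hz h
    rw [conj_eq_iff_im.2 h0, hs.real_conj h0 hzS]
  · rfl

theorem Qx_up {Q : ℂ → ℂ} {z : ℂ} (hz : 0 ≤ z.im) : Qx Q z = Q z := if_pos hz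

theorem Sol.Qx_conj (hs : Sol v V Q S c0) {z : ℂ} (hzS : z ∉ S) :
    Qx Q ((starRingEnd ℂ) z) = (starRingEnd ℂ) (Qx Q z) := by
  rcases le_total 0 z.im with h | h
  · rw [Qx_up h, hs.Qx_low (by simpa using h) (by rwa [hs.conj_mem]), conj_conj]
  · rw [hs.Qx_low h hzS, Qx_up (by simpa using h), conj_conj]

theorem Sol.Sclosed (hs : Sol v V Q S c0) : IsClosed S := hs.Sfin.isClosed

theorem Sol.holoQ (hs : Sol v V Q S c0) : DifferentiableOn ℂ Q {z | 0 < z.im} := by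
  refine holo_of_trip (isOpen_lt continuous_const continuous_im) (fun z hz => hs.trip z hz)
    (hs.cQ.mono ?_)
  intro z (hz : 0 < z.im)
  exact ⟨hz.le, fun h => hz.ne' (hs.Sre _ h)⟩

theorem Sol.holoQx (hs : Sol v V Q S c0) : DifferentiableOn ℂ (Qx Q) Sᶜ := by
  refine holo_of_off_real hs.Sclosed.isOpen_compl ?_ ?_
  · have c1 : ContinuousOn (Qx Q) (Hb \ S) := hs.cQ.congr fun z hz => Qx_up hz.1
    have c2 : ContinuousOn (Qx Q) ({z | z.im ≤ 0} \ S) := by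
      have : ContinuousOn (fun z => (starRingEnd ℂ) (Q ((starRingEnd ℂ) z))) ({z | z.im ≤ 0} \ S) := by
        refine continuous_conj.comp_continuousOn (hs.cQ.comp continuous_conj.continuousOn ?_)
        intro z hz
        have h1 : z.im ≤ 0 := hz.1
        exact ⟨by simpa [Hb] using h1, by rw [hs.conj_mem]; exact hz.2⟩
      exact this.congr fun z hz => hs.Qx_low hz.1 hz.2
    intro z hz
    have hn : Sᶜ ∈ 𝓝 z := hs.Sclosed.isOpen_compl.mem_nhds hz
    have d1 : ContinuousWithinAt (Qx Q) Hb z := by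
      by_cases h : 0 ≤ z.im
      · have := c1 z ⟨h, hz⟩
        rwa [Set.sdiff_eq, continuousWithinAt_inter hn] at this
      · refine continuousWithinAt_of_notMem_closure ?_
        have hcl : IsClosed Hb := isClosed_le continuous_const continuous_im
        rw [hcl.closure_eq]
        exact h
    have d2 : ContinuousWithinAt (Qx Q) {z | z.im ≤ 0} z := by
      by_cases h : z.im ≤ 0
      · have := c2 z ⟨h, hz⟩
        rwa [Set.sdiff_eq, continuousWithinAt_inter hn] at this
      · refine continuousWithinAt_of_notMem_closure ?_
        rw [(isClosed_le continuous_im continuous_const : IsClosed {z : ℂ | z.im ≤ 0}).closure_eq]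
        exact h
    have := d1.union d2
    refine ContinuousWithinAt.mono this fun w _ => ?_
    exact le_total 0 w.im
  · intro z hz h0
    rcases lt_or_gt_of_ne h0 with h | h
    · have o : IsOpen {z : ℂ | z.im < 0} := isOpen_lt continuous_im continuous_const
      have hd : DifferentiableAt ℂ Q ((starRingEnd ℂ) z) :=
        hs.holoQ.differentiableAt ((isOpen_lt continuous_const continuous_im).mem_nhds (by
          simpa using h))
      have hd2 := hd.conj_conj
      rw [conj_conj] at hd2
      refine hd2.congr_of_eventuallyEq ?_
      filter_upwards [o.mem_nhds h] with w hw
      exact if_neg (not_le.2 hw)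
    · have o : IsOpen {z : ℂ | 0 < z.im} := isOpen_lt continuous_const continuous_im
      refine (hs.holoQ.differentiableAt (o.mem_nhds h)).congr_of_eventuallyEq ?_
      filter_upwards [o.mem_nhds h] with w hw
      exact Qx_up (le_of_lt hw)
end

end Part10

section Part11
open scoped Topology Interval

theorem Sol.decay {v : ℂ → ℝ} {V Q : ℂ → ℂ} {S : Set ℂ} {c0 : ℝ} (hs : Sol v V Q S c0)
    {a : ℂ} {σ X1 : ℝ} (hσ : σ = 1 ∨ σ = -1) (hS : ∀ s ∈ S, s = a ∨ X1 ≤ σ * Real.log ‖s - a‖)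
    {ε : ℝ} (hε : 0 < ε) :
    ∃ X : ℝ, ∀ z : ℂ, 0 ≤ z.im → z ≠ a → σ * Real.log ‖z - a‖ ≤ X →
      ‖z - a‖ ^ 2 * Real.exp (v z) ≤ ε := by
  set B : ℕ → Set ℂ := fun n => {w | 0 < w.im ∧ σ * Real.log ‖w - a‖ < -(n:ℝ)} with hB
  have hBm : ∀ n, MeasurableSet (B n) := by
    intro n
    have m1 : MeasurableSet {w : ℂ | 0 < w.im} := measurableSet_lt measurable_const measurable_im
    have m2 : MeasurableSet {w : ℂ | σ * Real.log ‖w - a‖ < -(n:ℝ)} :=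
      measurableSet_lt (by fun_prop) measurable_const
    exact m1.inter m2
  have hBa : Antitone B := by
    intro n m hnm w hw
    have : (n:ℝ) ≤ m := by exact_mod_cast hnm
    exact ⟨hw.1, lt_of_lt_of_le hw.2 (by linarith)⟩
  have hBe : ⋂ n, B n = ∅ := by
    rw [eq_empty_iff_forall_notMem]
    intro w hw
    rw [mem_iInter] at hw
    obtain ⟨n, hn⟩ := exists_nat_gt (-(σ * Real.log ‖w - a‖))
    have := (hw n).2
    linarith
  have ht := tendsto_setIntegral_of_antitone (μ := volume) (f := fun z => Real.exp (v z)) hBm hBa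
    ⟨0, hs.fin.mono_set fun w hw => hw.1⟩
  rw [hBe, setIntegral_empty] at ht
  set M := 4 * c0 + 6 with hM
  set δ := min (Real.exp (-M)) (ε / (32 * Real.exp M)) with hδ
  have hδpos : 0 < δ := lt_min (Real.exp_pos _) (by positivity)
  obtain ⟨n, hn⟩ := (ht.eventually_lt_const hδpos).exists
  refine ⟨min (-(n:ℝ) - 1) (X1 - 2), fun z hz hza hX => ?_⟩
  have hX1 := hX.trans (min_le_left _ _)
  have hX2 := hX.trans (min_le_right _ _)
  have hd : 0 < ‖z - a‖ := norm_pos_iff.2 (sub_ne_zero.2 hza)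
  have hlog : ∀ w ∈ Metric.closedBall z (‖z - a‖ / 2), 0 < ‖w - a‖ ∧
      σ * Real.log ‖w - a‖ < σ * Real.log ‖z - a‖ + 1 := by
    intro w hw
    rw [mem_closedBall_iff_norm] at hw
    have h1 : ‖z - a‖ / 2 ≤ ‖w - a‖ := by
      have : ‖z - a‖ ≤ ‖w - a‖ + ‖w - z‖ := by
        have := norm_sub_le (w - a) (w - z)
        simpa using this
      linarith
    have h2 : ‖w - a‖ ≤ 2 * ‖z - a‖ := by
      have : ‖w - a‖ ≤ ‖w - z‖ + ‖z - a‖ := by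
        have := norm_add_le (w - z) (z - a)
        simpa using this
      linarith
    have h3 : 0 < ‖w - a‖ := by linarith
    refine ⟨h3, ?_⟩
    have l1 := Real.log_le_log (by positivity) h1
    have l2 := Real.log_le_log h3 h2
    rw [Real.log_div hd.ne' (by norm_num)] at l1
    rw [Real.log_mul (by norm_num) hd.ne'] at l2
    have := Real.log_two_lt_d9
    rcases hσ with h | h <;> rw [h] <;> linarith
  have hbound0 : ∫ w in Metric.ball z (‖z - a‖ / 2) ∩ {w : ℂ | 0 < w.im}, Real.exp (v w) ≤ δ := by
    refine le_trans ?_ hn.le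
    refine setIntegral_mono_set (hs.fin.mono_set fun w hw => hw.1)
      (Eventually.of_forall fun z => (Real.exp_pos _).le) (Eventually.of_forall ?_)
    intro w hw
    exact ⟨hw.2, by linarith [(hlog w (Metric.ball_subset_closedBall hw.1)).2]⟩
  have := hs.eps_reg hz (R := ‖z - a‖ / 2) (by positivity) ?_ (hbound0.trans (min_le_left _ _))
  · have h1 : 8 * Real.exp M * ∫ w in Metric.ball z (‖z - a‖ / 2) ∩ {w : ℂ | 0 < w.im}, Real.exp (v w) ≤
        8 * Real.exp M * (ε / (32 * Real.exp M)) := by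
      gcongr
      exact hbound0.trans (min_le_right _ _)
    have h2 : 8 * Real.exp M * (ε / (32 * Real.exp M)) = ε / 4 := by
      have := (Real.exp_pos M).ne'
      field_simp
      ring
    have h3 := this.trans h1
    rw [h2] at h3
    nlinarith
  · intro s hsS hsb
    have h1 := hlog s hsb
    rcases hS s hsS with h | h
    · rw [h, sub_self, norm_zero] at h1
      exact lt_irrefl _ h1.1
    · linarith [h1.2]

end Part11

section Part12
open scoped Topology Interval

/-- Closed half strip. -/
def Tb (X : ℝ) : Set ℂ := {ζ | ζ.re < X ∧ 0 ≤ ζ.im ∧ ζ.im ≤ Real.pi}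

/-- Open half strip. -/
def To (X : ℝ) : Set ℂ := {ζ | ζ.re < X ∧ 0 < ζ.im ∧ ζ.im < Real.pi}

/-- A solution of the Liouville equation in a half strip. -/
structure Strip (u : ℂ → ℝ) (D q : ℂ → ℂ) (X c0 : ℝ) : Prop where
  c0n : 0 ≤ c0
  cu : ContinuousOn u (Tb X)
  cD : ContinuousOn D (Tb X)
  cq : ContinuousOn q (Tb X)
  trip : ∀ ζ ∈ To X, LTrip u D q ζ
  bd : ∀ ζ ∈ Tb X, ζ.im = 0 ∨ ζ.im = Real.pi → |(D ζ).im| ≤ c0 * Real.exp (u ζ / 2)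
  rq : ∀ ζ ∈ Tb X, ζ.im = 0 ∨ ζ.im = Real.pi → (q ζ).im = 0
  neg : ∀ ζ ∈ Tb X, u ζ ≤ 0
  dec : ∀ ε > 0, ∃ X', ∀ ζ ∈ Tb X, ζ.re ≤ X' → Real.exp (u ζ) ≤ ε
  lu : ∀ x : ℝ, x < X → HasDerivAt (fun x : ℝ => u x) (2 * (D x).re) x
  lD : ∀ x : ℝ, x < X → HasDerivAt (fun x : ℝ => D x) (q x + D x ^ 2 / 2 - (Real.exp (u x) / 2 : ℝ)) x

theorem isOpen_To (X : ℝ) : IsOpen (To X) := by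
  have : To X = {ζ : ℂ | ζ.re < X} ∩ ({ζ | 0 < ζ.im} ∩ {ζ | ζ.im < Real.pi}) := rfl
  rw [this]
  exact (isOpen_lt continuous_re continuous_const).inter
    ((isOpen_lt continuous_const continuous_im).inter (isOpen_lt continuous_im continuous_const))

theorem To_sub (X : ℝ) : To X ⊆ Tb X := fun _ h => ⟨h.1, h.2.1.le, h.2.2.le⟩

theorem mem_Tb {X x y : ℝ} (hx : x < X) (h0 : 0 ≤ y) (h1 : y ≤ Real.pi) : ((x:ℂ) + y * I) ∈ Tb X := by
  refine ⟨?_, ?_, ?_⟩ <;> simpa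

theorem box_sub {X x1 x2 : ℝ} (h2 : x2 < X) : Icc x1 x2 ×ℂ Icc 0 Real.pi ⊆ Tb X := by
  intro z hz
  rw [mem_reProdIm] at hz
  exact ⟨hz.1.2.trans_lt h2, hz.2.1, hz.2.2⟩

theorem strip_div {X x1 x2 : ℝ} (h12 : x1 ≤ x2) (h2 : x2 < X) {A B G : ℂ → ℝ}
    (hA : ContinuousOn A (Tb X)) (hB : ContinuousOn B (Tb X)) (hG : ContinuousOn G (Tb X))
    (hd : ∀ z ∈ To X, ∃ A' B' : ℂ →L[ℝ] ℝ,
      HasFDerivAt A A' z ∧ HasFDerivAt B B' z ∧ B' 1 + A' I = G z) :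
    (∫ z in Icc x1 x2 ×ℂ Icc 0 Real.pi, G z) =
      (((∫ x in x1..x2, A (x + Real.pi * I)) - ∫ x in x1..x2, A (x + (0:ℝ) * I)) +
        ∫ y in (0:ℝ)..Real.pi, B (x2 + y * I)) - ∫ y in (0:ℝ)..Real.pi, B (x1 + y * I) := by
  have hpi := Real.pi_pos
  have hsub := box_sub (x1 := x1) h2
  rw [rect_fubini h12 hpi.le (hG.mono hsub)]
  refine rect_div ?_ ?_ ?_ ?_
  · rw [uIcc_of_le h12, uIcc_of_le hpi.le]; exact hA.mono hsub
  · rw [uIcc_of_le h12, uIcc_of_le hpi.le]; exact hB.mono hsub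
  · rw [uIcc_of_le h12, uIcc_of_le hpi.le]; exact hG.mono hsub
  · rw [min_eq_left h12, max_eq_right h12, min_eq_left hpi.le, max_eq_right hpi.le]
    intro z hz
    rw [mem_reProdIm] at hz
    exact hd z ⟨hz.1.2.trans h2, hz.2.1, hz.2.2⟩

theorem isCompact_box (x1 x2 : ℝ) : IsCompact (Icc x1 x2 ×ℂ Icc 0 Real.pi) :=
  isCompact_Icc.reProdIm isCompact_Icc

theorem vol_box {x1 x2 : ℝ} (h : x1 ≤ x2) (c : ℝ) :
    ∫ _z in Icc x1 x2 ×ℂ Icc 0 Real.pi, c = (x2 - x1) * Real.pi * c := by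
  rw [rect_fubini h Real.pi_pos.le continuousOn_const]
  simp
  ring

theorem box_mono {X x1 x2 : ℝ} (h2 : x2 < X) {F G : ℂ → ℝ}
    (hF : ContinuousOn F (Tb X)) (hG : ContinuousOn G (Tb X))
    (h : ∀ z ∈ Tb X, x1 ≤ z.re → z.re ≤ x2 → F z ≤ G z) :
    ∫ z in Icc x1 x2 ×ℂ Icc 0 Real.pi, F z ≤ ∫ z in Icc x1 x2 ×ℂ Icc 0 Real.pi, G z := by
  refine setIntegral_mono_on ((hF.mono (box_sub h2)).integrableOn_compact (isCompact_box _ _))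
    ((hG.mono (box_sub h2)).integrableOn_compact (isCompact_box _ _)) (isCompact_box _ _).measurableSet ?_
  intro z hz
  have := hz
  rw [mem_reProdIm] at this
  exact h z (box_sub h2 hz) this.1.1 this.1.2

section
variable {u : ℂ → ℝ} {D q : ℂ → ℂ} {X c0 : ℝ}

theorem Strip.expu (hs : Strip u D q X c0) {ζ : ℂ} (h : ζ ∈ Tb X) : Real.exp (u ζ / 2) ≤ 1 := by
  have := hs.neg ζ h
  exact Real.exp_le_one_iff.2 (by linarith)

theorem Strip.expu1 (hs : Strip u D q X c0) {ζ : ℂ} (h : ζ ∈ Tb X) : Real.exp (u ζ) ≤ 1 := by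
  have := hs.neg ζ h
  exact Real.exp_le_one_iff.2 (by linarith)

theorem Strip.bd1 (hs : Strip u D q X c0) {ζ : ℂ} (h : ζ ∈ Tb X) (h' : ζ.im = 0 ∨ ζ.im = Real.pi) :
    |(D ζ).im| ≤ c0 :=
  (hs.bd ζ h h').trans (mul_le_of_le_one_right hs.c0n (hs.expu h))

theorem reD_deriv {D : ℂ → ℂ} {L : ℂ →L[ℝ] ℂ} {z : ℂ} (h : HasFDerivAt D L z) :
    HasFDerivAt (fun w => (D w).re) (reCLM.comp L) z := (reCLM.hasFDerivAt (x := D z)).comp z h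

theorem imD_deriv {D : ℂ → ℂ} {L : ℂ →L[ℝ] ℂ} {z : ℂ} (h : HasFDerivAt D L z) :
    HasFDerivAt (fun w => (D w).im) (imCLM.comp L) z := (imCLM.hasFDerivAt (x := D z)).comp z h

theorem abs_int_le {f : ℝ → ℝ} {x1 x2 C : ℝ} (h : x1 ≤ x2) (hf : ∀ x, x1 ≤ x → x ≤ x2 → |f x| ≤ C) :
    |∫ x in x1..x2, f x| ≤ C * (x2 - x1) := by
  have := intervalIntegral.norm_integral_le_of_norm_le_const (a := x1) (b := x2) (f := f) (C := C) (by
    intro x hx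
    rw [uIoc_of_le h] at hx
    exact hf x hx.1.le hx.2)
  rwa [Real.norm_eq_abs, abs_of_nonneg (by linarith : 0 ≤ x2 - x1)] at this

theorem Strip.d_bound (hs : Strip u D q X c0) {x1 x2 : ℝ} (h12 : x1 ≤ x2) (h2 : x2 < X) :
    |(∫ y in (0:ℝ)..Real.pi, 2 * (D (x2 + y * I)).re) - ∫ y in (0:ℝ)..Real.pi, 2 * (D (x1 + y * I)).re| ≤
      (2 * Real.pi + 4 * c0) * (x2 - x1) := by
  have hpi := Real.pi_pos
  have key := strip_div h12 h2 (A := fun z => -2 * (D z).im) (B := fun z => 2 * (D z).re)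
    (G := fun z => -2 * Real.exp (u z))
    (continuousOn_const.mul (continuous_im.comp_continuousOn hs.cD))
    (continuousOn_const.mul (continuous_re.comp_continuousOn hs.cD))
    (continuousOn_const.mul (Real.continuous_exp.comp_continuousOn hs.cu)) (by
      intro z hz
      have t := hs.trip z hz
      refine ⟨_, _, (imD_deriv t.dV).const_mul _, (reD_deriv t.dV).const_mul _, ?_⟩
      simp [cF_apply, Complex.exp_ofReal_re]
      ring)
  have b1 := abs_int_le (f := fun x : ℝ => -2 * (D (x + Real.pi * I)).im) (C := 2 * c0) h12 (by
    intro x _ hx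
    have := hs.bd1 (mem_Tb (hx.trans_lt h2) hpi.le le_rfl) (Or.inr (by simp))
    rw [abs_mul]; norm_num; exact this)
  have b2 := abs_int_le (f := fun x : ℝ => -2 * (D (x + (0:ℝ) * I)).im) (C := 2 * c0) h12 (by
    intro x _ hx
    have := hs.bd1 (mem_Tb (hx.trans_lt h2) le_rfl hpi.le) (Or.inl (by simp))
    rw [abs_mul]; norm_num; simpa using this)
  have b3 : ∫ z in Icc x1 x2 ×ℂ Icc 0 Real.pi, -2 * Real.exp (u z) ≤ (x2 - x1) * Real.pi * 0 := by
    rw [← vol_box h12]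
    refine box_mono h2 (continuousOn_const.mul (Real.continuous_exp.comp_continuousOn hs.cu))
      continuousOn_const ?_
    intro z _ _ _
    linarith [Real.exp_pos (u z)]
  have b4 : (x2 - x1) * Real.pi * (-2) ≤ ∫ z in Icc x1 x2 ×ℂ Icc 0 Real.pi, -2 * Real.exp (u z) := by
    rw [← vol_box h12]
    refine box_mono h2 continuousOn_const
      (continuousOn_const.mul (Real.continuous_exp.comp_continuousOn hs.cu)) ?_
    intro z hz _ _
    linarith [hs.expu1 hz]
  rw [abs_le] at b1 b2 ⊢
  constructor <;> linarith [b1.1, b1.2, b2.1, b2.2]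

theorem Strip.W_diff (hs : Strip u D q X c0) {x1 x2 : ℝ} (h12 : x1 ≤ x2) (h2 : x2 < X) :
    (∫ y in (0:ℝ)..Real.pi, u (x2 + y * I)) - (∫ y in (0:ℝ)..Real.pi, u (x1 + y * I)) =
      ∫ x in x1..x2, ∫ y in (0:ℝ)..Real.pi, 2 * (D (x + y * I)).re := by
  have cD2 : ContinuousOn (fun z => 2 * (D z).re) (Tb X) :=
    (continuousOn_const.mul (continuous_re.comp_continuousOn hs.cD))
  have key := strip_div h12 h2 (A := fun z => 0) (B := u)
    (G := fun z => 2 * (D z).re) continuousOn_const hs.cu cD2 (by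
      intro z hz
      have t := hs.trip z hz
      exact ⟨_, _, hasFDerivAt_const _ _, t.dv, by simp [reF_apply]⟩)
  rw [rect_fubini h12 Real.pi_pos.le (cD2.mono (box_sub h2))] at key
  rw [key]; simp

theorem Strip.box_bound (hs : Strip u D q X c0) : ∃ C, 0 ≤ C ∧ ∀ x ≤ X - 3,
    ∫ z in Icc (x - 1) (x + 1) ×ℂ Icc 0 Real.pi, -u z ≤ C * (X - x) ^ 2 := by
  have hpi := Real.pi_pos
  have hc0 := hs.c0n
  set d : ℝ → ℝ := fun x => ∫ y in (0:ℝ)..Real.pi, 2 * (D (x + y * I)).re with hd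
  set W : ℝ → ℝ := fun x => ∫ y in (0:ℝ)..Real.pi, u (x + y * I) with hW
  set C1 := |d (X - 1)| + (2 * Real.pi + 4 * c0) with hC1
  set C2 := |W (X - 1)| + C1 with hC2
  have hC1n : 0 ≤ C1 := by positivity
  have d1 : ∀ x ≤ X - 1, |d x| ≤ C1 * (X - x) := by
    intro x hx
    have h1 := hs.d_bound hx (by linarith : X - 1 < X)
    have h2 : |d x| ≤ |d (X - 1)| + |d (X - 1) - d x| := by
      have := abs_sub (d (X-1)) (d (X - 1) - d x)
      simpa using this
    have h3 : |d (X - 1)| ≤ |d (X - 1)| * (X - x) := le_mul_of_one_le_right (abs_nonneg _) (by linarith)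
    have h4 : (2 * Real.pi + 4 * c0) * (X - 1 - x) ≤ (2 * Real.pi + 4 * c0) * (X - x) := by
      gcongr; linarith
    rw [hC1, add_mul]
    linarith
  have w1 : ∀ x ≤ X - 1, -W x ≤ C2 * (X - x) ^ 2 := by
    intro x hx
    have h1 := hs.W_diff hx (by linarith : X - 1 < X)
    have h2 := abs_int_le (f := d) (C := C1 * (X - x)) hx (by
      intro y hy hy2
      refine (d1 y hy2).trans ?_
      gcongr)
    have h3 : W (X - 1) - W x = ∫ y in x..(X - 1), d y := h1
    rw [← h3] at h2
    have h4 := (abs_le.1 h2).2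
    have h5 : C1 * (X - x) * (X - 1 - x) ≤ C1 * (X - x) ^ 2 := by
      rw [sq, ← mul_assoc]
      have : 0 ≤ C1 * (X - x) := mul_nonneg hC1n (by linarith)
      gcongr; linarith
    have h6 : |W (X - 1)| ≤ |W (X - 1)| * (X - x) ^ 2 :=
      le_mul_of_one_le_right (abs_nonneg _) (by nlinarith)
    have h7 := neg_abs_le (W (X - 1))
    rw [hC2, add_mul]
    linarith
  refine ⟨C2 * 8, by positivity, fun x hx => ?_⟩
  have hlt : x + 1 < X := by linarith
  rw [rect_fubini (G := fun z => -u z) (by linarith) hpi.le (hs.cu.neg.mono (box_sub hlt))]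
  have e : ∀ y : ℝ, ∫ t in (0:ℝ)..Real.pi, -u (y + t * I) = -W y := fun y => by
    rw [hW]; simp
  simp_rw [e]
  have := abs_int_le (f := fun y => -W y) (x1 := x - 1) (x2 := x + 1) (C := C2 * (4 * (X - x) ^ 2)) (by linarith) (by
    intro y hy hy2
    have h0 : 0 ≤ -W y := by
      rw [hW, ← intervalIntegral.integral_neg]
      refine intervalIntegral.integral_nonneg hpi.le ?_
      intro t ht
      linarith [hs.neg _ (mem_Tb (hy2.trans_lt hlt) ht.1 ht.2)]
    rw [abs_of_nonneg h0]
    refine (w1 y (by linarith)).trans ?_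
    have : 0 ≤ C2 := by positivity
    gcongr
    nlinarith)
  have h2 := le_abs_self (∫ y in (x-1)..(x+1), -W y)
  linarith
end

end Part12

section Part13
open scoped Topology Interval

theorem LapAt.translate {f : ℂ → ℝ} {z c : ℂ} {L : ℝ} (hf : LapAt f (z + c) L) :
    LapAt (fun w => f (w + c)) z L := by
  obtain ⟨fs, ft, a, b, h1, h2, h3, h4, h5⟩ := hf
  have ht : Tendsto (fun w => w + c) (𝓝 z) (𝓝 (z + c)) := (continuous_add_const c).tendsto z
  refine ⟨fun w => fs (w + c), fun w => ft (w + c), a, b, ?_, ?_, ?_, ?_, h5⟩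
  · filter_upwards [ht.eventually h1] with w hw
    simpa [add_right_comm] using hw
  · filter_upwards [ht.eventually h2] with w hw
    simpa [add_right_comm] using hw
  · simpa [add_right_comm] using h3
  · simpa [add_right_comm] using h4

theorem sup_aux {w : ℂ → ℝ} {z0 : ℂ} {c0 x : ℝ} (hc0 : 0 ≤ c0) (hx : z0.re = x) (h0 : 0 ≤ z0.im) (h1 : z0.im ≤ Real.pi / 2)
    (hc : ContinuousOn w (Icc (x - 1) (x + 1) ×ℂ Icc 0 Real.pi))
    (hL : ∀ z ∈ Metric.ball z0 1, 0 < z.im → ∃ L > 0, LapAt w z L)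
    (hN : ∀ z ∈ Metric.ball z0 1, z.im = 0 →
      ∃ d ≥ -(2 * c0), HasDerivWithinAt (fun τ : ℝ => w (z + τ * I)) d (Ici 0) 0)
    (hpos : ∀ z ∈ Icc (x - 1) (x + 1) ×ℂ Icc 0 Real.pi, 0 ≤ w z) :
    w z0 ≤ (∫ z in Icc (x - 1) (x + 1) ×ℂ Icc 0 Real.pi, w z) + 16 * (2 * c0 + 1) := by
  have hpi := Real.pi_gt_three
  have hpi4 := Real.pi_lt_four
  have hsub : Metric.closedBall z0 1 ∩ Hb ⊆ Icc (x - 1) (x + 1) ×ℂ Icc 0 Real.pi := by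
    rintro z ⟨hz, hz0⟩
    rw [mem_closedBall_iff_norm] at hz
    have r1 := (abs_re_le_norm (z - z0)).trans hz
    have r2 := (abs_im_le_norm (z - z0)).trans hz
    rw [sub_re, hx, abs_le] at r1
    rw [sub_im, abs_le] at r2
    rw [mem_reProdIm]
    exact ⟨⟨by linarith, by linarith⟩, ⟨hz0, by linarith⟩⟩
  set k := 2 * c0 + 1 with hk
  set f : ℂ → ℝ := fun z => w z + k * z.im with hf
  have hcf : ContinuousOn f (Metric.closedBall z0 1 ∩ Hb) := (hc.mono hsub).add (by fun_prop)
  have hmean := subMean_ball f z0 h0 one_pos hcf ?_ ?_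
  · have hfp : ∀ z ∈ Icc (x - 1) (x + 1) ×ℂ Icc 0 Real.pi, 0 ≤ f z := by
      intro z hz
      have h2 := hpos z hz
      rw [mem_reProdIm] at hz
      have := hz.2.1
      simp only [hf]
      positivity
    have hfold := fold_integral_le h0 hcf (fun z hz => hfp z (hsub hz))
    have hcfb : ContinuousOn f (Icc (x - 1) (x + 1) ×ℂ Icc 0 Real.pi) := hc.add (by fun_prop)
    have hcomp := isCompact_box (x - 1) (x + 1)
    have hle : ∫ z in Metric.ball z0 1 ∩ {z : ℂ | 0 < z.im}, f z ≤
        ∫ z in Icc (x - 1) (x + 1) ×ℂ Icc 0 Real.pi, f z := by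
      refine setIntegral_mono_set (hcfb.integrableOn_compact hcomp) ?_ (Eventually.of_forall ?_)
      · exact (ae_restrict_iff' hcomp.measurableSet).2 (Eventually.of_forall hfp)
      · intro z hz
        exact hsub ⟨Metric.ball_subset_closedBall hz.1, (show (0:ℝ) < z.im from hz.2).le⟩
    have hle2 : ∫ z in Icc (x - 1) (x + 1) ×ℂ Icc 0 Real.pi, f z ≤
        ∫ z in Icc (x - 1) (x + 1) ×ℂ Icc 0 Real.pi, (w z + k * Real.pi) := by
      refine setIntegral_mono_on (hcfb.integrableOn_compact hcomp)
        ((hc.add continuousOn_const).integrableOn_compact hcomp) hcomp.measurableSet ?_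
      intro z hz
      rw [mem_reProdIm] at hz
      have : k * z.im ≤ k * Real.pi := by
        have := hz.2.2
        gcongr
      simp only [hf]
      linarith
    have hci : IntegrableOn (fun _ : ℂ => k * Real.pi) (Icc (x - 1) (x + 1) ×ℂ Icc 0 Real.pi) :=
      continuousOn_const.integrableOn_compact hcomp
    rw [integral_add (hc.integrableOn_compact hcomp) hci, vol_box (by linarith)] at hle2
    set J := ∫ z in Icc (x - 1) (x + 1) ×ℂ Icc 0 Real.pi, w z
    have hJ : 0 ≤ J := setIntegral_nonneg hcomp.measurableSet hpos
    have hfz : w z0 ≤ f z0 := by simp only [hf]; nlinarith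
    have h5 : f z0 * Real.pi ≤ 2 * (J + 2 * Real.pi * (k * Real.pi)) := by
      have : x + 1 - (x - 1) = 2 := by ring
      rw [this] at hle2
      linarith
    have h6 : (f z0 - 4 * k * Real.pi) * Real.pi ≤ 2 * J := by nlinarith
    have h7 : f z0 - 4 * k * Real.pi ≤ J := by
      by_contra hcon
      push Not at hcon
      nlinarith
    have h8 : 4 * k * Real.pi ≤ 16 * k := by nlinarith
    linarith
  · intro z hz hz0
    obtain ⟨L, hL0, hL⟩ := hL z hz hz0
    exact ⟨L + k * 0, by simpa using hL0, hL.add ((LapAt.im z).const_mul k)⟩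
  · intro z hz hz0
    obtain ⟨d, hd0, hd⟩ := hN z hz hz0
    have h2 : HasDerivWithinAt (fun τ : ℝ => k * (z + τ * I).im) k (Ici 0) 0 := by
      have := (((hasDerivAt_id (0:ℝ)).const_add (z.im)).const_mul k)
      simpa using this.hasDerivWithinAt
    exact ⟨d + k, by rw [hk]; linarith, hd.add h2⟩

theorem Strip.sup_bound {u : ℂ → ℝ} {D q : ℂ → ℂ} {X c0 : ℝ} (hs : Strip u D q X c0) :
    ∃ C, 0 ≤ C ∧ ∀ ζ ∈ Tb X, ζ.re ≤ X - 3 → -u ζ ≤ C * (X - ζ.re) ^ 2 := by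
  obtain ⟨C, hC, hbox⟩ := hs.box_bound
  have hpi := Real.pi_gt_three
  have hc0 := hs.c0n
  refine ⟨C + 16 * (2 * c0 + 1), by positivity, fun ζ hζ hx => ?_⟩
  have hlt : ζ.re + 1 < X := by linarith
  have hone : 1 ≤ (X - ζ.re) ^ 2 := by nlinarith
  have fin : -u ζ ≤ (∫ z in Icc (ζ.re - 1) (ζ.re + 1) ×ℂ Icc 0 Real.pi, -u z) + 16 * (2 * c0 + 1) →
      -u ζ ≤ (C + 16 * (2 * c0 + 1)) * (X - ζ.re) ^ 2 := by
    intro h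
    have := hbox _ hx
    have h2 : 16 * (2 * c0 + 1) ≤ 16 * (2 * c0 + 1) * (X - ζ.re) ^ 2 :=
      le_mul_of_one_le_right (by positivity) hone
    rw [add_mul]; linarith
  have hre : ∀ {z z0 : ℂ}, z ∈ Metric.ball z0 1 → z.re < z0.re + 1 ∧ z.im < z0.im + 1 := by
    intro z z0 hz
    rw [mem_ball_iff_norm] at hz
    have r1 := (abs_re_le_norm (z - z0)).trans_lt hz
    have r2 := (abs_im_le_norm (z - z0)).trans_lt hz
    rw [sub_re, abs_lt] at r1
    rw [sub_im, abs_lt] at r2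
    exact ⟨by linarith, by linarith⟩
  rcases le_total ζ.im (Real.pi / 2) with hi | hi
  · apply fin
    refine sup_aux hc0 rfl hζ.2.1 hi (hs.cu.neg.mono (box_sub hlt)) ?_ ?_ ?_
    · intro z hz hz0
      have := hre hz
      have ht := LapAt.of_trip (isOpen_To X) hs.trip (z := z) ⟨by linarith, hz0, by linarith⟩
      exact ⟨_, by linarith [Real.exp_pos (u z)], ht.neg⟩
    · intro z hz hz0
      have hzr := hre hz
      have hzb : z ∈ Tb X := ⟨by linarith, hz0.ge, by linarith⟩
      have hm : ∀ τ ∈ Ioo (0:ℝ) 1, z + τ * I ∈ To X := fun τ hτ => by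
        refine ⟨?_, ?_, ?_⟩ <;> simp [hz0] <;> linarith [hτ.1, hτ.2]
      have hmaps : MapsTo (fun τ : ℝ => z + τ * I) (Ioo 0 1) (Tb X) := fun τ hτ => To_sub X (hm τ hτ)
      have hcc : ContinuousWithinAt (fun τ : ℝ => z + τ * I) (Ioo 0 1) 0 := by fun_prop
      have hh0 : z + ((0:ℝ):ℂ) * I = z := by simp
      have hn := normal_deriv (v := u) (V := D) (z := z) one_pos I (fun τ hτ => (hs.trip _ (hm τ hτ)).dv)
        (ContinuousWithinAt.comp (by simpa [hh0] using hs.cu z hzb) hcc hmaps)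
        (ContinuousWithinAt.comp (by simpa [hh0] using hs.cD z hzb) hcc hmaps)
      refine ⟨_, ?_, hn.neg⟩
      have := (abs_le.1 (hs.bd1 hzb (Or.inl hz0))).1
      simp
      linarith
    · intro z hz
      have := hs.neg z (box_sub hlt hz)
      simp only [Pi.neg_apply]
      linarith
  · apply fin
    set r : ℂ → ℂ := fun z => (starRingEnd ℂ) z + Real.pi * I with hr
    have rre : ∀ z, (r z).re = z.re := fun z => by simp [hr]
    have rim : ∀ z, (r z).im = Real.pi - z.im := fun z => by simp [hr]; ring
    have hrc : Continuous r := by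
      rw [hr]; exact continuous_conj.add continuous_const
    have rr : ∀ z, r (r z) = z := fun z => by apply Complex.ext <;> simp [rre, rim]
    have hrbox : ∀ x, ∀ z ∈ Icc (x - 1) (x + 1) ×ℂ Icc 0 Real.pi, r z ∈ Icc (x - 1) (x + 1) ×ℂ Icc 0 Real.pi := by
      intro x z hz
      rw [mem_reProdIm] at hz ⊢
      rw [rre, rim]
      exact ⟨hz.1, ⟨by linarith [hz.2.2], by linarith [hz.2.1]⟩⟩
    have hcw : ContinuousOn (fun z => -u (r z)) (Icc (ζ.re - 1) (ζ.re + 1) ×ℂ Icc 0 Real.pi) :=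
      (hs.cu.neg.mono (box_sub hlt)).comp hrc.continuousOn (hrbox _)
    have key := sup_aux (w := fun z => -u (r z)) (z0 := r ζ) (x := ζ.re) hc0 (rre ζ) (by rw [rim]; linarith [hζ.2.2])
      (by rw [rim]; linarith) hcw ?_ ?_ ?_
    · rw [rect_fubini (by linarith) (by linarith) hcw] at key
      rw [rect_fubini (G := fun z => -u z) (by linarith) (by linarith) (hs.cu.neg.mono (box_sub hlt))]
      simp only [rr] at key
      convert key using 3
      funext x
      have e := intervalIntegral.integral_comp_sub_left (fun y : ℝ => -u (x + y * I)) Real.pi (a := 0) (b := Real.pi)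
      simp only [sub_self, sub_zero] at e
      rw [← e]
      refine intervalIntegral.integral_congr fun y _ => ?_
      congr 2
      apply Complex.ext <;> simp [rre, rim]
    · intro z hz hz0
      have := hre hz
      rw [rre, rim] at this
      have hzo : r z ∈ To X := ⟨by rw [rre]; linarith, by rw [rim]; linarith, by rw [rim]; linarith⟩
      have ht := LapAt.of_trip (isOpen_To X) hs.trip hzo
      exact ⟨_, by linarith [Real.exp_pos (u (r z))], (LapAt.conj (LapAt.translate ht)).neg⟩
    · intro z hz hz0
      have hzr := hre hz
      rw [rre, rim] at hzr
      have hzb : r z ∈ Tb X := ⟨by rw [rre]; linarith, by rw [rim]; linarith, by rw [rim]; linarith⟩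
      have hm : ∀ τ ∈ Ioo (0:ℝ) 1, r z + τ * (-I) ∈ To X := fun τ hτ => by
        refine ⟨?_, ?_, ?_⟩ <;> simp [rre, rim, hz0] <;> linarith [hτ.1, hτ.2]
      have hmaps : MapsTo (fun τ : ℝ => r z + τ * (-I)) (Ioo 0 1) (Tb X) := fun τ hτ => To_sub X (hm τ hτ)
      have hcc : ContinuousWithinAt (fun τ : ℝ => r z + τ * (-I)) (Ioo 0 1) 0 := by fun_prop
      have hh0 : r z + ((0:ℝ):ℂ) * (-I) = r z := by simp
      have hn := normal_deriv (v := u) (V := D) (z := r z) one_pos (-I) (fun τ hτ => (hs.trip _ (hm τ hτ)).dv)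
        (ContinuousWithinAt.comp (by simpa [hh0] using hs.cu (r z) hzb) hcc hmaps)
        (ContinuousWithinAt.comp (by simpa [hh0] using hs.cD (r z) hzb) hcc hmaps)
      refine ⟨-(2 * (D (r z) * -I).re), ?_, ?_⟩
      rotate_left
      · have e : (fun τ : ℝ => -u (r (z + τ * I))) = -fun τ : ℝ => u (r z + τ * -I) := by
          funext τ
          have e2 : r (z + τ * I) = r z + τ * -I := by
            apply Complex.ext <;> simp [rre, rim]
            ring
          rw [e2]; rfl
        rw [e]
        exact hn.neg
      · have := (abs_le.1 (hs.bd1 hzb (Or.inr (by rw [rim, hz0]; ring)))).2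
        simp
        linarith
    · intro z hz
      linarith [hs.neg _ (box_sub hlt (hrbox _ z hz))]

end Part13

section Part14
open scoped Topology Interval

/-- cut off -/
noncomputable def cut (x : ℝ) (z : ℂ) : ℝ := 1 - (z.re - x) ^ 2

theorem cut_deriv (x : ℝ) (z : ℂ) : HasFDerivAt (cut x) ((-2 * (z.re - x)) • reCLM) z := by
  have h : HasFDerivAt (fun w : ℂ => w.re - x) reCLM z := reCLM.hasFDerivAt.sub_const x
  have h2 := (h.mul h).const_sub 1
  refine (h2.congr_of_eventuallyEq (Eventually.of_forall fun w => ?_)).congr_fderiv ?_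
  · simp [cut]; ring
  · ext
    simp; ring

theorem cut_cont (x : ℝ) : Continuous (cut x) := by unfold cut; fun_prop

/-- squared cut off -/
noncomputable def cut2 (x : ℝ) (z : ℂ) : ℝ := cut x z ^ 2

theorem cut2_deriv (x : ℝ) (z : ℂ) :
    HasFDerivAt (cut2 x) ((2 * cut x z * (-2 * (z.re - x))) • reCLM) z := by
  have h2 := (cut_deriv x z).mul (cut_deriv x z)
  refine (h2.congr_of_eventuallyEq (Eventually.of_forall fun w => ?_)).congr_fderiv ?_
  · simp [cut2]; ring
  · ext
    simp; ring

theorem cut2_cont (x : ℝ) : Continuous (cut2 x) := (cut_cont x).pow 2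

theorem cut_mem {x : ℝ} {z : ℂ} (h1 : x - 1 ≤ z.re) (h2 : z.re ≤ x + 1) : 0 ≤ cut x z ∧ cut x z ≤ 1 := by
  unfold cut
  constructor <;> nlinarith

theorem cut2_mem {x : ℝ} {z : ℂ} (h1 : x - 1 ≤ z.re) (h2 : z.re ≤ x + 1) : 0 ≤ cut2 x z ∧ cut2 x z ≤ 1 := by
  have := cut_mem h1 h2
  unfold cut2
  constructor
  · positivity
  · nlinarith

theorem box_le {X x1 x2 C : ℝ} (h1 : x1 ≤ x2) (h2 : x2 < X) {F : ℂ → ℝ}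
    (hF : ContinuousOn F (Tb X))
    (h : ∀ z ∈ Tb X, x1 ≤ z.re → z.re ≤ x2 → F z ≤ C) :
    ∫ z in Icc x1 x2 ×ℂ Icc 0 Real.pi, F z ≤ (x2 - x1) * Real.pi * C := by
  rw [← vol_box h1]
  exact box_mono h2 hF continuousOn_const h

theorem box_int {X x1 x2 : ℝ} (h2 : x2 < X) {F : ℂ → ℝ} (hF : ContinuousOn F (Tb X)) :
    IntegrableOn F (Icc x1 x2 ×ℂ Icc 0 Real.pi) :=
  (hF.mono (box_sub h2)).integrableOn_compact (isCompact_box _ _)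

theorem box_abs_le {X x1 x2 : ℝ} (h2 : x2 < X) {F G : ℂ → ℝ}
    (hF : ContinuousOn F (Tb X)) (hG : ContinuousOn G (Tb X))
    (h : ∀ z ∈ Tb X, x1 ≤ z.re → z.re ≤ x2 → |F z| ≤ G z) :
    |∫ z in Icc x1 x2 ×ℂ Icc 0 Real.pi, F z| ≤ ∫ z in Icc x1 x2 ×ℂ Icc 0 Real.pi, G z := by
  have h1 := box_mono h2 hF hG fun z a b c => (abs_le.1 (h z a b c)).2
  have h3 := box_mono h2 (F := fun z => -F z) hF.neg hG fun z a b c => by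
    linarith [(abs_le.1 (h z a b c)).1]
  rw [integral_neg] at h3
  exact abs_le.2 ⟨by linarith, h1⟩

theorem cF_of_deriv {g : ℂ → ℂ} {d z : ℂ} (h : HasDerivAt g d z) : HasFDerivAt g (cF d 0) z := by
  refine h.complexToReal_fderiv.congr_fderiv ?_
  apply ContinuousLinearMap.ext
  intro w
  simp [cF_apply]

theorem int_quartic (x : ℝ) : ∫ s in (x - 1)..(x + 1), (1 - (s - x) ^ 2) ^ 2 = 16 / 15 := by
  have h := intervalIntegral.integral_comp_sub_right (fun s : ℝ => (1 - s ^ 2) ^ 2) x (a := x - 1) (b := x + 1)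
  rw [h]
  have : (fun s : ℝ => (1 - s ^ 2) ^ 2) = fun s => 1 - 2 * s ^ 2 + s ^ 4 := by funext s; ring
  simp only [this]
  have e1 : x - 1 - x = -1 := by ring
  have e2 : x + 1 - x = 1 := by ring
  rw [e1, e2, intervalIntegral.integral_add, intervalIntegral.integral_sub] <;>
    first | (simp; norm_num) | (apply Continuous.intervalIntegrable; fun_prop)

section
variable {u : ℂ → ℝ} {D q : ℂ → ℂ} {X c0 : ℝ}

theorem Strip.caccio (hs : Strip u D q X c0) : ∃ C, 0 ≤ C ∧ ∀ x ≤ X - 5,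
    ∫ z in Icc (x - 1) (x + 1) ×ℂ Icc 0 Real.pi, cut2 x z * ‖D z‖ ^ 2 ≤ C * (X - x) ^ 4 := by
  obtain ⟨C, hC, hsup⟩ := hs.sup_bound
  have hpi := Real.pi_pos
  have hc0 := hs.c0n
  refine ⟨16 * c0 + 2 * Real.pi * (8 * (C * 4) ^ 2), by positivity, fun x hx => ?_⟩
  have h2 : x + 1 < X := by linarith
  have h12 : x - 1 ≤ x + 1 := by linarith
  have cre : ContinuousOn (fun z => (D z).re) (Tb X) := continuous_re.comp_continuousOn hs.cD
  have cim : ContinuousOn (fun z => (D z).im) (Tb X) := continuous_im.comp_continuousOn hs.cD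
  have cu := hs.cu
  have cc := (cut_cont x).continuousOn (s := Tb X)
  have cc2 := (cut2_cont x).continuousOn (s := Tb X)
  have crr : ContinuousOn (fun z : ℂ => z.re) (Tb X) := continuous_re.continuousOn
  have ceu : ContinuousOn (fun z => Real.exp (u z)) (Tb X) := Real.continuous_exp.comp_continuousOn cu
  have cn : ContinuousOn (fun z => ‖D z‖) (Tb X) := hs.cD.norm
  have cG : ContinuousOn (fun z => 4 * cut2 x z * ‖D z‖ ^ 2 - 2 * cut2 x z * u z * Real.exp (u z)
      - 8 * cut x z * (z.re - x) * u z * (D z).re) (Tb X) := by fun_prop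
  have key := strip_div h12 h2 (A := fun z => cut2 x z * (u z * (-2 * (D z).im)))
    (B := fun z => cut2 x z * (u z * (2 * (D z).re)))
    (G := fun z => 4 * cut2 x z * ‖D z‖ ^ 2 - 2 * cut2 x z * u z * Real.exp (u z)
      - 8 * cut x z * (z.re - x) * u z * (D z).re)
    (by fun_prop) (by fun_prop) cG (by
      intro z hz
      have t := hs.trip z hz
      refine ⟨_, _, (cut2_deriv x z).mul (t.dv.mul ((imD_deriv t.dV).const_mul _)),
        (cut2_deriv x z).mul (t.dv.mul ((reD_deriv t.dV).const_mul _)), ?_⟩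
      rw [← normSq_eq_norm_sq, normSq_apply]
      simp [cF_apply, reF_apply, Complex.exp_ofReal_re, cut2]
      ring)
  have hB : ∀ x' : ℝ, (x' - x) ^ 2 = 1 → ∫ y in (0:ℝ)..Real.pi, cut2 x (x' + y * I) *
      (u (x' + y * I) * (2 * (D (x' + y * I)).re)) = 0 := by
    intro x' hx'
    simp [cut2, cut, hx']
  have hAb : ∀ z ∈ Tb X, z.im = 0 ∨ z.im = Real.pi → x - 1 ≤ z.re → z.re ≤ x + 1 →
      |cut2 x z * (u z * (-2 * (D z).im))| ≤ 4 * c0 := by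
    intro z hz hz' hz1 hz2
    have b := hs.bd z hz hz'
    have n := hs.neg z hz
    obtain ⟨k1, k2⟩ := cut2_mem hz1 hz2
    have e1 := Real.add_one_le_exp (-(u z / 2))
    have e2 : |u z| * Real.exp (u z / 2) ≤ 2 := by
      have : Real.exp (-(u z / 2)) * Real.exp (u z / 2) = 1 := by rw [← Real.exp_add]; simp
      rw [abs_of_nonpos n]
      nlinarith [Real.exp_pos (u z / 2)]
    rw [abs_mul, abs_mul, abs_mul, abs_of_nonneg k1]
    calc cut2 x z * (|u z| * (|(-2:ℝ)| * |(D z).im|)) ≤ 1 * (|u z| * (2 * (c0 * Real.exp (u z / 2)))) := by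
          have : |(-2:ℝ)| = 2 := by norm_num
          rw [this]
          gcongr
      _ = 2 * c0 * (|u z| * Real.exp (u z / 2)) := by ring
      _ ≤ 2 * c0 * 2 := by gcongr
      _ = 4 * c0 := by ring
  have b1 := abs_int_le (f := fun x' : ℝ => cut2 x (x' + Real.pi * I) * (u (x' + Real.pi * I) * (-2 * (D (x' + Real.pi * I)).im)))
    (C := 4 * c0) h12 (fun x' h1' h2' => hAb _ (mem_Tb (h2'.trans_lt h2) hpi.le le_rfl) (Or.inr (by simp)) (by simpa using h1') (by simpa using h2'))
  have b2 := abs_int_le (f := fun x' : ℝ => cut2 x (x' + (0:ℝ) * I) * (u (x' + (0:ℝ) * I) * (-2 * (D (x' + (0:ℝ) * I)).im)))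
    (C := 4 * c0) h12 (fun x' h1' h2' => hAb _ (mem_Tb (h2'.trans_lt h2) le_rfl hpi.le) (Or.inl (by simp)) (by simpa using h1') (by simpa using h2'))
  rw [hB (x+1) (by ring), hB (x-1) (by ring)] at key
  have hmono := box_mono (x1 := x - 1) h2 (F := fun z => 2 * (cut2 x z * ‖D z‖ ^ 2) - 8 * u z ^ 2) (by fun_prop) cG (by
    intro z hz hz1 hz2
    obtain ⟨k1, k2⟩ := cut2_mem hz1 hz2
    have n := hs.neg z hz
    have e := Real.exp_pos (u z)
    have p1 : 0 ≤ -(cut2 x z * u z * Real.exp (u z)) := by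
      have : 0 ≤ cut2 x z * (-u z) * Real.exp (u z) := by
        have : 0 ≤ -u z := by linarith
        positivity
      linarith
    have p2 : (z.re - x) ^ 2 ≤ 1 := by nlinarith
    have p3 : 8 * cut x z * (z.re - x) * u z * (D z).re ≤ 2 * (cut x z * (D z).re) ^ 2 + 8 * ((z.re - x) * u z) ^ 2 := by
      nlinarith [sq_nonneg (cut x z * (D z).re - 2 * ((z.re - x) * u z))]
    have p4 : ((z.re - x) * u z) ^ 2 ≤ u z ^ 2 := by
      rw [mul_pow]; nlinarith [sq_nonneg (u z)]
    have p5 : (cut x z * (D z).re) ^ 2 ≤ cut2 x z * ‖D z‖ ^ 2 := by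
      rw [← normSq_eq_norm_sq, normSq_apply, cut2]
      nlinarith [sq_nonneg (cut x z * (D z).im)]
    linarith)
  have hu2 := box_le h12 h2 (F := fun z => 8 * u z ^ 2) (C := 8 * (C * 4) ^ 2 * (X - x) ^ 4) (by fun_prop) (by
    intro z hz hz1 hz2
    have := hsup z hz (by linarith)
    have n := hs.neg z hz
    have h3 : C * (X - z.re) ^ 2 ≤ C * (4 * (X - x) ^ 2) := by
      gcongr
      nlinarith
    have h4 : -u z ≤ C * 4 * (X - x) ^ 2 := by linarith
    have h5 : (-u z) ^ 2 ≤ (C * 4 * (X - x) ^ 2) ^ 2 := pow_le_pow_left₀ (by linarith) h4 2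
    calc 8 * u z ^ 2 = 8 * (-u z) ^ 2 := by ring
      _ ≤ 8 * (C * 4 * (X - x) ^ 2) ^ 2 := by gcongr
      _ = _ := by ring)
  have i1 : IntegrableOn (fun z => 2 * (cut2 x z * ‖D z‖ ^ 2)) (Icc (x - 1) (x + 1) ×ℂ Icc 0 Real.pi) :=
    box_int h2 (by fun_prop)
  have i2 : IntegrableOn (fun z => 8 * u z ^ 2) (Icc (x - 1) (x + 1) ×ℂ Icc 0 Real.pi) :=
    box_int h2 (by fun_prop)
  rw [integral_sub i1 i2, integral_const_mul] at hmono
  rw [abs_le] at b1 b2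
  have h16 : 16 * c0 ≤ 16 * c0 * (X - x) ^ 4 :=
    le_mul_of_one_le_right (by positivity) (one_le_pow₀ (by linarith))
  have e2 : x + 1 - (x - 1) = 2 := by ring
  rw [e2] at hu2 b1 b2
  have n1 : 0 ≤ 2 * Real.pi * (8 * (C * 4) ^ 2 * (X - x) ^ 4) := by
    have : 0 ≤ X - x := by linarith
    positivity
  rw [add_mul]
  linarith

/-- Test functions. -/
structure TestG (g g' : ℂ → ℂ) (X C : ℝ) : Prop where
  d : ∀ ζ ∈ Tb X, HasDerivAt g (g' ζ) ζ
  c : ContinuousOn g' (Tb X)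
  r : ∀ ζ ∈ Tb X, ζ.im = 0 ∨ ζ.im = Real.pi → (g ζ).im = 0
  b : ∀ ζ ∈ Tb X, ‖g ζ‖ ≤ C * Real.exp ζ.re
  b' : ∀ ζ ∈ Tb X, ‖g' ζ‖ ≤ C * Real.exp ζ.re

theorem TestG.cg {g g' : ℂ → ℂ} {C : ℝ} (h : TestG g g' X C) : ContinuousOn g (Tb X) :=
  fun z hz => (h.d z hz).continuousAt.continuousWithinAt

theorem Strip.moment_const (hs : Strip u D q X c0) {g g' : ℂ → ℂ} {C : ℝ} (hg : TestG g g' X C)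
    {x1 x2 : ℝ} (h12 : x1 ≤ x2) (h2 : x2 < X) :
    ∫ y in (0:ℝ)..Real.pi, (g (x2 + y * I) * q (x2 + y * I)).re =
      ∫ y in (0:ℝ)..Real.pi, (g (x1 + y * I) * q (x1 + y * I)).re := by
  have hpi := Real.pi_pos
  have cg := hg.cg
  have cq := hs.cq
  have cgq : ContinuousOn (fun z => g z * q z) (Tb X) := cg.mul cq
  have hq := holo_of_trip (isOpen_To X) hs.trip (hs.cq.mono (To_sub X))
  have key := strip_div h12 h2 (A := fun z => -1 * (g z * q z).im) (B := fun z => (g z * q z).re)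
    (G := fun z => 0)
    (continuousOn_const.mul (continuous_im.comp_continuousOn cgq))
    (continuous_re.comp_continuousOn cgq) continuousOn_const (by
      intro z hz
      have t := cF_of_deriv ((hg.d z (To_sub X hz)).mul (hq.differentiableAt ((isOpen_To X).mem_nhds hz)).hasDerivAt)
      refine ⟨_, _, (imD_deriv t).const_mul _, reD_deriv t, ?_⟩
      simp [cF_apply]
      ring)
  have hz : ∀ z ∈ Tb X, z.im = 0 ∨ z.im = Real.pi → -1 * (g z * q z).im = 0 := by
    intro z hz hz'
    rw [mul_im, hg.r z hz hz', hs.rq z hz hz']; simp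
  have a1 : ∫ x in x1..x2, -1 * (g (x + Real.pi * I) * q (x + Real.pi * I)).im = ∫ x in x1..x2, (0:ℝ) := by
    refine intervalIntegral.integral_congr fun x hx => ?_
    rw [uIcc_of_le h12] at hx
    exact hz _ (mem_Tb (hx.2.trans_lt h2) hpi.le le_rfl) (Or.inr (by simp))
  have a2 : ∫ x in x1..x2, -1 * (g (x + (0:ℝ) * I) * q (x + (0:ℝ) * I)).im = ∫ x in x1..x2, (0:ℝ) := by
    refine intervalIntegral.integral_congr fun x hx => ?_
    rw [uIcc_of_le h12] at hx
    exact hz _ (mem_Tb (hx.2.trans_lt h2) le_rfl hpi.le) (Or.inl (by simp))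
  rw [a1, a2] at key
  simp only [intervalIntegral.integral_zero, integral_zero, sub_zero, zero_add] at key
  linarith

theorem Strip.moment (hs : Strip u D q X c0) {g g' : ℂ → ℂ} {C : ℝ} (hg : TestG g g' X C)
    {x0 : ℝ} (hx0 : x0 < X) :
    ∫ y in (0:ℝ)..Real.pi, (g (x0 + y * I) * q (x0 + y * I)).re = 0 := by
  obtain ⟨C1, hC1, hcac⟩ := hs.caccio
  have hpi := Real.pi_pos
  have hc0 := hs.c0n
  have hC : 0 ≤ C := by
    have := (norm_nonneg _).trans (hg.b _ (mem_Tb hx0 le_rfl hpi.le))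
    exact nonneg_of_mul_nonneg_left this (Real.exp_pos _)
  set M := ∫ y in (0:ℝ)..Real.pi, (g (x0 + y * I) * q (x0 + y * I)).re with hM
  have main : ∀ x ≤ min x0 (X - 5), x + 1 ≤ x0 → |M| * (32 / 15) ≤
      C * Real.exp (x + 1) * (4 * c0 + 6 * Real.pi + 4 * C1 * (X - x) ^ 4) := by
    intro x hx hxx
    have hx5 := hx.trans (min_le_right _ _)
    have h2 : x + 1 < X := by linarith
    have h12 : x - 1 ≤ x + 1 := by linarith
    have cg := hg.cg
    have cg' := hg.c
    have cq := hs.cq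
    have cD := hs.cD
    have cc := (cut_cont x).continuousOn (s := Tb X)
    have cc2 := (cut2_cont x).continuousOn (s := Tb X)
    have crr : ContinuousOn (fun z : ℂ => z.re) (Tb X) := continuous_re.continuousOn
    have cn : ContinuousOn (fun z => ‖D z‖) (Tb X) := hs.cD.norm
    have c1 : ContinuousOn (fun z => (g z * q z).re) (Tb X) := continuous_re.comp_continuousOn (cg.mul cq)
    have c2 : ContinuousOn (fun z => (g z * D z).re) (Tb X) := continuous_re.comp_continuousOn (cg.mul cD)
    have c2' : ContinuousOn (fun z => (g z * D z).im) (Tb X) := continuous_im.comp_continuousOn (cg.mul cD)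
    have c3 : ContinuousOn (fun z => (g' z * D z).re) (Tb X) := continuous_re.comp_continuousOn (cg'.mul cD)
    have c4 : ContinuousOn (fun z => (g z * D z ^ 2).re) (Tb X) := continuous_re.comp_continuousOn (cg.mul (cD.pow 2))
    set R : ℂ → ℝ := fun z => -4 * cut x z * (z.re - x) * (g z * D z).re + 2 * cut2 x z * (g' z * D z).re
      + cut2 x z * (g z * D z ^ 2).re with hR
    have cR : ContinuousOn R (Tb X) := by rw [hR]; fun_prop
    have key := strip_div h12 h2 (A := fun z => cut2 x z * (g z * D z).im)
      (B := fun z => cut2 x z * (g z * D z).re)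
      (G := fun z => 2 * cut2 x z * (g z * q z).re + R z)
      (by fun_prop) (by fun_prop) (by fun_prop) (by
        intro z hz
        have t := hs.trip z hz
        have tg := (cF_of_deriv (hg.d z (To_sub X hz))).mul t.dV
        refine ⟨_, _, (cut2_deriv x z).mul (imD_deriv tg), (cut2_deriv x z).mul (reD_deriv tg), ?_⟩
        simp [cF_apply, Complex.exp_ofReal_re, cut2, hR, sq (D z)]
        ring)
    have hB : ∀ x' : ℝ, (x' - x) ^ 2 = 1 → ∫ y in (0:ℝ)..Real.pi, cut2 x (x' + y * I) *
        (g (x' + y * I) * D (x' + y * I)).re = 0 := by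
      intro x' hx'
      simp [cut2, cut, hx']
    rw [hB (x+1) (by ring), hB (x-1) (by ring)] at key
    have hAb : ∀ z ∈ Tb X, z.im = 0 ∨ z.im = Real.pi → x - 1 ≤ z.re → z.re ≤ x + 1 →
        |cut2 x z * (g z * D z).im| ≤ C * Real.exp (x + 1) * c0 := by
      intro z hz hz' hz1 hz2
      have b := hs.bd1 hz hz'
      obtain ⟨k1, k2⟩ := cut2_mem hz1 hz2
      have e : (g z * D z).im = (g z).re * (D z).im := by rw [mul_im, hg.r z hz hz']; ring
      have e2 := (abs_re_le_norm (g z)).trans (hg.b z hz)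
      rw [abs_mul, e, abs_mul, abs_of_nonneg k1]
      calc cut2 x z * (|(g z).re| * |(D z).im|) ≤ 1 * ((C * Real.exp z.re) * c0) := by gcongr
        _ ≤ C * Real.exp (x + 1) * c0 := by rw [one_mul]; gcongr
    have b1 := abs_int_le (f := fun x' : ℝ => cut2 x (x' + Real.pi * I) * (g (x' + Real.pi * I) * D (x' + Real.pi * I)).im)
      (C := C * Real.exp (x + 1) * c0) h12 (fun x' h1' h2' => hAb _ (mem_Tb (h2'.trans_lt h2) hpi.le le_rfl) (Or.inr (by simp)) (by simpa using h1') (by simpa using h2'))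
    have b2 := abs_int_le (f := fun x' : ℝ => cut2 x (x' + (0:ℝ) * I) * (g (x' + (0:ℝ) * I) * D (x' + (0:ℝ) * I)).im)
      (C := C * Real.exp (x + 1) * c0) h12 (fun x' h1' h2' => hAb _ (mem_Tb (h2'.trans_lt h2) le_rfl hpi.le) (Or.inl (by simp)) (by simpa using h1') (by simpa using h2'))
    have hRb := box_abs_le (x1 := x - 1) h2 (F := R) (G := fun z => C * Real.exp (x + 1) * (3 + 4 * (cut2 x z * ‖D z‖ ^ 2)))
      cR (by fun_prop) (by
        intro z hz hz1 hz2
        obtain ⟨k1, k2⟩ := cut_mem hz1 hz2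
        have he : Real.exp z.re ≤ Real.exp (x + 1) := Real.exp_le_exp.2 hz2
        have g1 : ‖g z‖ ≤ C * Real.exp (x + 1) := (hg.b z hz).trans (by gcongr)
        have g2 : ‖g' z‖ ≤ C * Real.exp (x + 1) := (hg.b' z hz).trans (by gcongr)
        set E := C * Real.exp (x + 1)
        have hE : 0 ≤ E := (norm_nonneg _).trans g1
        set d := ‖D z‖
        have hd : 0 ≤ d := norm_nonneg _
        have r1 : |(g z * D z).re| ≤ E * d := (abs_re_le_norm _).trans (by rw [norm_mul]; gcongr)
        have r2 : |(g' z * D z).re| ≤ E * d := (abs_re_le_norm _).trans (by rw [norm_mul]; gcongr)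
        have r3 : |(g z * D z ^ 2).re| ≤ E * d ^ 2 := (abs_re_le_norm _).trans (by rw [norm_mul, norm_pow]; gcongr)
        have hzx : |z.re - x| ≤ 1 := abs_le.2 ⟨by linarith, by linarith⟩
        set k := cut x z
        have hk2 : cut2 x z = k ^ 2 := rfl
        rw [hk2]
        have a1 : |-4 * k * (z.re - x) * (g z * D z).re| ≤ 4 * k * 1 * (E * d) := by
          rw [abs_mul, abs_mul, abs_mul, abs_of_nonneg k1]
          have : |(-4:ℝ)| = 4 := by norm_num
          rw [this]; gcongr
        have a2 : |2 * k ^ 2 * (g' z * D z).re| ≤ 2 * k ^ 2 * (E * d) := by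
          rw [abs_mul, abs_of_nonneg (by positivity : 0 ≤ 2 * k ^ 2)]; gcongr
        have a3 : |k ^ 2 * (g z * D z ^ 2).re| ≤ k ^ 2 * (E * d ^ 2) := by
          rw [abs_mul, abs_of_nonneg (by positivity : 0 ≤ k ^ 2)]; gcongr
        have a4 := abs_add_three (-4 * k * (z.re - x) * (g z * D z).re) (2 * k ^ 2 * (g' z * D z).re) (k ^ 2 * (g z * D z ^ 2).re)
        have p : 4 * k * d + 2 * k ^ 2 * d + k ^ 2 * d ^ 2 ≤ 3 + 4 * (k ^ 2 * d ^ 2) := by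
          have q1 : k ^ 2 * d ≤ k * d := by nlinarith [mul_nonneg k1 hd]
          nlinarith [sq_nonneg (k * d - 1)]
        have p2 := mul_le_mul_of_nonneg_left p hE
        calc _ ≤ _ := a4
          _ ≤ E * (4 * k * d + 2 * k ^ 2 * d + k ^ 2 * d ^ 2) := by linarith
          _ ≤ _ := p2)
    have i1 : IntegrableOn (fun z => 2 * cut2 x z * (g z * q z).re) (Icc (x - 1) (x + 1) ×ℂ Icc 0 Real.pi) :=
      box_int h2 (by fun_prop)
    have i2 : IntegrableOn R (Icc (x - 1) (x + 1) ×ℂ Icc 0 Real.pi) := box_int h2 cR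
    rw [integral_add i1 i2] at key
    have hmain : ∫ z in Icc (x - 1) (x + 1) ×ℂ Icc 0 Real.pi, 2 * cut2 x z * (g z * q z).re = M * (32 / 15) := by
      have cc3 : ContinuousOn (fun z => 2 * cut2 x z * (g z * q z).re) (Tb X) := by fun_prop
      rw [rect_fubini h12 hpi.le (cc3.mono (box_sub h2))]
      have : ∀ s ∈ uIcc (x - 1) (x + 1), ∫ y in (0:ℝ)..Real.pi, 2 * cut2 x (s + y * I) * (g (s + y * I) * q (s + y * I)).re
          = 2 * M * (1 - (s - x) ^ 2) ^ 2 := by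
        intro s hsx
        rw [uIcc_of_le h12] at hsx
        have e : ∀ y : ℝ, cut2 x (s + y * I) = (1 - (s - x) ^ 2) ^ 2 := fun y => by simp [cut2, cut]
        simp_rw [e]
        rw [intervalIntegral.integral_const_mul, ← hs.moment_const hg (hsx.2.trans hxx) hx0, ← hM]
        ring
      rw [intervalIntegral.integral_congr this, intervalIntegral.integral_const_mul, int_quartic]
      ring
    rw [hmain] at key
    have i3 : IntegrableOn (fun z => 4 * (cut2 x z * ‖D z‖ ^ 2)) (Icc (x - 1) (x + 1) ×ℂ Icc 0 Real.pi) :=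
      box_int h2 (by fun_prop)
    have i4 : IntegrableOn (fun _ : ℂ => (3:ℝ)) (Icc (x - 1) (x + 1) ×ℂ Icc 0 Real.pi) :=
      box_int h2 continuousOn_const
    rw [integral_const_mul, integral_add i4 i3, integral_const_mul, vol_box h12] at hRb
    have hc := hcac x hx5
    set E := C * Real.exp (x + 1)
    have hE : 0 ≤ E := by positivity
    have e2 : x + 1 - (x - 1) = 2 := by ring
    rw [e2] at hRb b1 b2
    have p := mul_le_mul_of_nonneg_left hc (by positivity : 0 ≤ 4 * E)
    have hab : |M| * (32 / 15) = |M * (32 / 15)| := by rw [abs_mul]; norm_num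
    rw [hab]
    have : |M * (32 / 15)| ≤ E * c0 * 2 + E * c0 * 2 + E * (2 * Real.pi * 3 + 4 * ∫ z in Icc (x - 1) (x + 1) ×ℂ Icc 0 Real.pi, cut2 x z * ‖D z‖ ^ 2) := by
      rw [abs_le] at *
      constructor <;> linarith [hRb.1, hRb.2, b1.1, b1.2, b2.1, b2.2]
    refine this.trans ?_
    nlinarith
  have hlim : Tendsto (fun x : ℝ => C * Real.exp (x + 1) * (4 * c0 + 6 * Real.pi + 4 * C1 * (X - x) ^ 4)) atBot (𝓝 0) := by
    have t0 := Real.tendsto_pow_mul_exp_neg_atTop_nhds_zero 0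
    have t4 := Real.tendsto_pow_mul_exp_neg_atTop_nhds_zero 4
    have tt : Tendsto (fun x : ℝ => X - x) atBot atTop := tendsto_atTop_add_const_left _ X tendsto_neg_atBot_atTop
    have t := ((t0.const_mul (4 * c0 + 6 * Real.pi)).add (t4.const_mul (4 * C1))).const_mul (C * Real.exp (X + 1))
    have t' := t.comp tt
    simp only [mul_zero, add_zero] at t'
    refine t'.congr fun x => ?_
    have : Real.exp (x + 1) = Real.exp (X + 1) * Real.exp (-(X - x)) := by rw [← Real.exp_add]; ring_nf
    simp only [Function.comp_def, this]
    ring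
  have : |M| * (32 / 15) ≤ 0 := by
    refine ge_of_tendsto hlim ?_
    filter_upwards [eventually_le_atBot (min x0 (X - 5)), eventually_le_atBot (x0 - 1)] with x h1 h2
    exact main x h1 (by linarith)
  have h3 : |M| ≤ 0 := by linarith
  exact abs_nonpos_iff.1 h3
end

end Part14

section Part15
open scoped Topology Interval

theorem mono_lin {y y' : ℝ → ℝ} {x0 κ : ℝ} (hd : ∀ x ≤ x0, HasDerivAt y (y' x) x)
    (hk : ∀ x ≤ x0, κ ≤ y' x) {x : ℝ} (hx : x ≤ x0) : y x ≤ y x0 - κ * (x0 - x) := by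
  have hm : MonotoneOn (fun x => y x - κ * x) (Iic x0) := by
    refine monotoneOn_of_hasDerivWithinAt_nonneg (f' := fun x => y' x - κ * 1) (convex_Iic x0) ?_ ?_ ?_
    · intro x hx
      exact ((hd x hx).sub ((hasDerivAt_id x).const_mul κ)).continuousAt.continuousWithinAt
    · intro x hx
      rw [interior_Iic] at hx
      exact ((hd x (le_of_lt hx)).sub ((hasDerivAt_id x).const_mul κ)).hasDerivWithinAt
    · intro x hx
      rw [interior_Iic] at hx
      have := hk x (le_of_lt hx)
      linarith
  have := hm hx (mem_Iic.2 le_rfl) hx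
  simp only at this
  linarith

theorem riccati_false {y y' : ℝ → ℝ} {x0 κ : ℝ} (hκ : 0 < κ) (hd : ∀ x ≤ x0, HasDerivAt y (y' x) x)
    (hk : ∀ x ≤ x0, κ + y x ^ 2 / 2 ≤ y' x) : False := by
  have h1 : ∀ x ≤ x0, y x ≤ y x0 - κ * (x0 - x) := fun x hx =>
    mono_lin hd (fun x hx => by nlinarith [hk x hx, sq_nonneg (y x)]) hx
  set x1 := x0 - (|y x0| + 1) / κ with hx1
  have hx10 : x1 ≤ x0 := by
    have : 0 ≤ (|y x0| + 1) / κ := by positivity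
    linarith
  have h2 : ∀ x ≤ x1, y x ≤ -1 := by
    intro x hx
    have := h1 x (hx.trans hx10)
    have h3 : (|y x0| + 1) / κ ≤ x0 - x := by linarith
    rw [div_le_iff₀ hκ] at h3
    linarith [le_abs_self (y x0)]
  have h3 : ∀ x ≤ x1, -(y x)⁻¹ ≤ -(y x1)⁻¹ - 1 / 2 * (x1 - x) := by
    intro x hx
    refine mono_lin (y := fun x => -(y x)⁻¹) (y' := fun x => -(-y' x / y x ^ 2)) ?_ ?_ hx
    · intro x hx
      exact ((hd x (hx.trans hx10)).inv (by linarith [h2 x hx])).neg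
    · intro x hx
      have a := h2 x hx
      have b := hk x (hx.trans hx10)
      have : 0 < y x ^ 2 := by nlinarith
      rw [neg_div, neg_neg, le_div_iff₀ this]
      linarith
  have h4 := h3 (x1 - 2 * -(y x1)⁻¹ ) (by
    have : 0 ≤ -(y x1)⁻¹ := by rw [← inv_neg]; exact inv_nonneg.2 (by linarith [h2 x1 le_rfl])
    linarith)
  have h5 := h2 (x1 - 2 * -(y x1)⁻¹ ) (by
    have : 0 ≤ -(y x1)⁻¹ := by rw [← inv_neg]; exact inv_nonneg.2 (by linarith [h2 x1 le_rfl])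
    linarith)
  have h6 : 0 < -(y (x1 - 2 * -(y x1)⁻¹))⁻¹ := by rw [← inv_neg]; exact inv_pos.2 (by linarith)
  linarith

theorem Strip.sturm {u : ℂ → ℝ} {D q : ℂ → ℂ} {X c0 L : ℝ} (hs : Strip u D q X c0)
    (hL : Tendsto (fun x : ℝ => (q x).re) atBot (𝓝 L)) : L ≤ 0 := by
  by_contra hcon
  push Not at hcon
  obtain ⟨X', hX'⟩ := hs.dec (L / (2 * (1 + c0 ^ 2))) (by positivity)
  have e1 := hL.eventually (eventually_ge_nhds (show L / 2 < L by linarith))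
  obtain ⟨x1, hx1⟩ := eventually_atBot.1 e1
  have hmem : ∀ x : ℝ, x < X → (x : ℂ) ∈ Tb X := fun x hx => ⟨by simpa, by simp, by simpa using Real.pi_pos.le⟩
  refine riccati_false (y := fun x => (D x).re) (x0 := min (min X' x1) (X - 1)) (κ := L / 4)
    (y' := fun x => (q x + D x ^ 2 / 2 - (Real.exp (u x) / 2 : ℝ)).re) (by linarith) ?_ ?_
  · intro x hx
    have hxX : x < X := by linarith [hx.trans (min_le_right _ _)]
    exact (reCLM.hasFDerivAt (x := D x)).comp_hasDerivAt x (hs.lD x hxX)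
  · intro x hx
    have hxX : x < X := by linarith [hx.trans (min_le_right _ _)]
    have h1 := hx1 x ((hx.trans (min_le_left _ _)).trans (min_le_right _ _))
    have h2 := hX' x (hmem x hxX) (by simpa using (hx.trans (min_le_left _ _)).trans (min_le_left _ _))
    have h3 := hs.bd x (hmem x hxX) (Or.inl (by simp))
    have h4 : (D x).im ^ 2 ≤ c0 ^ 2 * Real.exp (u x) := by
      have := pow_le_pow_left₀ (abs_nonneg _) h3 2
      rw [sq_abs, mul_pow, ← Real.exp_nat_mul] at this
      have e : ((2:ℕ):ℝ) * (u x / 2) = u x := by push_cast; ring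
      rwa [e] at this
    rw [le_div_iff₀ (by positivity)] at h2
    have e : (q x + D x ^ 2 / 2 - (Real.exp (u x) / 2 : ℝ)).re =
        (q x).re + ((D x).re ^ 2 - (D x).im ^ 2) / 2 - Real.exp (u x) / 2 := by
      rw [sub_re, add_re, ofReal_re]
      have : (D x ^ 2 / 2).re = ((D x).re ^ 2 - (D x).im ^ 2) / 2 := by
        rw [show (2:ℂ) = ((2:ℝ):ℂ) by simp, div_ofReal_re, sq, mul_re]; ring
      rw [this]
    rw [e]
    linarith

end Part15

section Part16
open scoped Topology Interval

/-- Derivative of the end coordinates. -/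
noncomputable def pp (σ : ℝ) (ζ : ℂ) : ℂ := Complex.exp (σ * ζ)

/-- End coordinates. -/
noncomputable def phi (a σ : ℝ) (ζ : ℂ) : ℂ := a + σ * pp σ ζ

theorem pp_deriv (σ : ℝ) (ζ : ℂ) : HasDerivAt (pp σ) (σ * pp σ ζ) ζ := by
  have h := (((hasDerivAt_id ζ).const_mul (σ : ℂ))).cexp
  refine h.congr_deriv ?_
  simp [pp]; ring

theorem pp_ne (σ : ℝ) (ζ : ℂ) : pp σ ζ ≠ 0 := Complex.exp_ne_zero _

theorem pp_norm (σ : ℝ) (ζ : ℂ) : ‖pp σ ζ‖ = Real.exp (σ * ζ.re) := by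
  simp [pp, Complex.norm_exp]

section
variable {a σ : ℝ}

theorem sig_sq (hσ : σ = 1 ∨ σ = -1) : σ ^ 2 = 1 := by rcases hσ with h | h <;> rw [h] <;> norm_num

theorem phi_deriv (hσ : σ = 1 ∨ σ = -1) (ζ : ℂ) : HasDerivAt (phi a σ) (pp σ ζ) ζ := by
  have h := ((pp_deriv σ ζ).const_mul (σ:ℂ)).const_add (a:ℂ)
  refine h.congr_deriv ?_
  have : (σ:ℂ) ^ 2 = 1 := by rw [← ofReal_pow, sig_sq hσ]; simp
  linear_combination (pp σ ζ) * this

theorem phi_sub_norm (hσ : σ = 1 ∨ σ = -1) (ζ : ℂ) : ‖phi a σ ζ - a‖ = Real.exp (σ * ζ.re) := by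
  have : |σ| = 1 := by rcases hσ with h | h <;> rw [h] <;> norm_num
  simp [phi, pp_norm, this]

theorem phi_ne (hσ : σ = 1 ∨ σ = -1) (ζ : ℂ) : phi a σ ζ ≠ a := by
  intro h
  have := phi_sub_norm (a := a) hσ ζ
  rw [h, sub_self, norm_zero] at this
  exact (Real.exp_pos _).ne this

theorem phi_log (hσ : σ = 1 ∨ σ = -1) (ζ : ℂ) : σ * Real.log ‖phi a σ ζ - a‖ = ζ.re := by
  rw [phi_sub_norm hσ, Real.log_exp]
  have := sig_sq hσ
  linear_combination ζ.re * this

theorem phi_im (hσ : σ = 1 ∨ σ = -1) (ζ : ℂ) : (phi a σ ζ).im = Real.exp (σ * ζ.re) * Real.sin ζ.im := by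
  rcases hσ with h | h <;> subst h <;> simp [phi, pp, Complex.exp_im]

theorem phi_im_nonneg (hσ : σ = 1 ∨ σ = -1) {X : ℝ} {ζ : ℂ} (h : ζ ∈ Tb X) : 0 ≤ (phi a σ ζ).im := by
  rw [phi_im hσ]
  have := Real.sin_nonneg_of_nonneg_of_le_pi h.2.1 h.2.2
  positivity

theorem phi_im_pos (hσ : σ = 1 ∨ σ = -1) {X : ℝ} {ζ : ℂ} (h : ζ ∈ To X) : 0 < (phi a σ ζ).im := by
  rw [phi_im hσ]
  have := Real.sin_pos_of_pos_of_lt_pi h.2.1 h.2.2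
  positivity

theorem pp_im_zero (hσ : σ = 1 ∨ σ = -1) {ζ : ℂ} (h : ζ.im = 0 ∨ ζ.im = Real.pi) : (pp σ ζ).im = 0 := by
  have hs : Real.sin ζ.im = 0 := by rcases h with h | h <;> rw [h] <;> simp
  rcases hσ with h | h <;> subst h <;> simp [pp, Complex.exp_im, hs]

theorem phi_im_zero (hσ : σ = 1 ∨ σ = -1) {ζ : ℂ} (h : ζ.im = 0 ∨ ζ.im = Real.pi) : (phi a σ ζ).im = 0 := by
  have hs : Real.sin ζ.im = 0 := by rcases h with h | h <;> rw [h] <;> simp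
  rw [phi_im hσ, hs, mul_zero]

end

theorem of_im_zero {z : ℂ} (h : z.im = 0) : z = ((z.re : ℝ) : ℂ) := by
  apply Complex.ext <;> simp [h]

/-- pulled back function -/
noncomputable def pu (a σ : ℝ) (v : ℂ → ℝ) (ζ : ℂ) : ℝ := v (phi a σ ζ) + 2 * σ * ζ.re

/-- pulled back derivative -/
noncomputable def pD (a σ : ℝ) (V : ℂ → ℂ) (ζ : ℂ) : ℂ := V (phi a σ ζ) * pp σ ζ + σ

/-- pulled back Schwarzian -/
noncomputable def pq (a σ : ℝ) (Q : ℂ → ℂ) (ζ : ℂ) : ℂ := pp σ ζ ^ 2 * Q (phi a σ ζ) - 1 / 2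

theorem pu_exp (a : ℝ) {σ : ℝ} (v : ℂ → ℝ) (ζ : ℂ) :
    Real.exp (pu a σ v ζ) = ‖pp σ ζ‖ ^ 2 * Real.exp (v (phi a σ ζ)) := by
  rw [pp_norm, pu, ← Real.exp_nat_mul, ← Real.exp_add]
  congr 1; push_cast; ring

theorem pu_exp2 (a : ℝ) {σ : ℝ} (v : ℂ → ℝ) (ζ : ℂ) :
    Real.exp (pu a σ v ζ / 2) = ‖pp σ ζ‖ * Real.exp (v (phi a σ ζ) / 2) := by
  rw [pp_norm, pu, ← Real.exp_add]
  congr 1; ring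

theorem LTrip.pull {v : ℂ → ℝ} {V Q : ℂ → ℂ} {a σ : ℝ} (hσ : σ = 1 ∨ σ = -1) {ζ : ℂ}
    (h : LTrip v V Q (phi a σ ζ)) : LTrip (pu a σ v) (pD a σ V) (pq a σ Q) ζ := by
  have hp := cF_of_deriv (pp_deriv σ ζ)
  have hf := cF_of_deriv (phi_deriv (a := a) hσ ζ)
  have hs : (σ:ℂ) ^ 2 = 1 := by rw [← ofReal_pow, sig_sq hσ]; simp
  constructor
  · have h1 := h.dv.comp ζ hf
    have h2 := (reCLM.hasFDerivAt (x := ζ)).const_mul (2 * σ)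
    refine (h1.add h2).congr_fderiv ?_
    apply ContinuousLinearMap.ext
    intro w
    simp [reF_apply, cF_apply, pD]
    ring
  · have h1 := ((h.dV.comp ζ hf).mul hp).add_const (σ:ℂ)
    refine h1.congr_fderiv ?_
    apply ContinuousLinearMap.ext
    intro w
    have hn : (starRingEnd ℂ) (pp σ ζ) * pp σ ζ = ((‖pp σ ζ‖ ^ 2 : ℝ) : ℂ) := by
      rw [mul_comm, mul_conj, normSq_eq_norm_sq]
    rw [pu_exp]
    simp only [_root_.add_apply, _root_.smul_apply, cF_apply, smul_eq_mul,
      ContinuousLinearMap.comp_apply, pD, pq, Function.comp, map_mul, zero_mul, add_zero, ofReal_div, ofReal_mul, ← hn]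
    push_cast
    linear_combination (-w / 2) * hs

theorem Sol.strip {v : ℂ → ℝ} {V Q : ℂ → ℂ} {S : Set ℂ} {c0 : ℝ} (hs : Sol v V Q S c0)
    {a σ X1 : ℝ} (hσ : σ = 1 ∨ σ = -1) (hS : ∀ s ∈ S, s = a ∨ X1 ≤ σ * Real.log ‖s - a‖) :
    ∃ X, X ≤ X1 ∧ Strip (pu a σ v) (pD a σ V) (pq a σ Q) X c0 := by
  obtain ⟨X2, hX2⟩ := hs.decay hσ hS one_pos
  set X := min X1 X2 with hX
  have hXX : X ≤ X1 := min_le_left _ _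
  have hXX2 : X ≤ X2 := min_le_right _ _
  refine ⟨X, hXX, ?_⟩
  have hnS : ∀ ζ ∈ Tb X, phi a σ ζ ∉ S := by
    intro ζ hζ hm
    rcases hS _ hm with h | h
    · exact phi_ne hσ ζ h
    · rw [phi_log hσ] at h
      linarith [hζ.1]
  have hmaps : MapsTo (phi a σ) (Tb X) (Hb \ S) := fun ζ hζ => ⟨phi_im_nonneg hσ hζ, hnS ζ hζ⟩
  have cphi : ContinuousOn (phi a σ) (Tb X) := fun ζ _ => (phi_deriv hσ ζ).continuousAt.continuousWithinAt
  have cpp : ContinuousOn (pp σ) (Tb X) := fun ζ _ => (pp_deriv σ ζ).continuousAt.continuousWithinAt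
  have crr : ContinuousOn (fun z : ℂ => z.re) (Tb X) := continuous_re.continuousOn
  have cv : ContinuousOn (fun ζ => v (phi a σ ζ)) (Tb X) := hs.cv.comp cphi hmaps
  have cV : ContinuousOn (fun ζ => V (phi a σ ζ)) (Tb X) := hs.cV.comp cphi hmaps
  have cQ : ContinuousOn (fun ζ => Q (phi a σ ζ)) (Tb X) := hs.cQ.comp cphi hmaps
  have hdec : ∀ ε X', (∀ z : ℂ, 0 ≤ z.im → z ≠ a → σ * Real.log ‖z - a‖ ≤ X' →
      ‖z - a‖ ^ 2 * Real.exp (v z) ≤ ε) → ∀ ζ ∈ Tb X, ζ.re ≤ X' → Real.exp (pu a σ v ζ) ≤ ε := by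
    intro ε X' h ζ hζ hζX
    have := h (phi a σ ζ) (phi_im_nonneg hσ hζ) (phi_ne hσ ζ) (by rw [phi_log hσ]; exact hζX)
    rwa [phi_sub_norm hσ, ← pp_norm, ← pu_exp] at this
  have hmem : ∀ x : ℝ, x < X → (x : ℂ) ∈ Tb X := fun x hx => ⟨by simpa, by simp, by simpa using Real.pi_pos.le⟩
  set φ : ℝ → ℝ := fun x => a + σ * Real.exp (σ * x) with hφ
  have hφd : ∀ x, HasDerivAt φ (Real.exp (σ * x)) x := by
    intro x
    have h := ((((hasDerivAt_id x).const_mul σ).exp).const_mul σ).const_add a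
    refine h.congr_deriv ?_
    have := sig_sq hσ
    simp only [id]
    linear_combination (Real.exp (σ * x)) * this
  have hpe : ∀ x : ℝ, pp σ x = ((Real.exp (σ * x) : ℝ) : ℂ) := fun x => by simp [pp]
  have hφe : ∀ x : ℝ, phi a σ x = ((φ x : ℝ) : ℂ) := fun x => by simp [phi, hφ, pp]
  refine ⟨hs.c0n, ?_, ?_, ?_, ?_, ?_, ?_, ?_, ?_, ?_, ?_⟩
  · exact cv.add (continuousOn_const.mul crr)
  · exact (cV.mul cpp).add continuousOn_const
  · exact ((cpp.pow 2).mul cQ).sub continuousOn_const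
  · intro ζ hζ
    exact (hs.trip _ (phi_im_pos hσ hζ)).pull hσ
  · intro ζ hζ hζ'
    have e1 := of_im_zero (phi_im_zero (a := a) hσ hζ')
    have e2 := pp_im_zero hσ hζ'
    have hb := hs.bd (phi a σ ζ).re (by rw [← e1]; exact hnS ζ hζ)
    rw [← e1] at hb
    have e3 : (pD a σ V ζ).im = (V (phi a σ ζ)).im * (pp σ ζ).re := by
      simp [pD, mul_im, e2]
    have e4 : |(pp σ ζ).re| = ‖pp σ ζ‖ := by
      conv_rhs => rw [of_im_zero e2]
      simp
    rw [e3, abs_mul, e4, pu_exp2]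
    calc _ ≤ c0 * Real.exp (v (phi a σ ζ) / 2) * ‖pp σ ζ‖ := by gcongr
      _ = _ := by ring
  · intro ζ hζ hζ'
    have e1 := of_im_zero (phi_im_zero (a := a) hσ hζ')
    have e2 := pp_im_zero hσ hζ'
    have hb := hs.realQ (phi a σ ζ).re (by rw [← e1]; exact hnS ζ hζ)
    rw [← e1] at hb
    simp [pq, hb, e2, sq, mul_im]
  · intro ζ hζ
    have := hdec 1 X2 hX2 ζ hζ (hζ.1.le.trans hXX2)
    exact Real.exp_le_one_iff.1 this
  · intro ε hε
    obtain ⟨X', hX'⟩ := hs.decay hσ hS hε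
    exact ⟨X', hdec ε X' hX'⟩
  · intro x hx
    have hn := hnS x (hmem x hx)
    rw [hφe] at hn
    have h1 := (hs.lv (φ x) hn).comp x (hφd x)
    have h2 := (hasDerivAt_id x).const_mul (2 * σ)
    have h3 := h1.add h2
    have e : (fun x : ℝ => pu a σ v x) = (fun x : ℝ => v x) ∘ φ + fun x => 2 * σ * id x := by
      funext x; simp [pu, hφe]
    rw [e]
    refine h3.congr_deriv ?_
    rw [pD, hφe, hpe, add_re, re_mul_ofReal, ofReal_re]
    ring
  · intro x hx
    have hn := hnS x (hmem x hx)
    rw [hφe] at hn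
    have h1 := (hs.lV (φ x) hn).scomp x (hφd x)
    have h2 : HasDerivAt (fun x : ℝ => pp σ x) (σ * pp σ x) x := (pp_deriv σ x).comp_ofReal
    have h3 := (h1.mul h2).add_const (σ:ℂ)
    have e : (fun x : ℝ => pD a σ V x) = fun y => ((fun x : ℝ => V x) ∘ φ * fun x : ℝ => pp σ x) y + (σ:ℂ) := by
      funext x; simp [pD, hφe]
    rw [e]
    refine h3.congr_deriv ?_
    have hs2 : (σ:ℂ) ^ 2 = 1 := by rw [← ofReal_pow, sig_sq hσ]; simp
    have hn : ‖pp σ x‖ = Real.exp (σ * x) := by rw [pp_norm]; simp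
    rw [pu_exp, pq, pD, hφe, hn]
    simp only [hpe, Function.comp, real_smul]
    push_cast
    linear_combination (-1 / 2) * hs2

end Part16

section Part17
open scoped Topology Interval

theorem circleMap_conj (a r θ : ℝ) : circleMap a r (2 * Real.pi - θ) = (starRingEnd ℂ) (circleMap a r θ) := by
  simp only [circleMap, map_add, map_mul, conj_ofReal, ← Complex.exp_conj, conj_I]
  congr 2
  have : ((2 * Real.pi - θ : ℝ) : ℂ) * I = θ * -I + 2 * Real.pi * I := by push_cast; ring
  rw [this, Complex.exp_add, Complex.exp_two_pi_mul_I, mul_one]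

theorem circle_zero {f : ℂ → ℂ} {a r : ℝ} (hr : 0 ≤ r) (hf : ContinuousOn f (Metric.sphere (a:ℂ) r))
    (sym : ∀ z ∈ Metric.sphere (a:ℂ) r, f ((starRingEnd ℂ) z) = (starRingEnd ℂ) (f z))
    (h0 : ∫ θ in (0:ℝ)..Real.pi, ((circleMap a r θ - a) * f (circleMap a r θ)).re = 0) :
    ∮ z in C(a, r), f z = 0 := by
  set H : ℝ → ℂ := fun θ => (circleMap a r θ - a) * f (circleMap a r θ) with hH
  have hcm : Continuous (circleMap (a:ℂ) r) := continuous_circleMap _ _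
  have hHc : Continuous H := by
    refine (hcm.sub continuous_const).mul ?_
    exact hf.comp_continuous hcm fun θ => circleMap_mem_sphere _ hr θ
  have e : ∮ z in C(a, r), f z = I * ∫ θ in (0:ℝ)..(2 * Real.pi), H θ := by
    rw [circleIntegral, ← intervalIntegral.integral_const_mul]
    refine intervalIntegral.integral_congr fun θ _ => ?_
    simp only [deriv_circleMap, smul_eq_mul, hH, circleMap_sub_center]
    ring
  have ii : ∀ x y, IntervalIntegrable H volume x y := fun x y => hHc.intervalIntegrable x y
  have hHs : ∀ θ, H (2 * Real.pi - θ) = (starRingEnd ℂ) (H θ) := by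
    intro θ
    simp only [hH, circleMap_conj, map_mul, map_sub, conj_ofReal, sym _ (circleMap_mem_sphere _ hr θ)]
  have h2 : ∫ θ in Real.pi..(2 * Real.pi), H θ = ∫ θ in (0:ℝ)..Real.pi, (starRingEnd ℂ) (H θ) := by
    have := intervalIntegral.integral_comp_sub_left H (2 * Real.pi) (a := 0) (b := Real.pi)
    rw [sub_zero, show 2 * Real.pi - Real.pi = Real.pi by ring] at this
    rw [← this]
    exact intervalIntegral.integral_congr fun θ _ => hHs θ
  have h3 : Continuous fun θ => (starRingEnd ℂ) (H θ) := continuous_conj.comp hHc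
  rw [e, ← intervalIntegral.integral_add_adjacent_intervals (ii 0 Real.pi) (ii _ _), h2,
    ← intervalIntegral.integral_add (ii _ _) (h3.intervalIntegrable _ _)]
  have : ∀ θ, H θ + (starRingEnd ℂ) (H θ) = ((2 * (H θ).re : ℝ) : ℂ) := fun θ => add_conj _
  simp only [this]
  rw [intervalIntegral.integral_ofReal, intervalIntegral.integral_const_mul, h0]
  simp

/-- Punctured neighbourhood of an end. -/
def En (a σ X : ℝ) : Set ℂ := {z | z ≠ a ∧ σ * Real.log ‖z - a‖ < X}

theorem En_conj {a σ X : ℝ} {z : ℂ} : (starRingEnd ℂ) z ∈ En a σ X ↔ z ∈ En a σ X := by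
  have h : ‖(starRingEnd ℂ) z - a‖ = ‖z - a‖ := by
    rw [← norm_conj, map_sub, conj_conj, conj_ofReal]
  have h2 : (starRingEnd ℂ) z ≠ a ↔ z ≠ a := by
    rw [← sub_ne_zero, ← norm_ne_zero_iff, h, norm_ne_zero_iff, sub_ne_zero]
  unfold En
  simp only [mem_ofPred_eq, h, h2]

theorem phi_En {a σ X : ℝ} (hσ : σ = 1 ∨ σ = -1) {ζ : ℂ} (h : ζ.re < X) : phi a σ ζ ∈ En a σ X :=
  ⟨phi_ne hσ ζ, by rw [phi_log hσ]; exact h⟩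

/-- test functions near an end -/
structure KT (k k' : ℂ → ℂ) (a σ X C : ℝ) : Prop where
  d : ∀ z ∈ En a σ X, HasDerivAt k (k' z) z
  c : ContinuousOn k' (En a σ X)
  b : ∀ z ∈ En a σ X, ‖k z‖ ≤ C
  b' : ∀ z ∈ En a σ X, ‖k' z‖ * ‖z - a‖ ≤ C

theorem KT.mono {k k' : ℂ → ℂ} {a σ X X' C : ℝ} (h : KT k k' a σ X C) (hX : X' ≤ X) : KT k k' a σ X' C := by
  have hs : En a σ X' ⊆ En a σ X := fun z hz => ⟨hz.1, hz.2.trans_le hX⟩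
  exact ⟨fun z hz => h.d z (hs hz), h.c.mono hs, fun z hz => h.b z (hs hz), fun z hz => h.b' z (hs hz)⟩

theorem KT.star {k k' : ℂ → ℂ} {a σ X C : ℝ} (h : KT k k' a σ X C) :
    KT (fun z => (starRingEnd ℂ) (k ((starRingEnd ℂ) z))) (fun z => (starRingEnd ℂ) (k' ((starRingEnd ℂ) z))) a σ X C := by
  refine ⟨?_, ?_, ?_, ?_⟩
  · intro z hz
    have := (h.d _ (En_conj.2 hz)).conj_conj
    rw [conj_conj] at this
    exact this
  · exact continuous_conj.comp_continuousOn (h.c.comp continuous_conj.continuousOn fun z hz => En_conj.2 hz)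
  · intro z hz
    rw [norm_conj]; exact h.b _ (En_conj.2 hz)
  · intro z hz
    rw [norm_conj]
    have e : ‖(starRingEnd ℂ) z - a‖ = ‖z - a‖ := by
      rw [← norm_conj, map_sub, conj_conj, conj_ofReal]
    rw [← e]; exact h.b' _ (En_conj.2 hz)

theorem KT.add {k k' l l' : ℂ → ℂ} {a σ X C C' : ℝ} (h : KT k k' a σ X C) (h2 : KT l l' a σ X C') :
    KT (fun z => k z + l z) (fun z => k' z + l' z) a σ X (C + C') := by
  refine ⟨fun z hz => (h.d z hz).add (h2.d z hz), h.c.add h2.c,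
    fun z hz => (norm_add_le _ _).trans (add_le_add (h.b z hz) (h2.b z hz)), fun z hz => ?_⟩
  calc ‖k' z + l' z‖ * ‖z - a‖ ≤ (‖k' z‖ + ‖l' z‖) * ‖z - a‖ := by gcongr; exact norm_add_le _ _
    _ ≤ _ := by rw [add_mul]; exact add_le_add (h.b' z hz) (h2.b' z hz)

theorem KT.const_mul {k k' : ℂ → ℂ} {a σ X C : ℝ} (h : KT k k' a σ X C) {c : ℂ} (hc : ‖c‖ = 1) :
    KT (fun z => c * k z) (fun z => c * k' z) a σ X C := by
  refine ⟨fun z hz => (h.d z hz).const_mul c, continuousOn_const.mul h.c, fun z hz => ?_, fun z hz => ?_⟩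
  · rw [norm_mul, hc, one_mul]; exact h.b z hz
  · rw [norm_mul, hc, one_mul]; exact h.b' z hz

theorem KT.cont {k k' : ℂ → ℂ} {a σ X C : ℝ} (h : KT k k' a σ X C) : ContinuousOn k (En a σ X) :=
  fun z hz => (h.d z hz).continuousAt.continuousWithinAt

theorem KT.test {k k' : ℂ → ℂ} {a σ X C : ℝ} (hσ : σ = 1 ∨ σ = -1) (h : KT k k' a σ X C)
    (hr : ∀ z ∈ En a σ X, z.im = 0 → (k z).im = 0) :
    TestG (fun ζ => k (phi a σ ζ) * Complex.exp ζ)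
      (fun ζ => k' (phi a σ ζ) * pp σ ζ * Complex.exp ζ + k (phi a σ ζ) * Complex.exp ζ) X (2 * C) := by
  have cphi : ContinuousOn (phi a σ) (Tb X) := fun ζ _ => (phi_deriv hσ ζ).continuousAt.continuousWithinAt
  have cpp : ContinuousOn (pp σ) (Tb X) := fun ζ _ => (pp_deriv σ ζ).continuousAt.continuousWithinAt
  have cex : ContinuousOn Complex.exp (Tb X) := Complex.continuous_exp.continuousOn
  have hm : MapsTo (phi a σ) (Tb X) (En a σ X) := fun ζ hζ => phi_En hσ hζ.1
  have cn : ∀ ζ ∈ Tb X, 0 ≤ C := fun ζ hζ => (norm_nonneg _).trans (h.b _ (hm hζ))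
  refine ⟨?_, ?_, ?_, ?_, ?_⟩
  · intro ζ hζ
    exact ((h.d _ (hm hζ)).comp ζ (phi_deriv hσ ζ)).mul (Complex.hasDerivAt_exp ζ)
  · exact (((h.c.comp cphi hm).mul cpp).mul cex).add ((h.cont.comp cphi hm).mul cex)
  · intro ζ hζ hζ'
    have h1 := hr _ (hm hζ) (phi_im_zero hσ hζ')
    have h2 := pp_im_zero (σ := 1) (Or.inl rfl) hζ'
    simp only [pp, ofReal_one, one_mul] at h2
    rw [mul_im, h1, h2]; simp
  · intro ζ hζ
    have := h.b _ (hm hζ)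
    have c := cn ζ hζ
    rw [norm_mul, Complex.norm_exp]
    gcongr
    linarith
  · intro ζ hζ
    have h1 := h.b _ (hm hζ)
    have h2 := h.b' _ (hm hζ)
    rw [phi_sub_norm hσ, ← pp_norm] at h2
    rw [← add_mul, norm_mul, Complex.norm_exp]
    gcongr
    refine (norm_add_le _ _).trans ?_
    rw [norm_mul]
    linarith

theorem phi_one (a x y : ℝ) : phi a 1 (x + y * I) = circleMap a (Real.exp x) y := by
  simp [phi, pp, circleMap, Complex.exp_add]

theorem phi_neg_one (x y : ℝ) : phi 0 (-1) (x + y * I) = circleMap 0 (Real.exp (-x)) (Real.pi - y) := by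
  have : Complex.exp ((Real.pi - y : ℝ) * I) = - Complex.exp (-(y * I)) := by
    push_cast
    rw [sub_mul, sub_eq_add_neg, Complex.exp_add, Complex.exp_pi_mul_I]; ring
  rw [circleMap, this]
  simp [phi, pp, Complex.exp_add]
  ring

/-- the data for one end -/
structure EndD (v : ℂ → ℝ) (V Q : ℂ → ℂ) (S : Set ℂ) (c0 a σ X : ℝ) : Prop where
  sol : Sol v V Q S c0
  sg : σ = 1 ∨ σ = -1
  nS : ∀ z ∈ En a σ X, z ∉ S
  st : Strip (pu a σ v) (pD a σ V) (pq a σ Q) X c0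

theorem Sol.endD {v : ℂ → ℝ} {V Q : ℂ → ℂ} {S : Set ℂ} {c0 : ℝ} (hs : Sol v V Q S c0)
    {a σ X1 : ℝ} (hσ : σ = 1 ∨ σ = -1) (hS : ∀ s ∈ S, s = a ∨ X1 ≤ σ * Real.log ‖s - a‖) :
    ∃ X, EndD v V Q S c0 a σ X := by
  obtain ⟨X, hX, h⟩ := hs.strip hσ hS
  refine ⟨X, hs, hσ, ?_, h⟩
  intro z hz hzS
  rcases hS z hzS with h1 | h1
  · exact hz.1 h1
  · linarith [hz.2]

theorem Strip.mono {u : ℂ → ℝ} {D q : ℂ → ℂ} {X X' c0 : ℝ} (hs : Strip u D q X c0) (h : X' ≤ X) :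
    Strip u D q X' c0 := by
  have h1 : Tb X' ⊆ Tb X := fun z hz => ⟨hz.1.trans_le h, hz.2⟩
  have h2 : To X' ⊆ To X := fun z hz => ⟨hz.1.trans_le h, hz.2⟩
  refine ⟨hs.c0n, hs.cu.mono h1, hs.cD.mono h1, hs.cq.mono h1, fun z hz => hs.trip z (h2 hz),
    fun z hz => hs.bd z (h1 hz), fun z hz => hs.rq z (h1 hz), fun z hz => hs.neg z (h1 hz), ?_,
    fun x hx => hs.lu x (hx.trans_le h), fun x hx => hs.lD x (hx.trans_le h)⟩
  intro ε hε
  obtain ⟨Y, hY⟩ := hs.dec ε hε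
  exact ⟨Y, fun z hz => hY z (h1 hz)⟩

theorem EndD.mono {v : ℂ → ℝ} {V Q : ℂ → ℂ} {S : Set ℂ} {c0 a σ X X' : ℝ} (h : EndD v V Q S c0 a σ X)
    (hX : X' ≤ X) : EndD v V Q S c0 a σ X' :=
  ⟨h.sol, h.sg, fun z hz => h.nS z ⟨hz.1, hz.2.trans_le hX⟩, h.st.mono hX⟩

theorem En_sphere {a σ X x : ℝ} (hσ : σ = 1 ∨ σ = -1) (hx : x < X) {z : ℂ}
    (hz : z ∈ Metric.sphere (a:ℂ) (Real.exp (σ * x))) : z ∈ En a σ X := by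
  rw [mem_sphere_iff_norm] at hz
  refine ⟨?_, ?_⟩
  · intro h
    rw [h, sub_self, norm_zero] at hz
    exact (Real.exp_pos _).ne hz
  · rw [hz, Real.log_exp]
    have h2 : σ * (σ * x) = x := by linear_combination x * sig_sq hσ
    linarith

section
variable {v : ℂ → ℝ} {V Q : ℂ → ℂ} {S : Set ℂ} {c0 a σ X : ℝ}

theorem EndD.cQx (h : EndD v V Q S c0 a σ X) : ContinuousOn (Qx Q) (En a σ X) :=
  h.sol.holoQx.continuousOn.mono h.nS

theorem EndD.circle_pos_sym (h : EndD v V Q S c0 a 1 X) {k k' : ℂ → ℂ} {C : ℝ} (hk : KT k k' a 1 X C)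
    (hsym : ∀ z ∈ En a 1 X, k ((starRingEnd ℂ) z) = (starRingEnd ℂ) (k z)) {x : ℝ} (hx : x < X) :
    ∮ z in C(a, Real.exp x), ((z - a) ^ 2 * Qx Q z - 1 / 2) * k z = 0 := by
  have hE : ∀ z ∈ Metric.sphere (a:ℂ) (Real.exp x), z ∈ En a 1 X := fun z hz =>
    En_sphere (Or.inl rfl) hx (by simpa using hz)
  have cQ := h.cQx.mono hE
  have ck := hk.cont.mono hE
  have mom := h.st.moment (hk.test h.sg (by
    intro z hz hz0
    have := hsym z hz
    rw [conj_eq_iff_im.2 hz0] at this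
    exact conj_eq_iff_im.1 this.symm)) hx
  refine circle_zero (Real.exp_pos x).le ?_ ?_ ?_
  · exact ((((continuousOn_id.sub continuousOn_const).pow 2).mul cQ).sub continuousOn_const).mul ck
  · intro z hz
    rw [h.sol.Qx_conj (h.nS z (hE z hz)), hsym z (hE z hz)]
    have h2c : (starRingEnd ℂ) (2:ℂ) = 2 := by simpa using conj_ofReal 2
    simp [h2c]
  · refine Eq.trans ?_ mom
    refine intervalIntegral.integral_congr fun y hy => ?_
    rw [uIcc_of_le Real.pi_pos.le] at hy
    have him : 0 ≤ (phi a 1 (x + y * I)).im := phi_im_nonneg (Or.inl rfl) (mem_Tb hx hy.1 hy.2)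
    simp only [← phi_one]
    rw [Qx_up him]
    have e : phi a 1 (x + y * I) - a = Complex.exp (x + y * I) := by simp [phi, pp]
    have e2 : pp 1 (x + y * I) = Complex.exp (x + y * I) := by simp [pp]
    rw [e, pq, e2]
    congr 1
    ring

theorem EndD.circle_neg_sym (h : EndD v V Q S c0 0 (-1) X) {k k' : ℂ → ℂ} {C : ℝ} (hk : KT k k' 0 (-1) X C)
    (hsym : ∀ z ∈ En 0 (-1) X, k ((starRingEnd ℂ) z) = (starRingEnd ℂ) (k z)) {x : ℝ} (hx : x < X) :
    ∮ z in C(0, Real.exp (-x)), (Qx Q z - 1 / 2 / z ^ 2) * k z = 0 := by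
  have hE : ∀ z ∈ Metric.sphere (((0:ℝ):ℂ)) (Real.exp (-x)), z ∈ En 0 (-1) X := fun z hz =>
    En_sphere (Or.inr rfl) hx (by simpa using hz)
  have cQ := h.cQx.mono hE
  have ck := hk.cont.mono hE
  have mom := h.st.moment (hk.test h.sg (by
    intro z hz hz0
    have := hsym z hz
    rw [conj_eq_iff_im.2 hz0] at this
    exact conj_eq_iff_im.1 this.symm)) hx
  rw [← ofReal_zero]
  refine circle_zero (Real.exp_pos (-x)).le ?_ ?_ ?_
  · exact (cQ.sub (continuousOn_const.div (continuousOn_id.pow 2) fun z hz => pow_ne_zero 2 (by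
      have := (hE z hz).1
      simpa using this))).mul ck
  · intro z hz
    rw [h.sol.Qx_conj (h.nS z (hE z hz)), hsym z (hE z hz)]
    have h2c : (starRingEnd ℂ) (2:ℂ) = 2 := by simpa using conj_ofReal 2
    simp [h2c]
  · have hsub := intervalIntegral.integral_comp_sub_left (fun θ : ℝ => ((circleMap ((0:ℝ):ℂ) (Real.exp (-x)) θ - ((0:ℝ):ℂ)) *
      ((Qx Q (circleMap ((0:ℝ):ℂ) (Real.exp (-x)) θ) - 1 / 2 / circleMap ((0:ℝ):ℂ) (Real.exp (-x)) θ ^ 2) * k (circleMap ((0:ℝ):ℂ) (Real.exp (-x)) θ))).re)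
        Real.pi (a := 0) (b := Real.pi)
    rw [sub_self, sub_zero] at hsub
    refine hsub.symm.trans (neg_eq_zero.1 ?_)
    rw [← intervalIntegral.integral_neg]
    refine Eq.trans ?_ mom
    refine intervalIntegral.integral_congr fun y hy => ?_
    rw [uIcc_of_le Real.pi_pos.le] at hy
    have him : 0 ≤ (phi 0 (-1) (x + y * I)).im := phi_im_nonneg (Or.inr rfl) (mem_Tb hx hy.1 hy.2)
    simp only [ofReal_zero, ← phi_neg_one]
    rw [Qx_up him, pq]
    have e : phi 0 (-1) (x + y * I) * Complex.exp (x + y * I) = -1 := by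
      simp [phi, pp, ← Complex.exp_add]
    have e2 : pp (-1) (x + y * I) ^ 2 = phi 0 (-1) (x + y * I) ^ 2 := by simp [phi]
    rw [e2]
    set z := phi 0 (-1) (x + y * I)
    set E := Complex.exp (x + y * I)
    have hz : z ≠ 0 := by
      intro h0; rw [h0] at e; simp at e
    have hEe : E = -1 / z := by field_simp; linear_combination e
    rw [hEe, ← neg_re]
    congr 1
    field_simp
    ring
end

theorem circle_gen {F : ℂ → ℂ} {a σ X r : ℝ} {c : ℂ} (hr : 0 ≤ r) (hE : ∀ z ∈ Metric.sphere c r, z ∈ En a σ X)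
    (cF : ContinuousOn F (Metric.sphere c r))
    (H : ∀ k k' : ℂ → ℂ, ∀ C : ℝ, KT k k' a σ X C →
      (∀ z ∈ En a σ X, k ((starRingEnd ℂ) z) = (starRingEnd ℂ) (k z)) → ∮ z in C(c, r), F z * k z = 0)
    {k k' : ℂ → ℂ} {C : ℝ} (hk : KT k k' a σ X C) : ∮ z in C(c, r), F z * k z = 0 := by
  have hk1 := hk.add hk.star
  have hk2 := (hk.add (hk.star.const_mul (c := -1) (by simp))).const_mul (c := I) (by simp)
  have h1 := H _ _ _ hk1 (by intro z hz; simp; ring)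
  have h2 := H _ _ _ hk2 (by intro z hz; simp; ring)
  have i1 : CircleIntegrable (fun z => F z * (k z + (starRingEnd ℂ) (k ((starRingEnd ℂ) z)))) c r :=
    ContinuousOn.circleIntegrable hr (cF.mul (hk1.cont.mono hE))
  have i2 : CircleIntegrable (fun z => F z * (I * (k z + -1 * (starRingEnd ℂ) (k ((starRingEnd ℂ) z))))) c r :=
    ContinuousOn.circleIntegrable hr (cF.mul (hk2.cont.mono hE))
  have e : ∀ z, F z * k z = (1/2:ℂ) * (F z * (k z + (starRingEnd ℂ) (k ((starRingEnd ℂ) z)))) +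
      (-I/2) * (F z * (I * (k z + -1 * (starRingEnd ℂ) (k ((starRingEnd ℂ) z))))) := by
    intro z
    linear_combination (-F z * (k z - (starRingEnd ℂ) (k ((starRingEnd ℂ) z))) / 2) * (-I_sq)
  simp only [e]
  refine (circleIntegral.integral_add (i1.const_smul (a := (1/2:ℂ))) (i2.const_smul (a := (-I/2:ℂ)))).trans ?_
  simp only [Pi.smul_apply, smul_eq_mul]
  rw [circleIntegral.integral_const_mul, circleIntegral.integral_const_mul, h1, h2]
  simp

section
variable {v : ℂ → ℝ} {V Q : ℂ → ℂ} {S : Set ℂ} {c0 a σ X : ℝ}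

theorem EndD.circle_pos (h : EndD v V Q S c0 a 1 X) {k k' : ℂ → ℂ} {C : ℝ} (hk : KT k k' a 1 X C) {x : ℝ} (hx : x < X) :
    ∮ z in C(a, Real.exp x), ((z - a) ^ 2 * Qx Q z - 1 / 2) * k z = 0 := by
  have hE : ∀ z ∈ Metric.sphere (a:ℂ) (Real.exp x), z ∈ En a 1 X := fun z hz =>
    En_sphere (Or.inl rfl) hx (by simpa using hz)
  refine circle_gen (Real.exp_pos x).le hE ?_ (fun k k' C hk hs => h.circle_pos_sym hk hs hx) hk
  exact ((((continuousOn_id.sub continuousOn_const).pow 2).mul (h.cQx.mono hE)).sub continuousOn_const)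

theorem EndD.circle_neg (h : EndD v V Q S c0 0 (-1) X) {k k' : ℂ → ℂ} {C : ℝ} (hk : KT k k' 0 (-1) X C) {x : ℝ} (hx : x < X) :
    ∮ z in C(0, Real.exp (-x)), (Qx Q z - 1 / 2 / z ^ 2) * k z = 0 := by
  have hE : ∀ z ∈ Metric.sphere (0:ℂ) (Real.exp (-x)), z ∈ En 0 (-1) X := fun z hz =>
    En_sphere (Or.inr rfl) hx (by simpa using hz)
  refine circle_gen (Real.exp_pos (-x)).le hE ?_ (fun k k' C hk hs => h.circle_neg_sym hk hs hx) hk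
  exact ((h.cQx.mono hE).sub (continuousOn_const.div (continuousOn_id.pow 2) fun z hz => pow_ne_zero 2 (by
      have := (hE z hz).1
      simpa using this)))
end

end Part17

section Part18
open scoped Topology Interval

theorem KT_inv_pos {a X : ℝ} {w : ℂ} (hw : w ≠ a) (hX : X ≤ Real.log (‖w - a‖ / 2)) :
    KT (fun z => (z - w)⁻¹) (fun z => -1 / (z - w) ^ 2) a 1 X (2 / ‖w - a‖) := by
  have hδ : 0 < ‖w - a‖ := norm_pos_iff.2 (sub_ne_zero.2 hw)
  have key : ∀ z ∈ En a 1 X, ‖z - a‖ ≤ ‖w - a‖ / 2 ∧ ‖w - a‖ / 2 ≤ ‖z - w‖ := by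
    intro z hz
    have hz1 : 0 < ‖z - a‖ := norm_pos_iff.2 (sub_ne_zero.2 hz.1)
    have h1 : ‖z - a‖ < ‖w - a‖ / 2 := by
      have := hz.2
      rw [one_mul] at this
      exact (Real.log_lt_log_iff hz1 (by positivity)).1 (this.trans_le hX)
    refine ⟨h1.le, ?_⟩
    have : ‖w - a‖ ≤ ‖z - a‖ + ‖z - w‖ := by
      have := norm_sub_le (z - a) (z - w)
      rwa [show z - a - (z - w) = w - a by ring] at this
    linarith
  have ne : ∀ z ∈ En a 1 X, z - w ≠ 0 := fun z hz => by
    have := (key z hz).2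
    exact norm_pos_iff.1 (by linarith)
  refine ⟨?_, ?_, ?_, ?_⟩
  · intro z hz
    exact ((hasDerivAt_id z).sub_const w).inv (ne z hz)
  · exact continuousOn_const.div ((continuousOn_id.sub continuousOn_const).pow 2) fun z hz => pow_ne_zero 2 (ne z hz)
  · intro z hz
    rw [norm_inv, show 2 / ‖w - a‖ = (‖w - a‖ / 2)⁻¹ from (inv_div _ _).symm]
    exact inv_anti₀ (by positivity) (key z hz).2
  · intro z hz
    rw [norm_div, norm_pow, norm_neg, norm_one]
    obtain ⟨h1, h2⟩ := key z hz
    have h3 : 1 / ‖z - w‖ ^ 2 ≤ 1 / (‖w - a‖ / 2) ^ 2 := by gcongr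
    calc 1 / ‖z - w‖ ^ 2 * ‖z - a‖ ≤ 1 / (‖w - a‖ / 2) ^ 2 * (‖w - a‖ / 2) := by gcongr
      _ = 2 / ‖w - a‖ := by field_simp

theorem circle_inv_zero {a w : ℂ} {ε : ℝ} (hε : 0 < ε) (h : ε < ‖w - a‖) : ∮ z in C(a, ε), (z - w)⁻¹ = 0 := by
  have ne : ∀ z ∈ Metric.closedBall a ε, z - w ≠ 0 := by
    intro z hz h0
    rw [mem_closedBall_iff_norm, sub_eq_zero.1 h0] at hz
    linarith
  refine circleIntegral_eq_zero_of_differentiable_on_off_countable hε.le countable_empty ?_ ?_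
  · exact (continuousOn_id.sub continuousOn_const).inv₀ ne
  · intro z hz
    exact ((differentiableAt_id).sub_const w).inv (ne z (Metric.ball_subset_closedBall hz.1))

theorem annulus_cauchy {G : ℂ → ℂ} {a w : ℂ} {ε ρ : ℝ} (hε : 0 < ε) (h1 : ε < ‖w - a‖) (h2 : ‖w - a‖ < ρ)
    {U : Set ℂ} (hU : IsOpen U) (hG : DifferentiableOn ℂ G U) (hsub : Metric.closedBall a ρ \ Metric.ball a ε ⊆ U) :
    (∮ z in C(a, ρ), (z - w)⁻¹ * G z) = 2 * Real.pi * I * G w + ∮ z in C(a, ε), (z - w)⁻¹ * G z := by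
  have hρ : 0 < ρ := hε.trans (h1.trans h2)
  have hwU : w ∈ U := hsub ⟨by rw [mem_closedBall_iff_norm]; exact h2.le, by rw [mem_ball_iff_norm]; linarith⟩
  have hU' : U ∈ 𝓝 w := hU.mem_nhds hwU
  have hd : ContinuousOn (dslope G w) U :=
    (continuousOn_dslope hU').2 ⟨hG.continuousOn, hG.differentiableAt hU'⟩
  have h := circleIntegral_eq_of_differentiable_on_annulus_off_countable hε (h1.trans h2).le
    (countable_singleton w) (hd.mono hsub) (by
      intro z hz
      have hzU : z ∈ U := hsub ⟨Metric.ball_subset_closedBall hz.1.1, fun h => hz.1.2 (Metric.ball_subset_closedBall h)⟩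
      exact (differentiableAt_dslope_of_ne hz.2).2 (hG.differentiableAt (hU.mem_nhds hzU)))
  have aux : ∀ r, 0 < r → ‖w - a‖ ≠ r → Metric.sphere a r ⊆ U →
      (∮ z in C(a, r), dslope G w z) = (∮ z in C(a, r), (z - w)⁻¹ * G z) - (∮ z in C(a, r), (z - w)⁻¹) * G w := by
    intro r hr hne hrU
    have ne : ∀ z ∈ Metric.sphere a r, z - w ≠ 0 := by
      intro z hz h0
      rw [mem_sphere_iff_norm, sub_eq_zero.1 h0] at hz
      exact hne hz
    have ci : ContinuousOn (fun z => (z - w)⁻¹) (Metric.sphere a r) :=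
      (continuousOn_id.sub continuousOn_const).inv₀ ne
    have cG := hG.continuousOn.mono hrU
    have e : (∮ z in C(a, r), dslope G w z) = ∮ z in C(a, r), ((z - w)⁻¹ * G z - (z - w)⁻¹ * G w) := by
      refine circleIntegral.integral_congr hr.le fun z hz => ?_
      have hzw : z ≠ w := sub_ne_zero.1 (ne z hz)
      simp only [dslope_of_ne _ hzw, slope_def_module, smul_eq_mul, mul_sub]
    have i1 : CircleIntegrable (fun z => (z - w)⁻¹ * G z) a r := (ci.mul cG).circleIntegrable hr.le
    have i2 : CircleIntegrable (fun z => (z - w)⁻¹ * G w) a r :=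
      (ci.mul continuousOn_const).circleIntegrable hr.le
    rw [e, circleIntegral.integral_sub i1 i2]
    congr 1
    have := circleIntegral.integral_const_mul (G w) (fun z => (z - w)⁻¹) a r
    simp only [mul_comm (G w)] at this
    exact this
  rw [aux ρ hρ h2.ne (fun z hz => hsub ?_), aux ε hε h1.ne' (fun z hz => hsub ?_), circle_inv_zero hε h1,
    circleIntegral.integral_sub_inv_of_mem_ball (by rw [mem_ball_iff_norm]; exact h2)] at h
  · linear_combination h
  · rw [mem_sphere_iff_norm] at hz
    refine ⟨?_, ?_⟩
    · rw [mem_closedBall_iff_norm]; linarith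
    · rw [mem_ball_iff_norm]; linarith
  · rw [mem_sphere_iff_norm] at hz
    refine ⟨?_, ?_⟩
    · rw [mem_closedBall_iff_norm]; linarith
    · rw [mem_ball_iff_norm]; linarith

theorem removable_of_circles {G : ℂ → ℂ} {a : ℂ} {R : ℝ} (hR : 0 < R)
    (hG : DifferentiableOn ℂ G (Metric.ball a R \ {a}))
    (hc : ∀ w ∈ Metric.ball a R \ {a}, ∃ ε, 0 < ε ∧ ε < ‖w - a‖ ∧ ∮ z in C(a, ε), (z - w)⁻¹ * G z = 0) :
    ∃ G' : ℂ → ℂ, AnalyticAt ℂ G' a ∧ ∀ᶠ z in 𝓝[≠] a, G z = G' z := by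
  have hU : IsOpen (Metric.ball a R \ {a}) := Metric.isOpen_ball.sdiff isClosed_singleton
  have hsph : Metric.sphere a (R / 2) ⊆ Metric.ball a R \ {a} := by
    intro z hz
    rw [mem_sphere_iff_norm] at hz
    refine ⟨by rw [mem_ball_iff_norm]; linarith, ?_⟩
    rintro rfl
    rw [sub_self, norm_zero] at hz; linarith
  have hR2 : ((R / 2).toNNReal : ℝ) = R / 2 := Real.coe_toNNReal _ (by positivity)
  have hci : CircleIntegrable G a ((R / 2).toNNReal : ℝ) := by
    rw [hR2]
    exact (hG.continuousOn.mono hsph).circleIntegrable (by positivity)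
  have hA := hasFPowerSeriesOn_cauchy_integral hci (by
    rw [← NNReal.coe_pos, hR2]; positivity)
  rw [hR2] at hA
  refine ⟨_, hA.analyticAt, ?_⟩
  have : Metric.ball a (R / 2) \ {a} ∈ 𝓝[≠] a := by
    rw [sdiff_eq, inter_comm]
    exact inter_mem_nhdsWithin _ (Metric.ball_mem_nhds a (by positivity))
  filter_upwards [this] with w hw
  have hw1 : ‖w - a‖ < R / 2 := by have := hw.1; rwa [mem_ball_iff_norm] at this
  obtain ⟨ε, he, he1, h0⟩ := hc w ⟨by rw [mem_ball_iff_norm]; linarith, hw.2⟩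
  have h := annulus_cauchy he he1 hw1 hU hG (by
    intro z hz
    have h1 := hz.1
    have h2 := hz.2
    rw [mem_closedBall_iff_norm] at h1
    rw [mem_ball_iff_norm] at h2
    refine ⟨by rw [mem_ball_iff_norm]; linarith, ?_⟩
    rintro rfl
    rw [sub_self, norm_zero] at h2; exact h2 he)
  rw [h0, add_zero] at h
  show G w = (2 * Real.pi * I : ℂ)⁻¹ • ∮ z in C(a, R / 2), (z - w)⁻¹ • G z
  simp only [smul_eq_mul]
  rw [h]
  have : (2 * Real.pi * I : ℂ) ≠ 0 := by simp [Real.pi_ne_zero]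
  field_simp

theorem real_val {f : ℂ → ℂ} {a : ℝ} (hf : ContinuousAt f a) (h : ∀ᶠ x : ℝ in 𝓝[≠] a, (f x).im = 0) :
    (f a).im = 0 := by
  have h1 : Tendsto (fun x : ℝ => (f x).im) (𝓝[≠] a) (𝓝 (f a).im) := by
    have hx : Tendsto (fun x : ℝ => (x:ℂ)) (𝓝 a) (𝓝 (a:ℂ)) := continuous_ofReal.tendsto a
    exact ((continuous_im.tendsto _).comp (hf.tendsto.comp hx)).mono_left nhdsWithin_le_nhds
  exact tendsto_nhds_unique (h1.congr' h) tendsto_const_nhds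

theorem AnalyticAt_dslope {f : ℂ → ℂ} {a : ℂ} (hf : AnalyticAt ℂ f a) : AnalyticAt ℂ (dslope f a) a := by
  obtain ⟨p, hp⟩ := hf
  exact ⟨_, hp.has_fpower_series_dslope_fslope⟩

theorem tendsto_ofReal_punct (a : ℝ) : Tendsto (fun x : ℝ => (x:ℂ)) (𝓝[≠] a) (𝓝[≠] (a:ℂ)) := by
  refine tendsto_nhdsWithin_iff.2 ⟨(continuous_ofReal.tendsto a).mono_left nhdsWithin_le_nhds, ?_⟩
  filter_upwards [self_mem_nhdsWithin] with x hx
  simpa using hx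

section
variable {v : ℂ → ℝ} {V Q : ℂ → ℂ} {S : Set ℂ} {c0 a X : ℝ}

theorem EndD.ball_En {X : ℝ} {z : ℂ} (hz : z ∈ Metric.ball (a:ℂ) (Real.exp X) \ {(a:ℂ)}) : z ∈ En a 1 X := by
  refine ⟨hz.2, ?_⟩
  rw [one_mul]
  have h1 := hz.1
  rw [mem_ball_iff_norm] at h1
  have := Real.log_lt_log (norm_pos_iff.2 (sub_ne_zero.2 hz.2)) h1
  rwa [Real.log_exp] at this

theorem EndD.removable (h : EndD v V Q S c0 a 1 X) :
    ∃ G : ℂ → ℂ, AnalyticAt ℂ G a ∧ ∀ᶠ z in 𝓝[≠] (a:ℂ), (z - a) ^ 2 * Qx Q z = G z := by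
  refine removable_of_circles (Real.exp_pos X) ?_ ?_
  · exact ((differentiableOn_id.sub_const _).pow 2).mul
      (h.sol.holoQx.mono fun z hz => h.nS z (EndD.ball_En hz))
  · intro w hw
    have hδ : 0 < ‖w - a‖ := norm_pos_iff.2 (sub_ne_zero.2 hw.2)
    set X' := min X (Real.log (‖w - a‖ / 2)) with hX'
    have hk := KT_inv_pos (X := X') hw.2 (min_le_right _ _)
    have hz := (h.mono (min_le_left _ _)).circle_pos hk (x := X' - 1) (by linarith)
    have hlt : Real.exp (X' - 1) < ‖w - a‖ := by
      have : Real.exp (X' - 1) < Real.exp (Real.log (‖w - a‖ / 2)) :=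
        Real.exp_lt_exp.2 (by have := min_le_right X (Real.log (‖w - a‖ / 2)); linarith)
      rw [Real.exp_log (by positivity)] at this
      linarith
    refine ⟨Real.exp (X' - 1), Real.exp_pos _, hlt, ?_⟩
    have hE : ∀ z ∈ Metric.sphere (a:ℂ) (Real.exp (X' - 1)), z ∈ En a 1 X' := fun z hz =>
      En_sphere (x := X' - 1) (Or.inl rfl) (by linarith) (by simpa using hz)
    have cQ : ContinuousOn (Qx Q) (Metric.sphere (a:ℂ) (Real.exp (X' - 1))) :=
      (h.mono (min_le_left _ _)).cQx.mono hE
    have ck := hk.cont.mono hE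
    have e : ∀ z : ℂ, (z - w)⁻¹ * ((z - a) ^ 2 * Qx Q z) =
        ((z - a) ^ 2 * Qx Q z - 1 / 2) * (z - w)⁻¹ + 1 / 2 * (z - w)⁻¹ := by intro z; ring
    simp only [e]
    rw [circleIntegral.integral_add, hz, circleIntegral.integral_const_mul,
      circle_inv_zero (Real.exp_pos _) hlt]
    · simp
    · exact ContinuousOn.circleIntegrable (Real.exp_pos _).le
        (((((continuousOn_id.sub continuousOn_const).pow 2).mul cQ).sub continuousOn_const).mul ck)
    · exact ContinuousOn.circleIntegrable (Real.exp_pos _).le (continuousOn_const.mul ck)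

theorem EndD.local_form (h : EndD v V Q S c0 a 1 X) :
    ∃ α β : ℝ, ∃ E : ℂ → ℂ, α ≤ 1 / 2 ∧ AnalyticAt ℂ E a ∧
      ∀ᶠ z in 𝓝[≠] (a:ℂ), Qx Q z = α / (z - a) ^ 2 + β / (z - a) + E z := by
  obtain ⟨G, hG, hGe⟩ := h.removable
  have hU : ∀ᶠ z in 𝓝[≠] (a:ℂ), z ∈ En a 1 X := by
    have : Metric.ball (a:ℂ) (Real.exp X) \ {(a:ℂ)} ∈ 𝓝[≠] (a:ℂ) := by
      rw [sdiff_eq, inter_comm]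
      exact inter_mem_nhdsWithin _ (Metric.ball_mem_nhds _ (Real.exp_pos X))
    filter_upwards [this] with z hz using EndD.ball_En hz
  have hGr : ∀ᶠ x : ℝ in 𝓝[≠] a, (G x).im = 0 := by
    filter_upwards [(tendsto_ofReal_punct a).eventually hGe, (tendsto_ofReal_punct a).eventually hU] with x hx hxU
    rw [← hx]
    have := h.sol.Qx_conj (h.nS _ hxU)
    rw [conj_ofReal] at this
    refine conj_eq_iff_im.1 ?_
    rw [map_mul, ← this]
    simp
  have ha := real_val hG.continuousAt hGr
  have hD := AnalyticAt_dslope hG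
  have hE := AnalyticAt_dslope hD
  have hDr : ∀ᶠ x : ℝ in 𝓝[≠] a, (dslope G a x).im = 0 := by
    filter_upwards [hGr, self_mem_nhdsWithin] with x hx hxa
    have hxa' : (x:ℂ) ≠ a := by simpa using hxa
    rw [dslope_of_ne _ hxa', slope_def_module, smul_eq_mul, ← ofReal_sub, ← ofReal_inv, im_ofReal_mul]
    simp [hx, ha]
  have hb := real_val hD.continuousAt hDr
  have e1 : G a = ((G a).re : ℂ) := of_im_zero ha
  have e2 : dslope G a a = ((dslope G a a).re : ℂ) := of_im_zero hb
  refine ⟨(G a).re, (dslope G a a).re, dslope (dslope G a) a, ?_, hE, ?_⟩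
  · have hL : Tendsto (fun x : ℝ => (pq a 1 Q x).re) atBot (𝓝 ((G a).re - 1 / 2)) := by
      have t1 : Tendsto (fun x : ℝ => phi a 1 x) atBot (𝓝[≠] (a:ℂ)) := by
        refine tendsto_nhdsWithin_iff.2 ⟨?_, Eventually.of_forall fun x => phi_ne (Or.inl rfl) _⟩
        have : Tendsto (fun x : ℝ => ((a + Real.exp x : ℝ) : ℂ)) atBot (𝓝 ((a + 0 : ℝ) : ℂ)) :=
          (continuous_ofReal.tendsto _).comp (tendsto_const_nhds.add Real.tendsto_exp_atBot)
        rw [add_zero] at this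
        refine this.congr fun x => ?_
        simp [phi, pp]
      have t2 : Tendsto (fun x : ℝ => (G (phi a 1 x)).re - 1 / 2) atBot (𝓝 ((G a).re - 1 / 2)) :=
        ((continuous_re.tendsto _).comp (hG.continuousAt.tendsto.comp (t1.mono_right nhdsWithin_le_nhds))).sub_const _
      refine t2.congr' ?_
      filter_upwards [t1.eventually hGe] with x hx
      rw [← hx, pq]
      have hup : 0 ≤ (phi a 1 (x:ℂ)).im := by rw [phi_im (Or.inl rfl)]; simp
      rw [Qx_up hup]
      have : phi a 1 (x:ℂ) - a = pp 1 x := by simp [phi]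
      rw [this, sub_re]
      norm_num
    have := h.st.sturm hL
    linarith
  · filter_upwards [hGe, self_mem_nhdsWithin] with z hz hza
    have hza' : z ≠ a := hza
    have hne : z - a ≠ 0 := sub_ne_zero.2 hza'
    rw [← e1, ← e2, dslope_of_ne _ hza', slope_def_module, dslope_of_ne _ hza', slope_def_module, smul_eq_mul, smul_eq_mul, ← hz]
    field_simp
    ring
end

end Part18

section Part19
open scoped Topology Interval

theorem ev_sphere {p : ℂ → Prop} (h : ∀ᶠ z in Bornology.cobounded ℂ, p z) :
    ∀ᶠ R : ℝ in atTop, ∀ z ∈ Metric.sphere (0:ℂ) R, p z := by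
  obtain ⟨r, -, hr⟩ := hasBasis_cobounded_norm.eventually_iff.1 h
  filter_upwards [eventually_ge_atTop r] with R hR z hz
  refine hr ?_
  rw [mem_sphere_iff_norm, sub_zero] at hz
  show r ≤ ‖z‖
  linarith

theorem ev_ge_cob (c : ℝ) : ∀ᶠ z in Bornology.cobounded ℂ, c ≤ ‖z‖ :=
  tendsto_norm_cobounded_atTop.eventually_ge_atTop c

theorem entire_ext {H : ℂ → ℂ} {S : Set ℂ} (hS : S.Finite) (hH : DifferentiableOn ℂ H Sᶜ)
    (hl : ∀ s ∈ S, ∃ c, Tendsto H (𝓝[≠] s) (𝓝 c)) :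
    ∃ F : ℂ → ℂ, Differentiable ℂ F ∧ ∀ z ∉ S, F z = H z := by
  classical
  set F : ℂ → ℂ := fun z => if z ∈ S then limUnder (𝓝[≠] z) H else H z with hF
  have hFo : ∀ z ∉ S, F z = H z := fun z hz => if_neg hz
  have hop : IsOpen Sᶜ := hS.isClosed.isOpen_compl
  have hd : ∀ z ∉ S, DifferentiableAt ℂ F z := by
    intro z hz
    have h1 : DifferentiableAt ℂ H z := hH.differentiableAt (hop.mem_nhds hz)
    refine h1.congr_of_eventuallyEq ?_
    filter_upwards [hop.mem_nhds hz] with w hw using hFo w hw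
  refine ⟨F, ?_, hFo⟩
  intro z
  by_cases hz : z ∈ S
  · have hp : ∀ᶠ w in 𝓝[≠] z, w ∉ S := by
      have h1 : (S \ {z})ᶜ ∈ 𝓝 z := (hS.subset sdiff_subset).isClosed.isOpen_compl.mem_nhds (by simp)
      filter_upwards [mem_nhdsWithin_of_mem_nhds h1, self_mem_nhdsWithin] with w hw hwz hwS
      exact hw ⟨hwS, hwz⟩
    refine (analyticAt_of_differentiable_on_punctured_nhds_of_continuousAt (hp.mono hd) ?_).differentiableAt
    rw [continuousAt_iff_punctured_nhds]
    obtain ⟨c, hc⟩ := hl z hz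
    have : F z = c := by
      rw [hF]; simp only [hz, if_true]
      exact hc.limUnder_eq
    rw [this]
    refine hc.congr' ?_
    filter_upwards [hp] with w hw using (hFo w hw).symm
  · exact hd z hz

theorem tendsto_ratio (q : ℂ) : Tendsto (fun z : ℂ => z / (z - q)) (Bornology.cobounded ℂ) (𝓝 1) := by
  have h1 : Tendsto (fun z : ℂ => (z - q)⁻¹) (Bornology.cobounded ℂ) (𝓝 0) :=
    tendsto_inv₀_cobounded.comp (tendsto_sub_const_cobounded q)
  have h2 : Tendsto (fun z : ℂ => 1 + q * (z - q)⁻¹) (Bornology.cobounded ℂ) (𝓝 1) := by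
    simpa using (h1.const_mul q).const_add 1
  refine h2.congr' ?_
  have hne : ∀ᶠ z in Bornology.cobounded ℂ, z ≠ q := by
    filter_upwards [ev_ge_cob (‖q‖ + 1)] with z hz h
    rw [h] at hz; linarith
  filter_upwards [hne] with z hz
  have : z - q ≠ 0 := sub_ne_zero.2 hz
  field_simp; ring

/-- the rational function -/
noncomputable def PP {m : ℕ} (q α β : Fin m → ℝ) (z : ℂ) : ℂ :=
  ∑ i, (((α i : ℝ) : ℂ) / (z - (q i : ℂ)) ^ 2 + ((β i : ℝ) : ℂ) / (z - (q i : ℂ)))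

section
variable {m : ℕ} {q α β : Fin m → ℝ}

theorem ev_ne_cob (q : ℂ) : ∀ᶠ z in Bornology.cobounded ℂ, z ≠ q := by
  filter_upwards [ev_ge_cob (‖q‖ + 1)] with z hz h
  rw [h] at hz; linarith

theorem PP_lim : Tendsto (fun z : ℂ => z ^ 2 * (PP q α β z - ((∑ i, β i : ℝ) : ℂ) / z)) (Bornology.cobounded ℂ)
    (𝓝 ((∑ i, (α i + q i * β i) : ℝ) : ℂ)) := by
  have h1 : Tendsto (fun z : ℂ => ∑ i, ((α i : ℂ) * (z / (z - q i)) ^ 2 + (q i * β i) * (z / (z - q i))))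
      (Bornology.cobounded ℂ) (𝓝 (∑ i, ((α i : ℂ) * 1 ^ 2 + (q i * β i) * 1))) := by
    refine tendsto_finsetSum _ fun i _ => ?_
    exact (((tendsto_ratio (q i)).pow 2).const_mul _).add ((tendsto_ratio (q i)).const_mul _)
  have e : (∑ i, ((α i : ℂ) * 1 ^ 2 + (q i * β i) * 1)) = ((∑ i, (α i + q i * β i) : ℝ) : ℂ) := by
    push_cast; simp
  rw [e] at h1
  refine h1.congr' ?_
  have hne : ∀ᶠ z in Bornology.cobounded ℂ, ∀ i, z ≠ (q i : ℂ) :=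
    eventually_all.2 fun i => ev_ne_cob _
  filter_upwards [hne, ev_ne_cob 0] with z hz hz0
  rw [PP, ofReal_sum, Finset.sum_div, ← Finset.sum_sub_distrib, Finset.mul_sum]
  refine Finset.sum_congr rfl fun i _ => ?_
  have : z - q i ≠ 0 := sub_ne_zero.2 (hz i)
  field_simp
  ring

theorem PP_bound : ∃ C, ∀ᶠ z in Bornology.cobounded ℂ,
    ‖PP q α β z - 1 / 2 / z ^ 2 - ((∑ i, β i : ℝ) : ℂ) / z‖ ≤ C / ‖z‖ ^ 2 := by
  have h := (PP_lim (q := q) (α := α) (β := β)).sub_const (1/2) |>.norm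
  refine ⟨‖((∑ i, (α i + q i * β i) : ℝ) : ℂ) - 1 / 2‖ + 1, ?_⟩
  · filter_upwards [h.eventually (eventually_le_nhds (lt_add_one _)), ev_ne_cob 0] with z hz hz0
    have hzp : 0 < ‖z‖ := norm_pos_iff.2 hz0
    rw [le_div_iff₀ (by positivity), ← norm_pow, ← norm_mul]
    refine le_trans (le_of_eq ?_) hz
    congr 1
    field_simp
    ring

theorem PP_bound1 : ∃ C, ∀ᶠ z in Bornology.cobounded ℂ, ‖PP q α β z - 1 / 2 / z ^ 2‖ ≤ C / ‖z‖ := by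
  obtain ⟨C, hC⟩ := PP_bound (q := q) (α := α) (β := β)
  refine ⟨|C| + ‖((∑ i, β i : ℝ) : ℂ)‖, ?_⟩
  filter_upwards [hC, ev_ge_cob 1] with z hz hz1
  have : 0 < ‖z‖ := by linarith
  have h1 : ‖PP q α β z - 1 / 2 / z ^ 2‖ ≤ ‖PP q α β z - 1 / 2 / z ^ 2 - ((∑ i, β i : ℝ) : ℂ) / z‖
      + ‖((∑ i, β i : ℝ) : ℂ) / z‖ := by
    have := norm_add_le (PP q α β z - 1 / 2 / z ^ 2 - ((∑ i, β i : ℝ) : ℂ) / z) (((∑ i, β i : ℝ) : ℂ) / z)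
    rwa [sub_add_cancel] at this
  rw [norm_div] at h1
  have h2 : C / ‖z‖ ^ 2 ≤ |C| / ‖z‖ := by
    calc C / ‖z‖ ^ 2 ≤ |C| / ‖z‖ ^ 2 := by gcongr; exact le_abs_self C
      _ ≤ |C| / ‖z‖ := by gcongr; nlinarith
  rw [add_div]
  linarith

theorem PP_diff {z : ℂ} (hz : z ∉ range fun i => (q i : ℂ)) : DifferentiableAt ℂ (PP q α β) z := by
  have hne : ∀ i, z - q i ≠ 0 := fun i => sub_ne_zero.2 fun h => hz ⟨i, h.symm⟩
  unfold PP
  refine DifferentiableAt.fun_sum fun i _ => ?_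
  have h1 : DifferentiableAt ℂ (fun z : ℂ => z - q i) z := differentiableAt_id.sub_const _
  have h2 : DifferentiableAt ℂ (fun z : ℂ => (z - q i) ^ 2) z := h1.pow 2
  exact ((differentiableAt_const _).div h2 (pow_ne_zero 2 (hne i))).add
    ((differentiableAt_const _).div h1 (hne i))

theorem PP_local (hq : Function.Injective q) (i : Fin m) : ∃ c, Tendsto (fun z => PP q α β z -
    ((α i:ℂ) / (z - q i) ^ 2 + (β i:ℂ) / (z - q i))) (𝓝[≠] (q i:ℂ)) (𝓝 c) := by
  classical
  have hne : ∀ j ∈ Finset.univ.erase i, (q i : ℂ) - q j ≠ 0 := by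
    intro j hj h
    have : q i = q j := by exact_mod_cast sub_eq_zero.1 h
    exact (Finset.ne_of_mem_erase hj) (hq this).symm
  have hc : ContinuousAt (fun z => ∑ j ∈ Finset.univ.erase i, ((α j:ℂ) / (z - q j) ^ 2 + (β j:ℂ) / (z - q j))) (q i : ℂ) := by
    refine tendsto_finsetSum _ fun j hj => ?_
    exact ((continuousAt_const.div ((continuousAt_id.sub continuousAt_const).pow 2) (pow_ne_zero 2 (hne j hj))).add
      (continuousAt_const.div (continuousAt_id.sub continuousAt_const) (hne j hj)))
  refine ⟨_, (hc.tendsto.mono_left nhdsWithin_le_nhds).congr fun z => ?_⟩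
  rw [PP, ← Finset.add_sum_erase _ _ (Finset.mem_univ i)]
  ring
end

theorem KT_one (a σ X : ℝ) : KT (fun _ => 1) (fun _ => 0) a σ X 1 :=
  ⟨fun z _ => hasDerivAt_const z 1, continuousOn_const, fun z _ => by simp, fun z _ => by simp⟩

theorem KT_inv_neg {X : ℝ} {w : ℂ} (hX : X ≤ -Real.log (‖w‖ + 1)) :
    KT (fun z => (z - w)⁻¹) (fun z => -1 / (z - w) ^ 2) 0 (-1) X (1 + ‖w‖) := by
  have key : ∀ z ∈ En 0 (-1) X, 1 ≤ ‖z - w‖ ∧ ‖z‖ ≤ ‖z - w‖ + ‖w‖ := by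
    intro z hz
    have hz0 : z ≠ 0 := by simpa using hz.1
    have hz1 : 0 < ‖z‖ := norm_pos_iff.2 hz0
    have h1 : ‖w‖ + 1 < ‖z‖ := by
      have := hz.2
      rw [ofReal_zero, sub_zero] at this
      exact (Real.log_lt_log_iff (by positivity) hz1).1 (by linarith)
    have h2 : ‖z‖ ≤ ‖z - w‖ + ‖w‖ := by
      have := norm_add_le (z - w) w
      rwa [sub_add_cancel] at this
    exact ⟨by linarith, h2⟩
  have ne : ∀ z ∈ En 0 (-1) X, z - w ≠ 0 := fun z hz => by
    have := (key z hz).1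
    exact norm_pos_iff.1 (by linarith)
  refine ⟨?_, ?_, ?_, ?_⟩
  · intro z hz
    exact ((hasDerivAt_id z).sub_const w).inv (ne z hz)
  · exact continuousOn_const.div ((continuousOn_id.sub continuousOn_const).pow 2) fun z hz => pow_ne_zero 2 (ne z hz)
  · intro z hz
    rw [norm_inv]
    have := inv_le_one_of_one_le₀ (key z hz).1
    linarith [norm_nonneg w]
  · intro z hz
    rw [norm_div, norm_pow, norm_neg, norm_one, ofReal_zero, sub_zero]
    obtain ⟨h1, h2⟩ := key z hz
    rw [div_mul_eq_mul_div, one_mul, div_le_iff₀ (by positivity)]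
    nlinarith [norm_nonneg w, mul_nonneg (norm_nonneg w) (sub_nonneg.2 h1), sq_nonneg (‖z - w‖ - 1)]

theorem EndD.ev_circle {v : ℂ → ℝ} {V Q : ℂ → ℂ} {S : Set ℂ} {c0 X : ℝ} (h : EndD v V Q S c0 0 (-1) X)
    {k k' : ℂ → ℂ} {C X1 : ℝ} (hk : KT k k' 0 (-1) X1 C) :
    ∀ᶠ R : ℝ in atTop, ∮ z in C(0, R), (Qx Q z - 1 / 2 / z ^ 2) * k z = 0 := by
  filter_upwards [eventually_gt_atTop (Real.exp (-(min X X1)))] with R hR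
  have hR0 : 0 < R := (Real.exp_pos _).trans hR
  have h1 := (h.mono (min_le_left X X1)).circle_neg (hk.mono (min_le_right X X1)) (x := -Real.log R) (by
    have := Real.log_lt_log (Real.exp_pos _) hR
    rw [Real.log_exp] at this
    linarith)
  rwa [neg_neg, Real.exp_log hR0] at h1

theorem zero_of_ev {c : ℂ} {f : ℝ → ℝ} (h : ∀ᶠ R in atTop, ‖c‖ ≤ f R) (hf : Tendsto f atTop (𝓝 0)) : c = 0 :=
  norm_le_zero_iff.1 (ge_of_tendsto hf h)

theorem Sol.exX {v : ℂ → ℝ} {V Q : ℂ → ℂ} {S : Set ℂ} {c0 : ℝ} (hs : Sol v V Q S c0) (a : ℝ) {σ : ℝ}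
    (hσ : σ = 1 ∨ σ = -1) : ∃ X, EndD v V Q S c0 a σ X := by
  obtain ⟨X1, hX1⟩ := (hs.Sfin.image fun s : ℂ => σ * Real.log ‖s - a‖).bddBelow
  exact hs.endD (X1 := X1) hσ fun s hsS => Or.inr (hX1 ⟨s, hsS, rfl⟩)

theorem Sol.assembly {v : ℂ → ℝ} {V Q : ℂ → ℂ} {c0 : ℝ} {m : ℕ} {q : Fin m → ℝ} (hq : Function.Injective q)
    (hs : Sol v V Q (range fun i => (q i : ℂ)) c0) :
    ∃ α β : Fin m → ℝ, (∀ i, α i ≤ 1 / 2) ∧ (∑ i, β i = 0) ∧ (∑ i, (α i + q i * β i) ≤ 1 / 2) ∧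
      ∀ z ∉ (range fun i => (q i : ℂ)), Qx Q z = PP q α β z := by
  have hloc : ∀ i, ∃ α β : ℝ, ∃ E : ℂ → ℂ, α ≤ 1 / 2 ∧ AnalyticAt ℂ E (q i) ∧
      ∀ᶠ z in 𝓝[≠] (q i:ℂ), Qx Q z = α / (z - q i) ^ 2 + β / (z - q i) + E z := by
    intro i
    obtain ⟨X, hX⟩ := hs.exX (q i) (Or.inl rfl)
    exact hX.local_form
  choose α β E hα hE hQ using hloc
  obtain ⟨X, hX⟩ := hs.exX 0 (Or.inr rfl)
  set S := range fun i => (q i : ℂ) with hS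
  have hop : IsOpen Sᶜ := hs.Sclosed.isOpen_compl
  have hPd : DifferentiableOn ℂ (PP q α β) Sᶜ := fun z hz => (PP_diff hz).differentiableWithinAt
  obtain ⟨F, hF, hFH⟩ := entire_ext (H := fun z => Qx Q z - PP q α β z) hs.Sfin (hs.holoQx.sub hPd) (by
    rintro s ⟨i, rfl⟩
    obtain ⟨c, hc⟩ := PP_local (α := α) (β := β) hq i
    refine ⟨E i (q i) - c, ?_⟩
    have := ((hE i).continuousAt.tendsto.mono_left nhdsWithin_le_nhds).sub hc
    refine this.congr' ?_
    filter_upwards [hQ i] with z hz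
    rw [hz]; ring)
  have evS : ∀ᶠ z in Bornology.cobounded ℂ, z ∉ S := by
    have : ∀ᶠ z in Bornology.cobounded ℂ, ∀ i, z ≠ (q i : ℂ) := eventually_all.2 fun i => ev_ne_cob _
    filter_upwards [this] with z hz
    rintro ⟨i, rfl⟩
    exact hz i rfl
  have hF0 : ∀ w, F w = 0 := by
    intro w
    obtain ⟨C, hC⟩ := PP_bound1 (q := q) (α := α) (β := β)
    have h1 := hX.ev_circle (KT_inv_neg (w := w) le_rfl)
    have hmul : (2 * Real.pi * I : ℂ) * F w = 0 := by
      refine zero_of_ev (f := fun R => 2 * Real.pi * |C| * (R - ‖w‖)⁻¹) ?_ ?_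
      · filter_upwards [h1, ev_sphere hC, ev_sphere evS, eventually_gt_atTop (‖w‖ + 1)] with R h1 hC hSR hR
        have hR0 : 0 < R := by linarith [norm_nonneg w]
        have hRw : 0 < R - ‖w‖ := by linarith
        have hw : ∀ z ∈ Metric.sphere (0:ℂ) R, R - ‖w‖ ≤ ‖z - w‖ := by
          intro z hz
          rw [mem_sphere_iff_norm, sub_zero] at hz
          have := norm_sub_norm_le z w
          linarith
        have hcau := (hF.diffContOnCl (s := Metric.ball 0 R)).circleIntegral_sub_inv_smul (w := w)
          (by rw [mem_ball_iff_norm, sub_zero]; linarith)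
        simp only [smul_eq_mul] at hcau
        have ci : ContinuousOn (fun z => (z - w)⁻¹) (Metric.sphere 0 R) :=
          (continuousOn_id.sub continuousOn_const).inv₀ fun z hz => norm_pos_iff.1 (hRw.trans_le (hw z hz))
        have cz : ContinuousOn (fun z : ℂ => 1 / 2 / z ^ 2) (Metric.sphere 0 R) :=
          continuousOn_const.div (continuousOn_id.pow 2) fun z hz => pow_ne_zero 2 (by
            rintro rfl
            rw [mem_sphere_iff_norm] at hz; simp at hz; linarith)
        have cQ : ContinuousOn (Qx Q) (Metric.sphere 0 R) := hs.holoQx.continuousOn.mono hSR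
        have cF : ContinuousOn F (Metric.sphere 0 R) := hF.continuous.continuousOn
        have i1 : CircleIntegrable (fun z => (z - w)⁻¹ * F z) 0 R := (ci.mul cF).circleIntegrable hR0.le
        have i2 : CircleIntegrable (fun z => (Qx Q z - 1 / 2 / z ^ 2) * (z - w)⁻¹) 0 R :=
          ((cQ.sub cz).mul ci).circleIntegrable hR0.le
        have hsub := circleIntegral.integral_sub i1 i2
        rw [h1, sub_zero] at hsub
        rw [← hcau, ← hsub]
        refine (circleIntegral.norm_integral_le_of_norm_le_const (C := |C| / R * (R - ‖w‖)⁻¹) hR0.le ?_).trans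
          (le_of_eq ?_)
        · intro z hz
          have e : (z - w)⁻¹ * F z - (Qx Q z - 1 / 2 / z ^ 2) * (z - w)⁻¹ =
              -((PP q α β z - 1 / 2 / z ^ 2) * (z - w)⁻¹) := by rw [hFH z (hSR z hz)]; ring
          rw [e, norm_neg, norm_mul, norm_inv]
          have h3 := hC z hz
          have h4 := hw z hz
          rw [mem_sphere_iff_norm, sub_zero] at hz
          rw [hz] at h3
          have h5 : ‖PP q α β z - 1 / 2 / z ^ 2‖ ≤ |C| / R := h3.trans (by gcongr; exact le_abs_self C)
          gcongr
        · field_simp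
      · have t : Tendsto (fun R : ℝ => (R - ‖w‖)⁻¹) atTop (𝓝 0) :=
          tendsto_inv_atTop_zero.comp (tendsto_atTop_add_const_right _ _ tendsto_id)
        simpa using t.const_mul (2 * Real.pi * |C|)
    have : (2 * Real.pi * I : ℂ) ≠ 0 := by simp [Real.pi_ne_zero]
    exact (mul_eq_zero.1 hmul).resolve_left this
  have hQP : ∀ z ∉ S, Qx Q z = PP q α β z := by
    intro z hz
    have := hFH z hz
    rw [hF0 z] at this
    exact (sub_eq_zero.1 this.symm)
  have hB : ∑ i, β i = 0 := by
    obtain ⟨C, hC⟩ := PP_bound (q := q) (α := α) (β := β)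
    have h1 := hX.ev_circle (KT_one 0 (-1) X)
    set B := ∑ i, β i with hBdef
    have hmul : (2 * Real.pi * I : ℂ) * (B:ℂ) = 0 := by
      refine zero_of_ev (f := fun R => 2 * Real.pi * |C| * R⁻¹) ?_ ?_
      · filter_upwards [h1, ev_sphere hC, ev_sphere evS, eventually_gt_atTop 0] with R h1 hC hSR hR0
        have hz0 : ∀ z ∈ Metric.sphere (0:ℂ) R, z ≠ 0 := by
          intro z hz
          rintro rfl
          rw [mem_sphere_iff_norm] at hz; simp at hz; linarith
        have hcau := circleIntegral.integral_sub_center_inv (0:ℂ) hR0.ne'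
        have ci : ContinuousOn (fun z : ℂ => (B:ℂ) * (z - 0)⁻¹) (Metric.sphere 0 R) :=
          continuousOn_const.mul ((continuousOn_id.sub continuousOn_const).inv₀ fun z hz => by
            simpa using hz0 z hz)
        have cz : ContinuousOn (fun z : ℂ => 1 / 2 / z ^ 2) (Metric.sphere 0 R) :=
          continuousOn_const.div (continuousOn_id.pow 2) fun z hz => pow_ne_zero 2 (hz0 z hz)
        have cQ : ContinuousOn (Qx Q) (Metric.sphere 0 R) := hs.holoQx.continuousOn.mono hSR
        have i1 : CircleIntegrable (fun z : ℂ => (B:ℂ) * (z - 0)⁻¹) 0 R := ci.circleIntegrable hR0.le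
        have i2 : CircleIntegrable (fun z => (Qx Q z - 1 / 2 / z ^ 2) * 1) 0 R :=
          ((cQ.sub cz).mul continuousOn_const).circleIntegrable hR0.le
        have hsub := circleIntegral.integral_sub i1 i2
        rw [h1, sub_zero] at hsub
        rw [← hcau, mul_comm, ← circleIntegral.integral_const_mul, ← hsub]
        refine (circleIntegral.norm_integral_le_of_norm_le_const (C := |C| / R ^ 2) hR0.le ?_).trans
          (le_of_eq ?_)
        · intro z hz
          have e : (B:ℂ) * (z - 0)⁻¹ - (Qx Q z - 1 / 2 / z ^ 2) * 1 =
              -(PP q α β z - 1 / 2 / z ^ 2 - B / z) := by rw [hQP z (hSR z hz)]; simp; ring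
          rw [e, norm_neg]
          have h3 := hC z hz
          rw [mem_sphere_iff_norm, sub_zero] at hz
          rw [hz] at h3
          exact h3.trans (by gcongr; exact le_abs_self C)
        · field_simp
      · simpa using (tendsto_inv_atTop_zero (𝕜 := ℝ)).const_mul (2 * Real.pi * |C|)
    have : (2 * Real.pi * I : ℂ) ≠ 0 := by simp [Real.pi_ne_zero]
    exact_mod_cast (mul_eq_zero.1 hmul).resolve_left this
  refine ⟨α, β, hα, hB, ?_, hQP⟩
  have t1 : Tendsto (fun x : ℝ => phi 0 (-1) x) atBot (Bornology.cobounded ℂ) := by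
    rw [← tendsto_norm_atTop_iff_cobounded]
    have : ∀ x : ℝ, ‖phi 0 (-1) x‖ = Real.exp (-x) := by
      intro x
      have := phi_sub_norm (a := 0) (σ := -1) (Or.inr rfl) (x:ℂ)
      simpa using this
    simp only [this]
    exact Real.tendsto_exp_atTop.comp tendsto_neg_atBot_atTop
  have t2 := ((continuous_re.tendsto _).comp ((PP_lim (q := q) (α := α) (β := β)).comp t1)).sub_const (1/2)
  have := hX.st.sturm (t2.congr' ?_)
  · rw [ofReal_re] at this
    linarith
  · filter_upwards [t1.eventually evS] with x hx
    have hup : 0 ≤ (phi 0 (-1) (x:ℂ)).im := by rw [phi_im (Or.inr rfl)]; simp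
    have e2 : pp (-1) (x:ℂ) ^ 2 = phi 0 (-1) x ^ 2 := by simp [phi]
    simp only [Function.comp_apply, pq]
    rw [← Qx_up (Q := Q) hup, hQP _ hx, hB, e2, sub_re]
    norm_num

end Part19

/-- the Schwarzian map of a finite-area solution of problem (+s) with
K = 1 and boundary singularities q₁ < ⋯ < q_m is
Q(z) = Σᵢ ( αᵢ/(z−qᵢ)² + βᵢ/(z−qᵢ) ) with αᵢ ≤ 1/2, Σ βᵢ = 0 and
Σ (αᵢ + qᵢ βᵢ) ≤ 1/2. -/
theorem schwarzian_of_polygonal_solution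
    (m : ℕ) (q : Fin m → ℝ) (hq : StrictMono q)
    (c : Fin (m + 1) → ℝ) (v : ℂ → ℝ)
    (hv : IsSolutionPS 1 m q c v)
    (hfin : IntegrableOn (fun z => Real.exp (v z)) {z : ℂ | 0 < z.im}) :
    ∃ α β : Fin m → ℝ,
      (∀ i, α i ≤ 1 / 2) ∧
      (∑ i, β i = 0) ∧
      (∑ i, (α i + q i * β i) ≤ 1 / 2) ∧
      ∀ z : ℂ, 0 < z.im →
        schwarzianMap v z =
          ∑ i, (((α i : ℝ) : ℂ) / (z - (q i : ℂ)) ^ 2 +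
            ((β i : ℝ) : ℂ) / (z - (q i : ℂ))) := by
  have hs := sol_of hq hv hfin
  obtain ⟨α, β, h1, h2, h3, h4⟩ := hs.assembly hq.injective
  refine ⟨α, β, h1, h2, h3, fun z hz => ?_⟩
  have hzS : z ∉ range fun i => (q i : ℂ) := fun h => hz.ne' (hs.Sre z h)
  rw [← Qx_up (Q := schwarzianMap v) hz.le, h4 z hzS]
  rfl
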